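/- Let λ ∈ ℝ. The family of all signed graphs whose largest eigenvalue is at most λ (with the convention that the signed graph with no vertices belongs to the family) has a finite forbidden subgraph characterization if and only if λ < λ*. -/

import Mathlib

open Classical

/-- An eigenvalue of a real matrix indexed by a finite type. -/
def IsEigenvalue {V : Type*} [Fintype V] (A : Matrix V V ℝ) (μ : ℝ) : Prop :=
  ∃ v : V → ℝ, v ≠ 0 ∧ A.mulVec v = μ • v

/-- A signed graph on `n` vertices, given by its signed adjacency matrix: a symmetric real
matrix with zero diagonal and off-diagonal entries in `{-1, 0, 1}`. -/
structure SignedGraph (n : ℕ) where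
  mat : Matrix (Fin n) (Fin n) ℝ
  isSymm : mat.IsSymm
  diag_zero : ∀ i, mat i i = 0
  entries : ∀ i j, mat i j = -1 ∨ mat i j = 0 ∨ mat i j = 1

/-- `F` embeds into `G` as an induced signed subgraph. -/
def SignedEmbeds {m n : ℕ} (F : SignedGraph m) (G : SignedGraph n) : Prop :=
  ∃ f : Fin m → Fin n, Function.Injective f ∧ ∀ i j, F.mat i j = G.mat (f i) (f j)

/-- A family of signed graphs has a finite forbidden (induced) subgraph characterization. -/
def HasFiniteForbiddenCharacterizationSigned (P : ∀ n : ℕ, SignedGraph n → Prop) : Prop :=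
  ∃ (k : ℕ) (N : Fin k → ℕ) (F : ∀ i : Fin k, SignedGraph (N i)),
    ∀ (n : ℕ) (G : SignedGraph n), P n G ↔ ∀ i : Fin k, ¬ SignedEmbeds (F i) G

/-- An integral symmetric function with zero diagonal and entries in `{-1, 0, 1}`. -/
structure IsSigned {V : Type} (g : V → V → ℤ) : Prop where
  symm : ∀ i j, g i j = g j i
  diag : ∀ i, g i i = 0
  entries : ∀ i j, g i j = -1 ∨ g i j = 0 ∨ g i j = 1

/-- The matrix `c • 1 + g`. -/
noncomputable def shiftGram {V : Type} (g : V → V → ℤ) (c : ℝ) (y z : V) : ℝ :=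
  (if y = z then c else 0) + g y z

/-- The quadratic form of `c • 1 + g` evaluated at `∑ α a • e_{y a}`. -/
noncomputable def shiftQuad {V ι : Type} [Fintype ι] (g : V → V → ℤ) (c : ℝ) (y : ι → V)
    (α : ι → ℝ) : ℝ :=
  ∑ a, ∑ b, shiftGram g c (y a) (y b) * α a * α b

lemma IsSigned.shiftGram_comm {V : Type} {g : V → V → ℤ} (hg : IsSigned g) (c : ℝ) (y z : V) :
    shiftGram g c y z = shiftGram g c z y := by
  unfold shiftGram
  rw [hg.symm y z]
  by_cases h : y = z
  · simp [h]
  · rw [if_neg h, if_neg (Ne.symm h)]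

/-- The quadratic form is nonnegative on vectors with support of size at most `N`. -/
def LocallyPSD {V : Type} (g : V → V → ℤ) (c : ℝ) (N : ℕ) : Prop :=
  ∀ (ι : Type) [Fintype ι] (y : ι → V) (α : ι → ℝ), Fintype.card ι ≤ N →
    0 ≤ shiftQuad g c y α

lemma shiftQuad_sum {V ι κ : Type} [Fintype ι] [Fintype κ] {g : V → V → ℤ} (hg : IsSigned g)
    (c : ℝ) (y : ι → V) (z : κ → V) (α : ι → ℝ) (ξ : κ → ℝ) :
    shiftQuad g c (Sum.elim y z) (Sum.elim α ξ) = shiftQuad g c y α +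
      2 * ∑ r, ξ r * ∑ a, α a * shiftGram g c (z r) (y a) + shiftQuad g c z ξ := by
  unfold shiftQuad
  simp only [Fintype.sum_sum_type, Sum.elim_inl, Sum.elim_inr, Finset.sum_add_distrib]
  have h1 : ∑ a, ∑ r, shiftGram g c (y a) (z r) * α a * ξ r =
      ∑ r, ξ r * ∑ a, α a * shiftGram g c (z r) (y a) := by
    rw [Finset.sum_comm]
    refine Finset.sum_congr rfl fun r _ => ?_
    rw [Finset.mul_sum]
    refine Finset.sum_congr rfl fun a _ => ?_
    rw [hg.shiftGram_comm]; ring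
  have h2 : ∑ r, ∑ a, shiftGram g c (z r) (y a) * ξ r * α a =
      ∑ r, ξ r * ∑ a, α a * shiftGram g c (z r) (y a) := by
    refine Finset.sum_congr rfl fun r _ => ?_
    rw [Finset.mul_sum]
    refine Finset.sum_congr rfl fun a _ => ?_
    ring
  rw [h1, h2]; ring

section Ends

variable {V : Type}

/-- The integral form attached to an end: the root form `a`, or a row of `g`. -/
def endForm (g : V → V → ℤ) (a : V → ℤ) : Option V → V → ℤ
  | none, y => a y
  | some r, y => g r y

/-- The entry of `2 • 1 + g` after subtracting the contribution of the ends in `E`. -/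
noncomputable def residGram (g : V → V → ℤ) (a : V → ℤ) (E : Finset (Option V)) (y z : V) : ℤ :=
  (if y = z then 2 else 0) + g y z - ∑ w ∈ E, endForm g a w y * endForm g a w z

/-- The ends at a given level: representatives of the classes of vertices which
are attached to exactly one end of the previous level. -/
noncomputable def ends [Fintype V] [LinearOrder V] (g : V → V → ℤ) (a : V → ℤ) (lev : V → ℕ) :
    ℕ → Finset (Option V)
  | 0 => {none}
  | k + 1 => (Finset.univ.filter fun r => lev r = k + 1 ∧
      residGram g a (ends g a lev k) r r = 1 ∧
      ∀ y, y < r → lev y = k + 1 → residGram g a (ends g a lev k) y r = 0).map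
        Function.Embedding.some

/-- A level structure compatible with `g` and the root form `a`. -/
structure IsLevel (g : V → V → ℤ) (a : V → ℤ) (lev : V → ℕ) : Prop where
  entries : ∀ i, a i = -1 ∨ a i = 0 ∨ a i = 1
  pos : ∀ i, 1 ≤ lev i
  one : ∀ i, lev i = 1 ↔ a i ≠ 0
  adj : ∀ i j, g i j ≠ 0 → lev i ≤ lev j + 1
  pred : ∀ i, 2 ≤ lev i → ∃ j, g i j ≠ 0 ∧ lev j + 1 = lev i

variable {g : V → V → ℤ} {a : V → ℤ} {lev : V → ℕ}

lemma residGram_comm (hg : IsSigned g) (E : Finset (Option V)) (y z : V) :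
    residGram g a E y z = residGram g a E z y := by
  unfold residGram
  rw [hg.symm y z]
  congr 1
  · congr 1
    by_cases h : y = z
    · simp [h]
    · rw [if_neg h, if_neg (Ne.symm h)]
  · exact Finset.sum_congr rfl fun w _ => mul_comm _ _

lemma endForm_entries (hl : IsLevel g a lev) (hg : IsSigned g) (w : Option V) (y : V) :
    endForm g a w y = -1 ∨ endForm g a w y = 0 ∨ endForm g a w y = 1 := by
  cases w with
  | none => exact hl.entries y
  | some r => exact hg.entries r y

variable [Fintype V] [LinearOrder V]

lemma mem_ends_succ {k : ℕ} {w : Option V} : w ∈ ends g a lev (k + 1) ↔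
    ∃ r, w = some r ∧ lev r = k + 1 ∧ residGram g a (ends g a lev k) r r = 1 ∧
      ∀ y, y < r → lev y = k + 1 → residGram g a (ends g a lev k) y r = 0 := by
  simp only [ends, Finset.mem_map, Finset.mem_filter, Finset.mem_univ, true_and,
    Function.Embedding.some_apply]
  constructor
  · rintro ⟨r, h, rfl⟩
    exact ⟨r, rfl, h⟩
  · rintro ⟨r, rfl, h⟩
    exact ⟨r, h, rfl⟩

lemma some_mem_ends_succ {k : ℕ} {r : V} : some r ∈ ends g a lev (k + 1) ↔
    lev r = k + 1 ∧ residGram g a (ends g a lev k) r r = 1 ∧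
      ∀ y, y < r → lev y = k + 1 → residGram g a (ends g a lev k) y r = 0 := by
  rw [mem_ends_succ]
  constructor
  · rintro ⟨r', h, h'⟩
    cases h
    exact h'
  · exact fun h => ⟨r, rfl, h⟩

/-- Forms of ends at level `k` vanish beyond level `k + 1`. -/
lemma endForm_eq_zero (hl : IsLevel g a lev) (hg : IsSigned g) {k : ℕ} {w : Option V}
    (hw : w ∈ ends g a lev k) {y : V} (hy : k + 1 < lev y) : endForm g a w y = 0 := by
  cases k with
  | zero =>
    simp only [ends, Finset.mem_singleton] at hw
    subst hw
    by_contra h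
    have := (hl.one y).2 h
    omega
  | succ k =>
    obtain ⟨r, rfl, hr, -⟩ := mem_ends_succ.1 hw
    by_contra h
    have h1 : g y r ≠ 0 := by rw [hg.symm]; exact h
    have := hl.adj _ _ h1
    omega

lemma residGram_ends_of_ne (hg : IsSigned g) {k : ℕ} {r s : V}
    (hr : some r ∈ ends g a lev (k + 1)) (hs : some s ∈ ends g a lev (k + 1)) (h : r ≠ s) :
    residGram g a (ends g a lev k) r s = 0 := by
  rw [some_mem_ends_succ] at hr hs
  rcases lt_or_gt_of_ne h with h | h
  · exact hs.2.2 r h hr.1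
  · rw [residGram_comm hg]
    exact hr.2.2 s h hs.1

/-- The value of the end form `w` on the combination `∑ α a • e_{y a}`. -/
noncomputable def endSum (g : V → V → ℤ) (a : V → ℤ) {ι : Type} [Fintype ι] (w : Option V)
    (y : ι → V) (α : ι → ℝ) : ℝ := ∑ i, α i * (endForm g a w (y i) : ℝ)

/-- A quantitative positivity statement for `m` ends at level `j`. -/
def MultiForm (g : V → V → ℤ) (a : V → ℤ) (lev : V → ℕ) (lam : ℝ) (j n L m : ℕ) (κ : ℝ) : Prop :=
  ∀ (ι : Type) [Fintype ι] (y : ι → V) (α : ι → ℝ), Fintype.card ι ≤ n →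
    (∀ i, j < lev (y i) ∧ lev (y i) ≤ L) → ∀ W ⊆ ends g a lev j, W.card = m →
    κ * ∑ w ∈ W, endSum g a w y α ^ 2 ≤ shiftQuad g lam y α

lemma MultiForm.mono {lam : ℝ} {j n n' L m : ℕ} {κ κ' : ℝ} (h : MultiForm g a lev lam j n L m κ)
    (hn : n' ≤ n) (hκ : κ' ≤ κ) : MultiForm g a lev lam j n' L m κ' := by
  intro ι _ y α hc hy W hW hm
  refine le_trans ?_ (h ι y α (hc.trans hn) hy W hW hm)
  exact mul_le_mul_of_nonneg_right hκ (Finset.sum_nonneg fun w _ => sq_nonneg _)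

end Ends

lemma exists_unique_of_sum_sq_eq_one {β : Type} {E : Finset β} {f : β → ℤ}
    (h : ∑ u ∈ E, f u * f u = 1) : ∃ u ∈ E, f u ^ 2 = 1 ∧ ∀ v ∈ E, v ≠ u → f v = 0 := by
  have hne : ∃ u ∈ E, f u ≠ 0 := by
    by_contra! hc
    rw [Finset.sum_eq_zero fun u hu => by rw [hc u hu]; simp] at h
    exact absurd h (by norm_num)
  obtain ⟨u, hu, hfu⟩ := hne
  rw [← Finset.add_sum_erase E _ hu] at h
  have h1 : 1 ≤ f u * f u := by
    have := mul_self_pos.2 hfu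
    omega
  have h2 : ∀ v ∈ E.erase u, 0 ≤ f v * f v := fun v _ => mul_self_nonneg _
  have h3 := Finset.sum_nonneg h2
  refine ⟨u, hu, by nlinarith, fun v hv hvu => ?_⟩
  have h4 : ∑ v ∈ E.erase u, f v * f v = 0 := by linarith
  exact mul_self_eq_zero.1 ((Finset.sum_eq_zero_iff_of_nonneg h2).1 h4 v
    (Finset.mem_erase.2 ⟨hvu, hv⟩))

lemma card_image_add_card_fiber_le {α β : Type} [Fintype α] [DecidableEq β] (p : α → β) (u : β) :
    (Finset.univ.image p).card + (Finset.univ.filter fun w => p w = u).card ≤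
      Fintype.card α + 1 := by
  have h1 : Finset.univ.image p ⊆ insert u ((Finset.univ.filter fun w => p w ≠ u).image p) := by
    intro v hv
    obtain ⟨w, -, rfl⟩ := Finset.mem_image.1 hv
    by_cases h : p w = u
    · simp [h]
    · exact Finset.mem_insert_of_mem (Finset.mem_image_of_mem _ (by simp [h]))
  have h2 := (Finset.card_le_card h1).trans (Finset.card_insert_le _ _)
  have h3 : ((Finset.univ.filter fun w => p w ≠ u).image p).card ≤ _ := Finset.card_image_le
  have h4 := Finset.card_filter_add_card_filter_not
    (s := (Finset.univ : Finset α)) (fun w => p w = u)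
  rw [Finset.card_univ] at h4
  simp only [ne_eq] at h2 h3
  omega

section

variable {V : Type} [Fintype V] [LinearOrder V] {g : V → V → ℤ} {a : V → ℤ} {lev : V → ℕ}

lemma MultiForm.step (hg : IsSigned g) (hl : IsLevel g a lev) {lam : ℝ} (hlam : 1 < lam)
    {j n L m : ℕ} (hm : 1 ≤ m) (hL : j + 1 ≤ L) (κ : ℕ → ℝ) {κ' : ℝ} (hκ : ∀ m₀, κ m₀ ≤ 1)
    (h : ∀ m₀, 1 ≤ m₀ → m₀ ≤ m → MultiForm g a lev lam j (n + m) L m₀ (κ m₀))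
    (hD : ∀ m₀ : ℕ, 1 ≤ m₀ → m₀ ≤ m → κ' * (lam - 1 + (1 - κ m₀) * (m - m₀ + 1)) ≤ 1) :
    MultiForm g a lev lam (j + 1) n L m κ' := by
  intro ι _ y α hc hy W hW hWm
  have hr0 : ∀ w : W, ∃ r, (w : Option V) = some r ∧ lev r = j + 1 ∧
      residGram g a (ends g a lev j) r r = 1 := fun w => by
    obtain ⟨r, h1, h2, h3, -⟩ := mem_ends_succ.1 (hW w.2)
    exact ⟨r, h1, h2, h3⟩
  choose r hr hlev hres using hr0
  have hrinj : Function.Injective r := fun w w' hww => by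
    apply Subtype.ext; rw [hr w, hr w', hww]
  set E := ends g a lev j with hE
  have hp0 : ∀ w : W, ∃ u ∈ E, endForm g a u (r w) ^ 2 = 1 ∧
      ∀ v ∈ E, v ≠ u → endForm g a v (r w) = 0 := fun w => by
    apply exists_unique_of_sum_sq_eq_one
    have := hres w
    unfold residGram at this
    rw [hg.diag] at this
    simp only [if_true] at this
    linarith
  choose p hpE hp1 hp2 using hp0
  set W₀ := Finset.univ.image p with hW₀
  have hW₀E : W₀ ⊆ E := by
    intro u hu
    obtain ⟨w, -, rfl⟩ := Finset.mem_image.1 hu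
    exact hpE w
  have hcard : Fintype.card W = m := by rw [Fintype.card_coe, hWm]
  have hm₀1 : 1 ≤ W₀.card := by
    have hne : Nonempty W := Fintype.card_pos_iff.1 (by omega)
    obtain ⟨w⟩ := hne
    exact Finset.card_pos.2 ⟨p w, Finset.mem_image_of_mem _ (Finset.mem_univ _)⟩
  have hm₀m : W₀.card ≤ m := by
    rw [← hcard, ← Finset.card_univ]; exact Finset.card_image_le
  set D := lam - 1 + (1 - κ W₀.card) * (m - W₀.card + 1) with hDdef
  have hm₀m' : (W₀.card : ℝ) ≤ m := by exact_mod_cast hm₀m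
  have hDpos : 0 < D := by
    have h1 : 0 ≤ (1 - κ W₀.card) * (m - W₀.card + 1) :=
      mul_nonneg (by linarith [hκ W₀.card]) (by linarith)
    linarith
  -- the fibre estimate
  have hfib : ∀ ξ : W → ℝ, ∑ u ∈ W₀, endSum g a u r ξ ^ 2 ≤
      (m - W₀.card + 1) * ∑ w, ξ w ^ 2 := by
    intro ξ
    rw [← Finset.sum_fiberwise_of_maps_to (s := Finset.univ) (t := W₀) (g := p)
      (fun w _ => Finset.mem_image_of_mem _ (Finset.mem_univ _)), Finset.mul_sum]
    refine Finset.sum_le_sum fun u hu => ?_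
    have h1 : endSum g a u r ξ =
        ∑ w ∈ Finset.univ.filter (fun w => p w = u), ξ w * (endForm g a u (r w) : ℝ) := by
      unfold endSum
      rw [Finset.sum_filter]
      refine Finset.sum_congr rfl fun w _ => ?_
      split_ifs with hw
      · rfl
      · rw [hp2 w u (hW₀E hu) (Ne.symm hw)]; simp
    rw [h1]
    refine sq_sum_le_card_mul_sum_sq.trans ?_
    have h2 := card_image_add_card_fiber_le p u
    rw [hcard] at h2
    have h3 : ((Finset.univ.filter fun w => p w = u).card : ℝ) ≤ m - W₀.card + 1 := by
      have h4 : ((W₀.card + (Finset.univ.filter fun w => p w = u).card : ℕ) : ℝ) ≤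
        ((m + 1 : ℕ) : ℝ) := by exact_mod_cast h2
      push_cast at h4
      linarith
    refine mul_le_mul h3 (le_of_eq ?_) (Finset.sum_nonneg fun _ _ => sq_nonneg _) (by linarith)
    refine Finset.sum_congr rfl fun w hw => ?_
    have hw' := (Finset.mem_filter.1 hw).2
    have := hp1 w
    rw [hw'] at this
    rw [mul_pow]
    have h5 : (endForm g a u (r w) : ℝ) ^ 2 = 1 := by exact_mod_cast this
    rw [h5, mul_one]
  -- the form on the ends
  have hquad : ∀ ξ : W → ℝ, shiftQuad g lam r ξ =
      (lam - 1) * ∑ w, ξ w ^ 2 + ∑ u ∈ W₀, endSum g a u r ξ ^ 2 := by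
    intro ξ
    have h1 : ∀ w w', shiftGram g lam (r w) (r w') = (if w = w' then lam - 1 else 0) +
        ∑ u ∈ E, (endForm g a u (r w) : ℝ) * endForm g a u (r w') := by
      intro w w'
      unfold shiftGram
      by_cases hww : w = w'
      · subst hww
        have := hres w
        unfold residGram at this
        rw [hg.diag] at this ⊢
        simp only [if_true] at this ⊢
        have h2 : ∑ u ∈ E, endForm g a u (r w) * endForm g a u (r w) = 1 := by linarith
        have h3 : ∑ u ∈ E, (endForm g a u (r w) : ℝ) * endForm g a u (r w) = 1 := by
          exact_mod_cast h2
        rw [h3]; push_cast; ring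
      · have hne : r w ≠ r w' := fun hh => hww (hrinj hh)
        have := residGram_ends_of_ne hg (by rw [← hr w]; exact hW w.2)
          (by rw [← hr w']; exact hW w'.2) hne
        unfold residGram at this
        rw [if_neg hne] at this ⊢
        rw [if_neg hww]
        have h2 : g (r w) (r w') = ∑ u ∈ E, endForm g a u (r w) * endForm g a u (r w') := by
          linarith
        rw [h2]; push_cast; rfl
    unfold shiftQuad
    simp only [h1, add_mul, Finset.sum_add_distrib]
    congr 1
    · rw [Finset.mul_sum]
      refine Finset.sum_congr rfl fun w _ => ?_
      simp [sq, mul_assoc]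
    · have h2 : ∑ u ∈ W₀, endSum g a u r ξ ^ 2 = ∑ u ∈ E, endSum g a u r ξ ^ 2 := by
        refine Finset.sum_subset hW₀E fun u hu hu' => ?_
        have : endSum g a u r ξ = 0 := Finset.sum_eq_zero fun w _ => by
          rw [hp2 w u hu ?_]
          · simp
          · rintro rfl
            exact hu' (Finset.mem_image_of_mem _ (Finset.mem_univ _))
        rw [this]; simp
      rw [h2]
      unfold endSum
      simp only [sq, Finset.sum_mul_sum]
      simp only [Finset.sum_mul]
      rw [Finset.sum_congr rfl fun w _ => Finset.sum_comm, Finset.sum_comm]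
      refine Finset.sum_congr rfl fun u _ => Finset.sum_congr rfl fun w _ =>
        Finset.sum_congr rfl fun w' _ => ?_
      ring
  set X : W → ℝ := fun w => endSum g a w y α with hX
  have hcross : ∀ w, ∑ i, α i * shiftGram g lam (r w) (y i) = X w := by
    intro w
    rw [hX]
    unfold endSum
    refine Finset.sum_congr rfl fun i _ => ?_
    have hne : r w ≠ y i := fun hh => by
      have := (hy i).1
      rw [← hh, hlev w] at this
      omega
    unfold shiftGram
    rw [if_neg hne, zero_add, hr w]
    rfl
  set ξ : W → ℝ := fun w => - X w / D with hξ
  have key := h W₀.card hm₀1 hm₀m (ι ⊕ W) (Sum.elim y r) (Sum.elim α ξ)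
    (by rw [Fintype.card_sum]; omega)
    (by
      rintro (i | w)
      · have := hy i
        exact ⟨by simp; omega, this.2⟩
      · simp [hlev w, hL]) W₀ hW₀E rfl
  rw [shiftQuad_sum hg, hquad] at key
  simp only [hcross] at key
  have hend : ∀ u ∈ W₀, endSum g a u (Sum.elim y r) (Sum.elim α ξ) = endSum g a u r ξ := by
    intro u hu
    unfold endSum
    rw [Fintype.sum_sum_type]
    simp only [Sum.elim_inl, Sum.elim_inr]
    rw [add_eq_right]
    refine Finset.sum_eq_zero fun i _ => ?_
    rw [endForm_eq_zero hl hg (hW₀E hu) (hy i).1]; simp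
  rw [Finset.sum_congr rfl fun u hu => by rw [hend u hu]] at key
  have hf := hfib ξ
  have hk1 : (1 - κ W₀.card) * ∑ u ∈ W₀, endSum g a u r ξ ^ 2 ≤
      (1 - κ W₀.card) * ((m - W₀.card + 1) * ∑ w, ξ w ^ 2) :=
    mul_le_mul_of_nonneg_left hf (by linarith [hκ W₀.card])
  have e1 : ∑ w, ξ w * X w = - (∑ w, X w ^ 2) / D := by
    rw [neg_div, Finset.sum_div, ← Finset.sum_neg_distrib]
    refine Finset.sum_congr rfl fun w _ => ?_
    simp only [hξ]; ring
  have e2 : ∑ w, ξ w ^ 2 = (∑ w, X w ^ 2) / D ^ 2 := by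
    rw [Finset.sum_div]
    refine Finset.sum_congr rfl fun w _ => ?_
    simp only [hξ, div_pow, neg_sq]
  have e3 : D * ∑ w, ξ w ^ 2 = (∑ w, X w ^ 2) / D := by
    rw [e2]; field_simp
  have e4 : (∑ w, X w ^ 2) / D ≤ shiftQuad g lam y α := by
    rw [e1] at key
    have : D * ∑ w, ξ w ^ 2 = (lam - 1) * ∑ w, ξ w ^ 2 +
      (1 - κ W₀.card) * ((m - W₀.card + 1) * ∑ w, ξ w ^ 2) := by rw [hDdef]; ring
    have e5 : -(∑ w, X w ^ 2) / D = -((∑ w, X w ^ 2) / D) := neg_div _ _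
    rw [e5] at key
    linarith
  refine le_trans ?_ e4
  have e6 : ∑ w ∈ W, endSum g a w y α ^ 2 = ∑ w, X w ^ 2 := by
    rw [← Finset.sum_coe_sort]
  rw [e6, le_div_iff₀ hDpos]
  have := mul_le_mul_of_nonneg_right (hD W₀.card hm₀1 hm₀m)
    (Finset.sum_nonneg fun w (_ : w ∈ Finset.univ) => sq_nonneg (X w))
  calc κ' * (∑ w, X w ^ 2) * D = κ' * D * ∑ w, X w ^ 2 := by ring
    _ ≤ 1 * ∑ w, X w ^ 2 := this
    _ = ∑ w, X w ^ 2 := one_mul _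

end

/-- The numerical constraints used in the growth argument. -/
structure Params (lam k₁ : ℝ) : Prop where
  lam_ge : 2.0197 ≤ lam
  lam_le : lam ≤ 2.01981
  k_ge : 0.8687 ≤ k₁
  k_lt : k₁ < 1
  gap : k₁ * (lam - k₁) < 1
  tight : lam ^ 2 * (lam - 2 * k₁) < lam - k₁

/-- The positivity constants for one, two and three ends. -/
noncomputable def endConst (k₁ : ℝ) (m : ℕ) : ℝ :=
  if m = 1 then k₁ else if m = 2 then 0.779 else 0.683

lemma endConst_le_one {lam k₁ : ℝ} (hp : Params lam k₁) (m : ℕ) : endConst k₁ m ≤ 1 := by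
  unfold endConst
  have := hp.k_lt
  split_ifs <;> linarith

lemma endConst_pos {lam k₁ : ℝ} (hp : Params lam k₁) (m : ℕ) : 0 < endConst k₁ m := by
  unfold endConst
  have := hp.k_ge
  split_ifs <;> linarith

lemma endConst_step {lam k₁ : ℝ} (hp : Params lam k₁) {m m₀ : ℕ} (h1 : 1 ≤ m₀) (h2 : m₀ ≤ m)
    (h3 : m ≤ 3) :
    endConst k₁ m * (lam - 1 + (1 - endConst k₁ m₀) * (m - m₀ + 1)) ≤ 1 := by
  obtain ⟨a1, a2, a3, a4, a5, a6⟩ := hp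
  have hm : 1 ≤ m := h1.trans h2
  unfold endConst
  interval_cases m <;> interval_cases m₀ <;> norm_num <;> nlinarith

/-- A uniform increment for the growth argument. -/
noncomputable def endStep (lam k₁ : ℝ) : ℝ := (1 - k₁ * (lam - k₁)) / 100

lemma endStep_pos {lam k₁ : ℝ} (hp : Params lam k₁) : 0 < endStep lam k₁ := by
  have := hp.gap
  unfold endStep
  linarith

lemma endConst_grow {lam k₁ : ℝ} (hp : Params lam k₁) {m : ℕ} {θ : ℝ} (h1 : 1 ≤ m)
    (h3 : m ≤ 3) (hθ0 : 0 ≤ θ) (hθ1 : θ ≤ 1) :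
    (θ + endStep lam k₁) * endConst k₁ m * (lam - θ * endConst k₁ m) ≤ 1 := by
  have hδ := endStep_pos hp
  have hk := endConst_pos hp m
  have hk1 := endConst_le_one hp m
  have hη : lam * endConst k₁ m * endStep lam k₁ ≤ 1 - endConst k₁ m * (lam - endConst k₁ m) := by
    obtain ⟨a1, a2, a3, a4, a5, a6⟩ := hp
    have hδ' : endStep lam k₁ ≤ 0.01 := by
      unfold endStep
      nlinarith
    unfold endConst
    interval_cases m
    · norm_num
      have : lam * k₁ ≤ 100 := by nlinarith
      unfold endStep
      nlinarith
    · norm_num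
      nlinarith
    · norm_num
      nlinarith
  have hl : 2 * endConst k₁ m ≤ lam := by have := hp.lam_ge; linarith
  set k := endConst k₁ m
  set δ := endStep lam k₁
  have h4 : 0 ≤ (1 - θ) * (k * (lam - k) - θ * k ^ 2) := by
    refine mul_nonneg (by linarith) ?_
    nlinarith [mul_nonneg hk.le (by linarith : (0 : ℝ) ≤ lam - 2 * k),
      mul_nonneg (sq_nonneg k) (by linarith : (0 : ℝ) ≤ 1 - θ)]
  have h5 : 0 ≤ δ * k * (θ * k) := by positivity
  have h6 : 0 ≤ (1 - θ) * (1 - k * (lam - k) - lam * k * δ) :=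
    mul_nonneg (by linarith) (by linarith)
  nlinarith

section

variable {V : Type} [Fintype V] [LinearOrder V] {g : V → V → ℤ} {a : V → ℤ} {lev : V → ℕ}

lemma MultiForm.mono_level {lam : ℝ} {j n L L' m : ℕ} {κ : ℝ} (h : MultiForm g a lev lam j n L m κ)
    (hL : L' ≤ L) : MultiForm g a lev lam j n L' m κ := fun ι _ y α hc hy W hW hm =>
  h ι y α hc (fun i => ⟨(hy i).1, (hy i).2.trans hL⟩) W hW hm

lemma LocallyPSD.mono {V : Type} {g : V → V → ℤ} {c : ℝ} {N N' : ℕ} (h : LocallyPSD g c N)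
    (hN : N' ≤ N) : LocallyPSD g c N' := fun ι _ y α hc => h ι y α (hc.trans hN)

lemma LocallyPSD.multiForm {lam : ℝ} {n : ℕ} (h : LocallyPSD g lam n) (j L m : ℕ) :
    MultiForm g a lev lam j n L m 0 := by
  intro ι _ y α hc _ W _ _
  rw [zero_mul]
  exact h ι y α hc

lemma multiForm_root (hg : IsSigned g) (hl : IsLevel g a lev) {lam k₁ : ℝ} (hp : Params lam k₁)
    {n L : ℕ} (h : MultiForm g a lev lam 0 n L 1 k₁) :
    ∀ j n', j ≤ L → n' + 3 * j ≤ n → ∀ m, 1 ≤ m → m ≤ 3 →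
      MultiForm g a lev lam j n' L m (endConst k₁ m) := by
  intro j
  induction j with
  | zero =>
    intro n' _ hn m hm1 hm3
    rcases Nat.eq_or_lt_of_le hm1 with rfl | hm
    · exact h.mono (by omega) (by simp [endConst])
    · intro ι _ y α _ _ W hW hWm
      have := Finset.card_le_card hW
      simp only [ends, Finset.card_singleton] at this
      omega
  | succ j ih =>
    intro n' hL hn m hm1 hm3
    refine MultiForm.step hg hl (by linarith [hp.lam_ge]) hm1 hL (endConst k₁)
      (endConst_le_one hp) (fun m₀ h1 h2 => ih _ (by omega) (by omega) m₀ h1 (h2.trans hm3))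
      fun m₀ h1 h2 => endConst_step hp h1 h2 hm3

lemma multiForm_grow (hg : IsSigned g) (hl : IsLevel g a lev) {lam k₁ : ℝ} (hp : Params lam k₁)
    {m j n L q : ℕ} (hm1 : 1 ≤ m) (hm3 : m ≤ 3) (hL : j + q ≤ L)
    (h : ∀ i ≤ q, ∀ m₀, 1 ≤ m₀ → m₀ < m →
      MultiForm g a lev lam (j + i) (n + 3 * (q - i)) L m₀ (endConst k₁ m₀))
    (h0 : MultiForm g a lev lam j (n + 3 * q) L m 0) :
    ∀ i ≤ q, MultiForm g a lev lam (j + i) (n + 3 * (q - i)) L m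
      (min 1 (i * endStep lam k₁) * endConst k₁ m) := by
  intro i
  have hδ := endStep_pos hp
  induction i with
  | zero => intro _; simpa using h0
  | succ i ih =>
    intro hi
    have ih := ih (by omega)
    set θ := min 1 (i * endStep lam k₁) with hθ
    have hθ0 : 0 ≤ θ := le_min zero_le_one (by positivity)
    have hθ1 : θ ≤ 1 := min_le_left _ _
    have hk := endConst_pos hp m
    have hmin : min 1 ((i + 1 : ℕ) * endStep lam k₁) ≤ θ + endStep lam k₁ := by
      rw [hθ]
      rcases min_cases (1 : ℝ) (i * endStep lam k₁) with ⟨e, -⟩ | ⟨e, -⟩ <;> rw [e]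
      · exact (min_le_left _ _).trans (by linarith)
      · refine (min_le_right _ _).trans (le_of_eq ?_)
        push_cast; ring
    have hmin0 : 0 ≤ min 1 ((i + 1 : ℕ) * endStep lam k₁) := le_min zero_le_one (by positivity)
    refine MultiForm.step hg hl (by linarith [hp.lam_ge]) hm1 (j := j + i) (by omega)
      (fun m₀ => if m₀ = m then θ * endConst k₁ m else endConst k₁ m₀) ?_ ?_ ?_
    · intro m₀
      split_ifs
      · have := endConst_le_one hp m
        nlinarith
      · exact endConst_le_one hp m₀
    · intro m₀ h1 h2
      split_ifs with hm
      · subst hm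
        exact ih.mono (by omega) le_rfl
      · exact (h i (by omega) m₀ h1 (by omega)).mono (by omega) le_rfl
    · intro m₀ h1 h2
      split_ifs with hm
      · subst hm
        have e : lam - 1 + (1 - θ * endConst k₁ m₀) * ((m₀ : ℝ) - m₀ + 1) =
          lam - θ * endConst k₁ m₀ := by ring
        rw [e]
        refine le_trans ?_ (endConst_grow hp h1 hm3 hθ0 hθ1)
        have h5 : 0 ≤ lam - θ * endConst k₁ m₀ := by
          have := endConst_le_one hp m₀
          have := hp.lam_ge
          nlinarith
        exact mul_le_mul_of_nonneg_right (mul_le_mul_of_nonneg_right hmin hk.le) h5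
      · have h6 := endConst_step hp h1 h2 hm3
        have h7 : min 1 ((i + 1 : ℕ) * endStep lam k₁) ≤ 1 := min_le_left _ _
        have h8 : 0 ≤ lam - 1 + (1 - endConst k₁ m₀) * ((m : ℝ) - m₀ + 1) := by
          have h9 : (m₀ : ℝ) ≤ m := by exact_mod_cast h2
          have := mul_nonneg (by linarith [endConst_le_one hp m₀] : 0 ≤ 1 - endConst k₁ m₀)
            (by linarith : (0 : ℝ) ≤ m - m₀ + 1)
          linarith [hp.lam_ge]
        calc _ = min 1 ((i + 1 : ℕ) * endStep lam k₁) * (endConst k₁ m *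
            (lam - 1 + (1 - endConst k₁ m₀) * ((m : ℝ) - m₀ + 1))) := by ring
          _ ≤ 1 * 1 := mul_le_mul h7 h6 (mul_nonneg hk.le h8) zero_le_one
          _ = 1 := one_mul 1

/-- The number of steps after which the growth argument reaches its limit. -/
noncomputable def growTime (lam k₁ : ℝ) : ℕ := ⌈1 / endStep lam k₁⌉₊

lemma multiForm_deep (hg : IsSigned g) (hl : IsLevel g a lev) {lam k₁ : ℝ} (hp : Params lam k₁)
    (m : ℕ) : 1 ≤ m → m ≤ 3 → ∀ k n L, m * growTime lam k₁ ≤ k → k ≤ L →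
      LocallyPSD g lam (n + 3 * (m * growTime lam k₁)) →
      MultiForm g a lev lam k n L m (endConst k₁ m) := by
  induction m using Nat.strong_induction_on with
  | _ m ih =>
  intro hm1 hm3 k n L hk hL h
  set q := growTime lam k₁ with hq
  have hmq : q ≤ m * q := Nat.le_mul_of_pos_left q hm1
  have := multiForm_grow hg hl hp (j := k - q) (n := n) (L := L) (q := q) hm1 hm3 (by omega)
    (fun i hi m₀ h1 h2 => by
      have h3 : m₀ * q + q ≤ m * q := by
        calc m₀ * q + q = (m₀ + 1) * q := by ring
          _ ≤ m * q := Nat.mul_le_mul_right _ h2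
      exact ih m₀ h2 h1 (by omega) _ _ _ (by omega) (by omega) (h.mono (by omega)))
    ((h.mono (by omega)).multiForm _ _ _) q le_rfl
  rw [Nat.sub_add_cancel (by omega), Nat.sub_self, mul_zero, add_zero] at this
  refine this.mono le_rfl ?_
  have h1 : min 1 (q * endStep lam k₁) = 1 := by
    apply min_eq_left
    have h2 := Nat.le_ceil (1 / endStep lam k₁)
    rwa [div_le_iff₀ (endStep_pos hp)] at h2
  rw [h1, one_mul]

/-- The positivity statement used in the structural analysis. -/
def LevelForm (g : V → V → ℤ) (a : V → ℤ) (lev : V → ℕ) (lam k₁ : ℝ) : Prop :=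
  ∀ k m, 1 ≤ m → m ≤ 3 → MultiForm g a lev lam k 3 (k + 2) m (endConst k₁ m)

lemma levelForm_of_root (hg : IsSigned g) (hl : IsLevel g a lev) {lam k₁ : ℝ}
    (hp : Params lam k₁) (h : LocallyPSD g lam (3 + 9 * growTime lam k₁))
    (h' : MultiForm g a lev lam 0 (3 + 9 * growTime lam k₁) (3 * growTime lam k₁ + 2) 1 k₁) :
    LevelForm g a lev lam k₁ := by
  intro k m hm1 hm3
  rcases le_or_gt k (3 * growTime lam k₁) with hk | hk
  · exact (multiForm_root hg hl hp h' k 3 (by omega) (by omega) m hm1 hm3).mono_level (by omega)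
  · have h1 : m * growTime lam k₁ ≤ 3 * growTime lam k₁ := Nat.mul_le_mul_right _ hm3
    exact multiForm_deep hg hl hp m hm1 hm3 k 3 (k + 2) (by omega) (by omega)
      (h.mono (by omega))

end

lemma exists_pair_of_sum_sq_eq_two {β : Type} {E : Finset β} {f : β → ℤ}
    (hf : ∀ u, f u = -1 ∨ f u = 0 ∨ f u = 1)
    (h : ∑ u ∈ E, f u * f u = 2) : ∃ u ∈ E, ∃ v ∈ E, u ≠ v ∧ f u ≠ 0 ∧ f v ≠ 0 ∧
      ∀ w ∈ E, w ≠ u → w ≠ v → f w = 0 := by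
  have hne : ∃ u ∈ E, f u ≠ 0 := by
    by_contra! hc
    rw [Finset.sum_eq_zero fun u hu => by rw [hc u hu]; simp] at h
    exact absurd h (by norm_num)
  obtain ⟨u, hu, hfu⟩ := hne
  rw [← Finset.add_sum_erase E _ hu] at h
  have h1 : f u * f u = 1 := by
    rcases hf u with h | h | h <;> simp_all
  obtain ⟨v, hv, hv1, hv2⟩ := exists_unique_of_sum_sq_eq_one
    (E := E.erase u) (f := f) (by linarith)
  refine ⟨u, hu, v, Finset.mem_of_mem_erase hv, (Finset.ne_of_mem_erase hv).symm, hfu, ?_,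
    fun w hw hwu hwv => hv2 w (Finset.mem_erase.2 ⟨hwu, hw⟩) hwv⟩
  rintro h0
  rw [h0] at hv1
  norm_num at hv1

lemma eq_of_two_ends_aux {lam : ℝ} (hlam : lam ≤ 2.01981) {u v c : ℤ}
    (hu : u = -1 ∨ u = 0 ∨ u = 1) (hv : v = -1 ∨ v = 0 ∨ v = 1) (hc : c = -1 ∨ c = 0 ∨ c = 1)
    (H : ∀ x z : ℝ, 0.779 * ((x + z * u) ^ 2 + (x + z * v) ^ 2) ≤
      lam * (x ^ 2 + z ^ 2) + 2 * c * x * z) : c = u + v := by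
  have h1 := H 2 1
  have h2 := H 2 (-1)
  have h3 := H 1.7 1
  have h4 := H 1.7 (-1)
  have h5 := H 1 1
  have h6 := H 1 (-1)
  clear H
  rcases hu with rfl | rfl | rfl <;> rcases hv with rfl | rfl | rfl <;>
    rcases hc with rfl | rfl | rfl <;>
    first
    | rfl
    | (exfalso; norm_num at h1 h2 h3 h4 h5 h6; linarith)

/-- A two-vector estimate: a vertex attached to two ends is orthogonal to all others. -/
lemma eq_of_two_ends {lam : ℝ} (hlam : lam ≤ 2.01981) {s t u v c : ℤ} (hs : s = -1 ∨ s = 1)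
    (ht : t = -1 ∨ t = 1) (hu : u = -1 ∨ u = 0 ∨ u = 1) (hv : v = -1 ∨ v = 0 ∨ v = 1)
    (hc : c = -1 ∨ c = 0 ∨ c = 1)
    (H : ∀ x z : ℝ, 0.779 * ((x * s + z * u) ^ 2 + (x * t + z * v) ^ 2) ≤
      lam * (x ^ 2 + z ^ 2) + 2 * c * x * z) : c = s * u + t * v := by
  refine eq_of_two_ends_aux hlam ?_ ?_ hc fun x z => le_trans (le_of_eq ?_) (H x z)
  · rcases hs with rfl | rfl <;> omega
  · rcases ht with rfl | rfl <;> omega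
  · rcases hs with rfl | rfl <;> rcases ht with rfl | rfl <;> push_cast <;> ring

section

variable {V : Type} [Fintype V] [LinearOrder V] {g : V → V → ℤ} {a : V → ℤ} {lev : V → ℕ}

/-- The residual form at level `k`. -/
noncomputable def levelResid (g : V → V → ℤ) (a : V → ℤ) (lev : V → ℕ) (k : ℕ) (y z : V) : ℤ :=
  residGram g a (ends g a lev k) y z

lemma levelResid_comm (hg : IsSigned g) (k : ℕ) (y z : V) :
    levelResid g a lev k y z = levelResid g a lev k z y := residGram_comm hg _ _ _

lemma levelResid_self (hg : IsSigned g) (k : ℕ) (y : V) :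
    levelResid g a lev k y y =
      2 - ∑ w ∈ ends g a lev k, endForm g a w y * endForm g a w y := by
  unfold levelResid residGram
  rw [hg.diag, if_pos rfl]; ring

lemma levelResid_of_ne (k : ℕ) {y z : V} (h : y ≠ z) :
    levelResid g a lev k y z =
      g y z - ∑ w ∈ ends g a lev k, endForm g a w y * endForm g a w z := by
  unfold levelResid residGram
  rw [if_neg h, zero_add]

lemma levelResid_far (hl : IsLevel g a lev) (hg : IsSigned g) (k : ℕ) {y z : V}
    (hz : k + 1 < lev z) (h : y ≠ z) : levelResid g a lev k y z = g y z := by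
  rw [levelResid_of_ne k h, Finset.sum_eq_zero fun w hw => by
    rw [endForm_eq_zero hl hg hw hz, mul_zero], sub_zero]

lemma levelResid_far_self (hl : IsLevel g a lev) (hg : IsSigned g) (k : ℕ) {z : V}
    (hz : k + 1 < lev z) : levelResid g a lev k z z = 2 := by
  rw [levelResid_self hg, Finset.sum_eq_zero fun w hw => by
    rw [endForm_eq_zero hl hg hw hz, mul_zero], sub_zero]

variable {lam k₁ : ℝ}

lemma LevelForm.core (hF : LevelForm g a lev lam k₁) {k m : ℕ}
    (hm1 : 1 ≤ m) (hm3 : m ≤ 3) {ι : Type} [Fintype ι] (y : ι → V) (hy : Function.Injective y)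
    (α : ι → ℝ) (hc : Fintype.card ι ≤ 3) (hlev : ∀ i, k < lev (y i) ∧ lev (y i) ≤ k + 2)
    {W : Finset (Option V)} (hW : W ⊆ ends g a lev k) (hWm : W.card = m)
    (hs : ∀ i, ∀ w ∈ ends g a lev k, w ∉ W → endForm g a w (y i) = 0) :
    0 ≤ ∑ i, ∑ j, (levelResid g a lev k (y i) (y j) : ℝ) * α i * α j + (lam - 2) * ∑ i, α i ^ 2 +
      (1 - endConst k₁ m) * ∑ w ∈ W, endSum g a w y α ^ 2 := by
  have h := hF k m hm1 hm3 ι y α hc hlev W hW hWm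
  have h1 : ∀ i j, shiftGram g lam (y i) (y j) = levelResid g a lev k (y i) (y j) +
      (if i = j then lam - 2 else 0) +
      ∑ w ∈ W, (endForm g a w (y i) : ℝ) * endForm g a w (y j) := by
    intro i j
    have h2 : ∑ w ∈ ends g a lev k, (endForm g a w (y i)) * endForm g a w (y j) =
      ∑ w ∈ W, (endForm g a w (y i)) * endForm g a w (y j) := by
      symm
      refine Finset.sum_subset hW fun w hw hw' => ?_
      rw [hs i w hw hw', zero_mul]
    unfold levelResid residGram shiftGram
    rw [h2]
    by_cases hij : i = j
    · subst hij; simp only [if_true]; push_cast; ring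
    · have : y i ≠ y j := fun hh => hij (hy hh)
      rw [if_neg this, if_neg this, if_neg hij]; push_cast; ring
  have h3 : shiftQuad g lam y α = ∑ i, ∑ j, (levelResid g a lev k (y i) (y j) : ℝ) * α i * α j +
      (lam - 2) * ∑ i, α i ^ 2 + ∑ w ∈ W, endSum g a w y α ^ 2 := by
    unfold shiftQuad
    simp only [h1, add_mul, Finset.sum_add_distrib]
    congr 1
    · congr 1
      rw [Finset.mul_sum]
      refine Finset.sum_congr rfl fun w _ => ?_
      simp [sq, mul_assoc]
    · unfold endSum
      simp only [sq, Finset.sum_mul_sum]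
      simp only [Finset.sum_mul]
      rw [Finset.sum_congr rfl fun w _ => Finset.sum_comm, Finset.sum_comm]
      refine Finset.sum_congr rfl fun u _ => Finset.sum_congr rfl fun w _ =>
        Finset.sum_congr rfl fun w' _ => ?_
      ring
  rw [h3] at h
  linarith

lemma LevelForm.core_two (hF : LevelForm g a lev lam k₁) (hg : IsSigned g) {k m : ℕ}
    (hm1 : 1 ≤ m) (hm3 : m ≤ 3) {y₁ y₂ : V} (h12 : y₁ ≠ y₂) (x₁ x₂ : ℝ)
    (hl₁ : k < lev y₁ ∧ lev y₁ ≤ k + 2) (hl₂ : k < lev y₂ ∧ lev y₂ ≤ k + 2)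
    {W : Finset (Option V)} (hW : W ⊆ ends g a lev k) (hWm : W.card = m) :
    endConst k₁ m * ∑ w ∈ W, (x₁ * endForm g a w y₁ + x₂ * endForm g a w y₂) ^ 2 ≤
      lam * (x₁ ^ 2 + x₂ ^ 2) + 2 * g y₁ y₂ * x₁ * x₂ := by
  have h := hF k m hm1 hm3 (Fin 2) ![y₁, y₂] ![x₁, x₂] (by simp)
    (by intro i; fin_cases i <;> simpa) W hW hWm
  unfold shiftQuad endSum shiftGram at h
  simp only [Fin.sum_univ_two, Matrix.cons_val_zero, Matrix.cons_val_one,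
    if_true, h12, h12.symm, if_false, hg.diag, hg.symm y₂ y₁] at h
  refine h.trans (le_of_eq ?_)
  push_cast; ring

lemma LevelForm.core_three (hF : LevelForm g a lev lam k₁) (hg : IsSigned g) {k m : ℕ}
    (hm1 : 1 ≤ m) (hm3 : m ≤ 3) {y₁ y₂ y₃ : V} (h12 : y₁ ≠ y₂) (h13 : y₁ ≠ y₃) (h23 : y₂ ≠ y₃)
    (x₁ x₂ x₃ : ℝ) (hl₁ : k < lev y₁ ∧ lev y₁ ≤ k + 2) (hl₂ : k < lev y₂ ∧ lev y₂ ≤ k + 2)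
    (hl₃ : k < lev y₃ ∧ lev y₃ ≤ k + 2)
    {W : Finset (Option V)} (hW : W ⊆ ends g a lev k) (hWm : W.card = m)
    (hs₁ : ∀ w ∈ ends g a lev k, w ∉ W → endForm g a w y₁ = 0)
    (hs₂ : ∀ w ∈ ends g a lev k, w ∉ W → endForm g a w y₂ = 0)
    (hs₃ : ∀ w ∈ ends g a lev k, w ∉ W → endForm g a w y₃ = 0) :
    0 ≤ (levelResid g a lev k y₁ y₁ : ℝ) * x₁ ^ 2 + levelResid g a lev k y₂ y₂ * x₂ ^ 2 +
      levelResid g a lev k y₃ y₃ * x₃ ^ 2 + 2 * (levelResid g a lev k y₁ y₂ * x₁ * x₂ +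
      levelResid g a lev k y₁ y₃ * x₁ * x₃ + levelResid g a lev k y₂ y₃ * x₂ * x₃) +
      (lam - 2) * (x₁ ^ 2 + x₂ ^ 2 + x₃ ^ 2) + (1 - endConst k₁ m) *
      ∑ w ∈ W, (x₁ * endForm g a w y₁ + x₂ * endForm g a w y₂ + x₃ * endForm g a w y₃) ^ 2 := by
  have h := hF.core hm1 hm3 (ι := Fin 3) ![y₁, y₂, y₃] (by
      intro i j hij
      fin_cases i <;> fin_cases j <;> simp_all) ![x₁, x₂, x₃] (by simp)
    (by intro i; fin_cases i <;> simpa) hW hWm (by intro i; fin_cases i <;> simpa)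
  unfold endSum at h
  simp only [Fin.sum_univ_three, Matrix.cons_val_zero, Matrix.cons_val_one,
    Matrix.cons_val, levelResid_comm hg k y₂ y₁, levelResid_comm hg k y₃ y₁,
    levelResid_comm hg k y₃ y₂] at h
  refine h.trans (le_of_eq ?_)
  ring

lemma LevelForm.sum_sq_le_two (hF : LevelForm g a lev lam k₁) (hp : Params lam k₁)
    (hg : IsSigned g) (hl : IsLevel g a lev) {k : ℕ} {y : V} (hy : lev y = k + 1) :
    ∑ w ∈ ends g a lev k, endForm g a w y * endForm g a w y ≤ 2 := by
  have hsq : ∀ w, endForm g a w y * endForm g a w y = if endForm g a w y ≠ 0 then 1 else 0 := by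
    intro w
    rcases endForm_entries hl hg w y with h | h | h <;> simp [h]
  simp only [hsq]
  rw [← Finset.sum_filter, Finset.sum_const, nsmul_eq_mul, mul_one]
  by_contra! hc
  have hc' : 3 ≤ ((ends g a lev k).filter fun w => endForm g a w y ≠ 0).card := by
    exact_mod_cast hc
  obtain ⟨W, hW, hWc⟩ := Finset.exists_subset_card_eq hc'
  have h := hF k 3 (by norm_num) le_rfl (Fin 1) (fun _ => y) (fun _ => 1) (by simp)
    (fun _ => by omega) W (hW.trans (Finset.filter_subset _ _)) hWc
  unfold endSum shiftQuad shiftGram at h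
  simp only [Finset.univ_unique, Finset.sum_singleton, if_true, hg.diag, one_mul, mul_one] at h
  rw [Finset.sum_congr rfl fun w hw => show ((endForm g a w y : ℝ)) ^ 2 = 1 by
    have := (Finset.mem_filter.1 (hW hw)).2
    rcases endForm_entries hl hg w y with h | h | h
    · rw [h]; norm_num
    · exact absurd h this
    · rw [h]; norm_num] at h
  rw [Finset.sum_const, hWc] at h
  have := hp.lam_le
  norm_num [endConst] at h
  linarith

/-- Vertices attached to two ends are orthogonal to all later vertices. -/
lemma LevelForm.resid_full (hF : LevelForm g a lev lam k₁) (hp : Params lam k₁)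
    (hg : IsSigned g) (hl : IsLevel g a lev) {k : ℕ} {y z : V} (hy : lev y = k + 1)
    (hf : levelResid g a lev k y y = 0) (hyz : y ≠ z) (hz : k < lev z ∧ lev z ≤ k + 2) :
    levelResid g a lev k y z = 0 := by
  rw [levelResid_self hg] at hf
  obtain ⟨p, hpE, q, hqE, hpq, hp0, hq0, hpq0⟩ := exists_pair_of_sum_sq_eq_two
    (fun w => endForm_entries hl hg w y) (E := ends g a lev k) (by linarith)
  have hW : ({p, q} : Finset (Option V)) ⊆ ends g a lev k := by
    intro w hw
    rw [Finset.mem_insert, Finset.mem_singleton] at hw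
    rcases hw with rfl | rfl <;> assumption
  rw [levelResid_of_ne k hyz, ← Finset.sum_subset hW, Finset.sum_pair hpq]
  · have := eq_of_two_ends hp.lam_le (s := endForm g a p y) (t := endForm g a q y)
      (u := endForm g a p z) (v := endForm g a q z) (c := g y z)
      (by rcases endForm_entries hl hg p y with h | h | h <;> simp_all)
      (by rcases endForm_entries hl hg q y with h | h | h <;> simp_all)
      (endForm_entries hl hg _ _) (endForm_entries hl hg _ _) (hg.entries _ _) (by
        intro x x'
        have h := hF.core_two hg (m := 2) (by norm_num) (by norm_num) hyz x x' (by omega) hz hW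
          (Finset.card_pair hpq)
        rw [Finset.sum_pair hpq] at h
        simpa [endConst] using h)
    linarith
  · intro w hw hw'
    simp only [Finset.mem_insert, Finset.mem_singleton, not_or] at hw'
    rw [hpq0 w hw hw'.1 hw'.2, zero_mul]

end

lemma sq_add_three_le {u v w b c d : ℝ} (hu : |u| ≤ b) (hv : |v| ≤ c) (hw : |w| ≤ d) :
    (u + v + w) ^ 2 ≤ (b + c + d) ^ 2 := by
  rw [abs_le] at hu hv hw
  apply sq_le_sq' <;> linarith [hu.1, hu.2, hv.1, hv.2, hw.1, hw.2]

lemma abs_mul_sign_le {x c : ℝ} (hx : |x| ≤ c) {s : ℤ} (h : s = 1 ∨ s = -1) :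
    |x * s| ≤ c := by
  rcases h with h | h <;> rw [h] <;> simpa

/-- Sums of squares over the ends of three vertices, each attached to at most one end. -/
lemma sum_sq_three_ends {β : Type} [DecidableEq β] {p q r : β} {u v w : β → ℝ} {b c d : ℝ}
    (hu : |u p| ≤ b) (hv : |v q| ≤ c) (hw : |w r| ≤ d)
    (hu0 : ∀ t ∈ ({p, q, r} : Finset β), t ≠ p → u t = 0)
    (hv0 : ∀ t ∈ ({p, q, r} : Finset β), t ≠ q → v t = 0)
    (hw0 : ∀ t ∈ ({p, q, r} : Finset β), t ≠ r → w t = 0) :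
    (({p, q, r} : Finset β).card = 1 ∧
      ∑ t ∈ {p, q, r}, (u t + v t + w t) ^ 2 ≤ (b + c + d) ^ 2) ∨
    (({p, q, r} : Finset β).card = 2 ∧
      (∑ t ∈ {p, q, r}, (u t + v t + w t) ^ 2 ≤ (b + c) ^ 2 + d ^ 2 ∨
      ∑ t ∈ {p, q, r}, (u t + v t + w t) ^ 2 ≤ (b + d) ^ 2 + c ^ 2 ∨
      ∑ t ∈ {p, q, r}, (u t + v t + w t) ^ 2 ≤ b ^ 2 + (c + d) ^ 2)) ∨
    (({p, q, r} : Finset β).card = 3 ∧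
      ∑ t ∈ {p, q, r}, (u t + v t + w t) ^ 2 ≤ b ^ 2 + c ^ 2 + d ^ 2) := by
  have h0 : |(0 : ℝ)| ≤ 0 := by simp
  by_cases hpq : p = q
  · subst hpq
    by_cases hpr : p = r
    · subst hpr
      left
      simp only [Finset.pair_eq_singleton, Finset.card_singleton,
        Finset.sum_singleton, true_and]
      exact sq_add_three_le hu hv hw
    · right; left
      have e : ({p, p, r} : Finset β) = {p, r} := by simp
      rw [e, Finset.card_pair hpr, Finset.sum_pair hpr]
      refine ⟨rfl, Or.inl ?_⟩
      rw [hw0 p (by simp) hpr, hu0 r (by simp) (Ne.symm hpr), hv0 r (by simp) (Ne.symm hpr)]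
      have h1 := sq_add_three_le hu hv h0
      have h2 := sq_add_three_le h0 h0 hw
      simp only [add_zero, zero_add] at h1 h2 ⊢
      linarith
  · by_cases hpr : p = r
    · subst hpr
      right; left
      have e : ({p, q, p} : Finset β) = {p, q} := by
        ext t; simp only [Finset.mem_insert, Finset.mem_singleton]; tauto
      rw [e] at hu0 hv0 hw0 ⊢
      rw [Finset.card_pair hpq, Finset.sum_pair hpq]
      refine ⟨rfl, Or.inr (Or.inl ?_)⟩
      rw [hv0 p (by simp) hpq, hu0 q (by simp) (Ne.symm hpq), hw0 q (by simp) (Ne.symm hpq)]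
      have h1 := sq_add_three_le hu h0 hw
      have h2 := sq_add_three_le h0 hv h0
      simp only [add_zero, zero_add] at h1 h2 ⊢
      linarith
    · by_cases hqr : q = r
      · subst hqr
        right; left
        have e : ({p, q, q} : Finset β) = {p, q} := by simp
        rw [e] at hu0 hv0 hw0 ⊢
        rw [Finset.card_pair hpq, Finset.sum_pair hpq]
        refine ⟨rfl, Or.inr (Or.inr ?_)⟩
        rw [hv0 p (by simp) hpq, hw0 p (by simp) hpq, hu0 q (by simp) (Ne.symm hpq)]
        have h1 := sq_add_three_le hu h0 h0
        have h2 := sq_add_three_le h0 hv hw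
        simp only [add_zero, zero_add] at h1 h2 ⊢
        linarith
      · right; right
        rw [Finset.card_eq_three.2 ⟨p, q, r, hpq, hpr, hqr, rfl⟩,
          Finset.sum_insert (by simp [hpq, hpr]), Finset.sum_pair hqr]
        refine ⟨rfl, ?_⟩
        rw [hv0 p (by simp) hpq, hw0 p (by simp) hpr, hu0 q (by simp) (Ne.symm hpq),
          hw0 q (by simp) hqr, hu0 r (by simp) (Ne.symm hpr), hv0 r (by simp) (Ne.symm hqr)]
        have h1 := sq_add_three_le hu h0 h0
        have h2 := sq_add_three_le h0 hv h0
        have h3 := sq_add_three_le h0 h0 hw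
        simp only [add_zero, zero_add] at h1 h2 h3 ⊢
        linarith

section

variable {V : Type} [Fintype V] [LinearOrder V] {g : V → V → ℤ} {a : V → ℤ} {lev : V → ℕ}
  {lam k₁ : ℝ}

/-- A vertex at level `k + 1` attached to exactly one end. -/
structure IsSingle (g : V → V → ℤ) (a : V → ℤ) (lev : V → ℕ) (k : ℕ) (y : V) : Prop where
  level : lev y = k + 1
  resid : levelResid g a lev k y y = 1

lemma IsSingle.exists_end (hg : IsSigned g) {k : ℕ} {y : V} (h : IsSingle g a lev k y) :
    ∃ p ∈ ends g a lev k, (endForm g a p y = 1 ∨ endForm g a p y = -1) ∧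
      ∀ w ∈ ends g a lev k, w ≠ p → endForm g a w y = 0 := by
  have h1 := h.resid
  rw [levelResid_self hg] at h1
  obtain ⟨p, hp, h2, h3⟩ := exists_unique_of_sum_sq_eq_one (E := ends g a lev k)
    (f := fun w => endForm g a w y) (by linarith)
  exact ⟨p, hp, mul_self_eq_one_iff.1 (by rw [← sq]; exact h2), h3⟩

lemma IsSingle.entries (hF : LevelForm g a lev lam k₁) (hp : Params lam k₁)
    (hg : IsSigned g) {k : ℕ} {y z : V} (hy : IsSingle g a lev k y)
    (hz : IsSingle g a lev k z) (hyz : y ≠ z) :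
    levelResid g a lev k y z = -1 ∨ levelResid g a lev k y z = 0 ∨
      levelResid g a lev k y z = 1 := by
  obtain ⟨p, hpE, hp1, hp2⟩ := hy.exists_end hg
  obtain ⟨q, hqE, hq1, hq2⟩ := hz.exists_end hg
  rw [levelResid_of_ne k hyz, Finset.sum_eq_single_of_mem p hpE fun w hw hwp => by
    rw [hp2 w hw hwp, zero_mul]]
  by_cases hpq : p = q
  · subst hpq
    have h := hF.core_two hg (m := 1) le_rfl (by norm_num) hyz (endForm g a p y) (endForm g a p z)
      (by have := hy.level; omega) (by have := hz.level; omega) (W := {p})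
      (Finset.singleton_subset_iff.2 hpE) (Finset.card_singleton _)
    rw [Finset.sum_singleton] at h
    have h3 := hp.lam_le
    have h4 := hp.k_ge
    rcases hp1 with h1 | h1 <;> rcases hq1 with h2 | h2 <;>
      rcases hg.entries y z with h0 | h0 | h0 <;> rw [h1, h2] at h ⊢ <;> rw [h0] at h ⊢ <;>
      norm_num [endConst] at h ⊢ <;> linarith
  · rw [hq2 p hpE hpq, mul_zero, sub_zero]
    exact hg.entries y z

lemma IsSingle.trans (hF : LevelForm g a lev lam k₁) (hp : Params lam k₁)
    (hg : IsSigned g) {k : ℕ} {y₁ y₂ y₃ : V} (h₁ : IsSingle g a lev k y₁)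
    (h₂ : IsSingle g a lev k y₂) (h₃ : IsSingle g a lev k y₃) (h12 : y₁ ≠ y₂) (h13 : y₁ ≠ y₃)
    (h23 : y₂ ≠ y₃) (e12 : levelResid g a lev k y₁ y₂ ≠ 0)
    (e23 : levelResid g a lev k y₂ y₃ ≠ 0) :
    levelResid g a lev k y₁ y₃ = levelResid g a lev k y₁ y₂ * levelResid g a lev k y₂ y₃ := by
  obtain ⟨p₁, hpE₁, hs₁, hz₁⟩ := h₁.exists_end hg
  obtain ⟨p₂, hpE₂, hs₂, hz₂⟩ := h₂.exists_end hg
  obtain ⟨p₃, hpE₃, hs₃, hz₃⟩ := h₃.exists_end hg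
  have E12 := h₁.entries hF hp hg h₂ h12
  have E13 := h₁.entries hF hp hg h₃ h13
  have E23 := h₂.entries hF hp hg h₃ h23
  have hW : ({p₁, p₂, p₃} : Finset (Option V)) ⊆ ends g a lev k := by
    intro w hw
    simp only [Finset.mem_insert, Finset.mem_singleton] at hw
    rcases hw with rfl | rfl | rfl <;> assumption
  have core := fun (m : ℕ) hm1 hm3 x₁ x₂ x₃ hWm => hF.core_three hg (m := m) hm1 hm3 h12 h13 h23
    x₁ x₂ x₃ (by have := h₁.level; omega) (by have := h₂.level; omega)
    (by have := h₃.level; omega) hW hWm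
    (fun w hw hw' => hz₁ w hw (by rintro rfl; simp at hw'))
    (fun w hw hw' => hz₂ w hw (by rintro rfl; simp at hw'))
    (fun w hw hw' => hz₃ w hw (by rintro rfl; simp at hw'))
  rw [h₁.resid, h₂.resid, h₃.resid] at core
  have hlam := hp.lam_le
  have hlam' := hp.lam_ge
  have hk := hp.k_ge
  have hk' := hp.k_lt
  set c12 := levelResid g a lev k y₁ y₂
  set c13 := levelResid g a lev k y₁ y₃
  set c23 := levelResid g a lev k y₂ y₃
  have a12 : |(-0.7 : ℝ) * c12| ≤ 0.7 := by
    rcases E12 with h | h | h <;> rw [h] <;> norm_num [abs_le]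
  have a23 : |(-0.7 : ℝ) * c23| ≤ 0.7 := by
    rcases E23 with h | h | h <;> rw [h] <;> norm_num [abs_le]
  have bound := sum_sq_three_ends
    (u := fun w => -0.7 * c12 * endForm g a w y₁) (v := fun w => 1 * endForm g a w y₂)
    (w := fun w => -0.7 * c23 * endForm g a w y₃)
    (abs_mul_sign_le a12 hs₁) (abs_mul_sign_le (c := 1) (by simp) hs₂)
    (abs_mul_sign_le a23 hs₃)
    (fun w hw h => by rw [hz₁ w (hW hw) h]; simp) (fun w hw h => by rw [hz₂ w (hW hw) h]; simp)
    (fun w hw h => by rw [hz₃ w (hW hw) h]; simp)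
  have main : ∀ m, 1 ≤ m → m ≤ 3 → ({p₁, p₂, p₃} : Finset (Option V)).card = m → c13 ≠ c12 * c23 →
      0 ≤ (lam - 1) * 1.98 - 2.8 + (1 - endConst k₁ m) * ∑ w ∈ {p₁, p₂, p₃},
        (-0.7 * c12 * (endForm g a w y₁ : ℝ) + 1 * endForm g a w y₂ +
          -0.7 * c23 * endForm g a w y₃) ^ 2 := by
    intro m hm1 hm3 hm hne
    refine (core m hm1 hm3 (-0.7 * c12) 1 (-0.7 * c23) hm).trans ?_
    apply add_le_add_left
    rcases E12 with h | h | h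
    · rcases E23 with h' | h' | h'
      · rcases E13 with h'' | h'' | h'' <;> rw [h, h', h''] at hne ⊢ <;>
          first | (norm_num at hne; done) | (norm_num; try linarith)
      · exact absurd h' e23
      · rcases E13 with h'' | h'' | h'' <;> rw [h, h', h''] at hne ⊢ <;>
          first | (norm_num at hne; done) | (norm_num; try linarith)
    · exact absurd h e12
    · rcases E23 with h' | h' | h'
      · rcases E13 with h'' | h'' | h'' <;> rw [h, h', h''] at hne ⊢ <;>
          first | (norm_num at hne; done) | (norm_num; try linarith)
      · exact absurd h' e23
      · rcases E13 with h'' | h'' | h'' <;> rw [h, h', h''] at hne ⊢ <;>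
          first | (norm_num at hne; done) | (norm_num; try linarith)
  by_contra hne
  clear core
  rcases bound with ⟨hm, hb⟩ | ⟨hm, hb⟩ | ⟨hm, hb⟩
  · have := main 1 le_rfl (by norm_num) hm hne
    norm_num [endConst] at this hb
    nlinarith
  · have := main 2 (by norm_num) (by norm_num) hm hne
    norm_num [endConst] at this hb
    rcases hb with hb | hb | hb <;> nlinarith
  · have := main 3 (by norm_num) (by norm_num) hm hne
    norm_num [endConst] at this hb
    nlinarith

/-- Equivalent vertices have proportional rows towards the next level. -/
lemma IsSingle.next (hF : LevelForm g a lev lam k₁) (hp : Params lam k₁)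
    (hg : IsSigned g) (hl : IsLevel g a lev) {k : ℕ} {i j z : V} (hi : IsSingle g a lev k i)
    (hj : IsSingle g a lev k j) (hij : i ≠ j) (hz : lev z = k + 2)
    (e : levelResid g a lev k i j ≠ 0) (hzi : g z i ≠ 0) :
    g z i = levelResid g a lev k i j * g z j := by
  obtain ⟨p, hpE, hs, hzero⟩ := hi.exists_end hg
  obtain ⟨q, hqE, ht, hzero'⟩ := hj.exists_end hg
  have E := hi.entries hF hp hg hj hij
  have hiz : i ≠ z := by rintro rfl; have := hi.level; omega
  have hjz : j ≠ z := by rintro rfl; have := hj.level; omega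
  have hW : ({p, q} : Finset (Option V)) ⊆ ends g a lev k := by
    intro w hw
    simp only [Finset.mem_insert, Finset.mem_singleton] at hw
    rcases hw with rfl | rfl <;> assumption
  have hz0 : ∀ w ∈ ends g a lev k, endForm g a w z = 0 := fun w hw =>
    endForm_eq_zero hl hg hw (by omega)
  have core := fun (m : ℕ) hm1 hm3 x₁ x₂ x₃ hWm => hF.core_three hg (m := m) hm1 hm3 hij hiz hjz
    x₁ x₂ x₃ (by have := hi.level; omega) (by have := hj.level; omega) (by omega) hW hWm
    (fun w hw hw' => hzero w hw (by rintro rfl; simp at hw'))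
    (fun w hw hw' => hzero' w hw (by rintro rfl; simp at hw'))
    (fun w hw _ => hz0 w hw)
  rw [hi.resid, hj.resid, levelResid_far_self hl hg k (by omega),
    levelResid_far hl hg k (by omega) hiz, levelResid_far hl hg k (by omega) hjz,
    hg.symm i z, hg.symm j z] at core
  have hlam := hp.lam_le
  have hlam' := hp.lam_ge
  have hk := hp.k_ge
  have hk' := hp.k_lt
  have bound : ∀ x₁ x₂ x₃ c₁ c₂ : ℝ, |x₁| ≤ c₁ → |x₂| ≤ c₂ →
      (({p, q} : Finset (Option V)).card = 1 ∧ ∑ w ∈ {p, q}, (x₁ * endForm g a w i +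
        x₂ * endForm g a w j + x₃ * endForm g a w z) ^ 2 ≤ (c₁ + c₂) ^ 2) ∨
      (({p, q} : Finset (Option V)).card = 2 ∧ ∑ w ∈ {p, q}, (x₁ * endForm g a w i +
        x₂ * endForm g a w j + x₃ * endForm g a w z) ^ 2 ≤ c₁ ^ 2 + c₂ ^ 2) := by
    intro x₁ x₂ x₃ c₁ c₂ h₁ h₂
    have h0 : |(0 : ℝ)| ≤ 0 := by simp
    by_cases hpq : p = q
    · subst hpq
      left
      simp only [Finset.pair_eq_singleton, Finset.card_singleton, Finset.sum_singleton, true_and]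
      have := sq_add_three_le (abs_mul_sign_le h₁ hs) (abs_mul_sign_le h₂ ht) h0
      simpa [hz0 p hpE] using this
    · right
      rw [Finset.card_pair hpq, Finset.sum_pair hpq, hzero q hqE (Ne.symm hpq), hzero' p hpE hpq,
        hz0 p hpE, hz0 q hqE]
      have h3 := sq_add_three_le (abs_mul_sign_le h₁ hs) h0 h0
      have h4 := sq_add_three_le (abs_mul_sign_le h₂ ht) h0 h0
      simp only [add_zero] at h3 h4
      simpa using add_le_add h3 h4
  have hzi' : g z i = 1 ∨ g z i = -1 := by
    rcases hg.entries z i with h | h | h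
    · exact Or.inr h
    · exact absurd h hzi
    · exact Or.inl h
  set c := levelResid g a lev k i j
  have hc : c = 1 ∨ c = -1 := by
    rcases E with h | h | h
    · exact Or.inr h
    · exact absurd h e
    · exact Or.inl h
  clear hzero hzero' hz0 E
  by_contra hne
  have hzj : g z j = 0 ∨ g z j = - c * g z i := by
    rcases hg.entries z j with h | h | h <;> rcases hc with h' | h' <;>
      rcases hzi' with h'' | h'' <;>
      rw [h, h', h''] at hne ⊢ <;> revert hne <;> decide
  have hcsq : (c : ℝ) * c = 1 := by rcases hc with h | h <;> rw [h] <;> norm_num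
  have hzsq : (g z i : ℝ) * g z i = 1 := by rcases hzi' with h | h <;> rw [h] <;> norm_num
  have habs : ∀ t : ℝ, 0 ≤ t → |-(c * t)| ≤ t := by
    intro t ht
    rcases hc with h | h <;> rw [h] <;> simp [abs_of_nonneg ht]
  rcases hzj with hzj | hzj
  · rw [hzj] at core
    have val : ∀ m x y t : ℝ, ∀ S : ℝ, ((1 : ℤ) : ℝ) * x ^ 2 + ((1 : ℤ) : ℝ) * (-(c * y)) ^ 2 +
        ((2 : ℤ) : ℝ) * (-(g z i * t)) ^ 2 + 2 * (c * x * (-(c * y)) + g z i * x * (-(g z i * t)) +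
        ((0 : ℤ) : ℝ) * (-(c * y)) * (-(g z i * t))) + (lam - 2) * (x ^ 2 + (-(c * y)) ^ 2 +
        (-(g z i * t)) ^ 2) + (1 - m) * S =
        (lam - 1) * (x ^ 2 + y ^ 2) + lam * t ^ 2 - 2 * x * y - 2 * x * t + (1 - m) * S := by
      intro m x y t S
      push_cast
      linear_combination ((lam - 1) * y ^ 2 - 2 * x * y) * hcsq + (lam * t ^ 2 - 2 * x * t) * hzsq
    rcases bound 1 (-(c * 0.8)) (-(g z i * 0.5)) 1 0.8 (by simp) (habs _ (by norm_num)) with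
      ⟨hm, hb⟩ | ⟨hm, hb⟩
    · clear hb
      have hx0 : 0 ≤ lam * (lam - k₁) := by nlinarith
      have hy0 : 0 ≤ lam * k₁ := by nlinarith
      have := core 1 le_rfl (by norm_num) (lam * (lam - k₁)) (-(c * (lam * k₁)))
        (-(g z i * (lam - k₁))) hm
      rw [val] at this
      rcases bound (lam * (lam - k₁)) (-(c * (lam * k₁))) (-(g z i * (lam - k₁))) _ _
        (abs_of_nonneg hx0).le (habs _ hy0) with ⟨-, hb⟩ | ⟨hm', -⟩
      · have hE := hp.tight
        norm_num [endConst] at this hb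
        have h1 := mul_le_mul_of_nonneg_left hb (by linarith : 0 ≤ 1 - k₁)
        have h2 : 0 ≤ lam * (lam - k₁) * (lam ^ 2 * (lam - 2 * k₁) - (lam - k₁)) := by
          nlinarith
        have h3 : 0 < lam * (lam - k₁) := by nlinarith
        nlinarith
      · omega
    · have := core 2 (by norm_num) (by norm_num) 1 (-(c * 0.8)) (-(g z i * 0.5)) hm
      rw [val] at this
      norm_num [endConst] at this hb
      nlinarith
  · rw [hzj] at core
    have val : ∀ m : ℝ, ∀ S : ℝ, ((1 : ℤ) : ℝ) * 1 ^ 2 + ((1 : ℤ) : ℝ) * (-(c * 1)) ^ 2 +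
        ((2 : ℤ) : ℝ) * (-(g z i * 1)) ^ 2 + 2 * (c * 1 * (-(c * 1)) + g z i * 1 * (-(g z i * 1)) +
        ((-c * g z i : ℤ) : ℝ) * (-(c * 1)) * (-(g z i * 1))) + (lam - 2) * (1 ^ 2 +
        (-(c * 1)) ^ 2 + (-(g z i * 1)) ^ 2) + (1 - m) * S = 3 * lam - 8 + (1 - m) * S := by
      intro m S
      push_cast
      linear_combination ((lam - 1) - 2 - 2 * g z i * g z i) * hcsq + (lam - 4) * hzsq
    rcases bound 1 (-(c * 1)) (-(g z i * 1)) 1 1 (by simp) (habs _ (by norm_num)) with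
      ⟨hm, hb⟩ | ⟨hm, hb⟩
    · have := core 1 le_rfl (by norm_num) 1 (-(c * 1)) (-(g z i * 1)) hm
      rw [val] at this
      norm_num [endConst] at this hb
      nlinarith
    · have := core 2 (by norm_num) (by norm_num) 1 (-(c * 1)) (-(g z i * 1)) hm
      rw [val] at this
      norm_num [endConst] at this hb
      nlinarith

end

/-- Integral vectors whose Gram matrix is `2 • 1 + g`. -/
def Represents {V W : Type} [Fintype W] (g : V → V → ℤ) (u : V → W → ℤ) : Prop :=
  ∀ i j, ∑ w, u i w * u j w = (if i = j then 2 else 0) + g i j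

section

variable {V : Type} [Fintype V] [LinearOrder V] {g : V → V → ℤ} {a : V → ℤ} {lev : V → ℕ}
  {lam k₁ : ℝ}

lemma IsSingle.resid_mul_self (hF : LevelForm g a lev lam k₁) (hp : Params lam k₁)
    (hg : IsSigned g) {k : ℕ} {y z : V} (hy : IsSingle g a lev k y) (hz : IsSingle g a lev k z)
    (h : levelResid g a lev k y z ≠ 0) :
    levelResid g a lev k y z * levelResid g a lev k y z = 1 := by
  by_cases hyz : y = z
  · subst hyz; rw [hy.resid]; rfl
  · rcases hy.entries hF hp hg hz hyz with h' | h' | h'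
    · rw [h']; rfl
    · exact absurd h' h
    · rw [h']; rfl

lemma IsSingle.resid_trans (hF : LevelForm g a lev lam k₁) (hp : Params lam k₁)
    (hg : IsSigned g) {k : ℕ} {x y z : V} (hx : IsSingle g a lev k x) (hy : IsSingle g a lev k y)
    (hz : IsSingle g a lev k z) (h : levelResid g a lev k x y ≠ 0)
    (h' : levelResid g a lev k y z ≠ 0) :
    levelResid g a lev k x z = levelResid g a lev k x y * levelResid g a lev k y z := by
  by_cases hxy : x = y
  · subst hxy; rw [hx.resid, one_mul]
  by_cases hyz : y = z
  · subst hyz; rw [hz.resid, mul_one]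
  by_cases hxz : x = z
  · subst hxz
    rw [hx.resid, levelResid_comm hg k y x, hx.resid_mul_self hF hp hg hy h]
  exact hx.trans hF hp hg hy hz hxy hxz hyz h h'

lemma isSingle_of_mem_ends {k : ℕ} {r : V} (h : some r ∈ ends g a lev (k + 1)) :
    IsSingle g a lev k r := by
  rw [some_mem_ends_succ] at h
  exact ⟨h.1, h.2.1⟩

/-- Each class has a representative among the ends. -/
lemma IsSingle.exists_rep (hF : LevelForm g a lev lam k₁) (hp : Params lam k₁)
    (hg : IsSigned g) (hl : IsLevel g a lev) {k : ℕ} (hpos : ∀ y, lev y = k + 1 →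
      1 ≤ ∑ w ∈ ends g a lev k, endForm g a w y * endForm g a w y)
    {i : V} (hi : IsSingle g a lev k i) :
    ∃ r, some r ∈ ends g a lev (k + 1) ∧ levelResid g a lev k r i ≠ 0 := by
  let S := Finset.univ.filter fun y => lev y = k + 1 ∧ levelResid g a lev k y i ≠ 0
  have hS : S.Nonempty := ⟨i, by simp [S, hi.level, hi.resid]⟩
  obtain ⟨h1, h2⟩ := (Finset.mem_filter.1 (S.min'_mem hS)).2
  set r := S.min' hS with hr
  have single : ∀ y, lev y = k + 1 → levelResid g a lev k y i ≠ 0 → IsSingle g a lev k y := by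
    intro y hy hyi
    by_cases hy' : y = i
    · rwa [hy']
    refine ⟨hy, ?_⟩
    have h3 := hF.sum_sq_le_two hp hg hl hy
    have h4 := hpos y hy
    have h5 := levelResid_self hg (a := a) (lev := lev) k y
    by_contra hne
    refine hyi (hF.resid_full hp hg hl hy (by omega) hy' ?_)
    have := hi.level
    omega
  have hrs := single r h1 h2
  refine ⟨r, some_mem_ends_succ.2 ⟨h1, hrs.resid, fun y hy hyl => ?_⟩, h2⟩
  by_contra hyr
  change levelResid g a lev k y r ≠ 0 at hyr
  have hys : IsSingle g a lev k y := by
    refine ⟨hyl, ?_⟩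
    have h3 := hF.sum_sq_le_two hp hg hl hyl
    have h4 := hpos y hyl
    have h5 := levelResid_self hg (a := a) (lev := lev) k y
    by_contra hne
    exact hyr (hF.resid_full hp hg hl hyl (by omega) hy.ne (by omega))
  have hyi := hys.resid_trans hF hp hg hrs hi hyr h2
  have : r ≤ y := S.min'_le y (by
    simp only [S, Finset.mem_filter, Finset.mem_univ, true_and]
    exact ⟨hyl, by rw [hyi]; exact mul_ne_zero hyr h2⟩)
  exact absurd hy (not_lt.2 this)

lemma IsSingle.next_all (hF : LevelForm g a lev lam k₁) (hp : Params lam k₁)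
    (hg : IsSigned g) (hl : IsLevel g a lev) {k : ℕ} {i r z : V} (hi : IsSingle g a lev k i)
    (hr : IsSingle g a lev k r) (hz : lev z = k + 2) (e : levelResid g a lev k r i ≠ 0) :
    levelResid g a lev k r i * g r z = g i z := by
  by_cases hir : i = r
  · subst hir; rw [hi.resid, one_mul]
  have e' : levelResid g a lev k i r ≠ 0 := by rwa [levelResid_comm hg]
  rw [hg.symm r z, hg.symm i z]
  by_cases hzi : g z i = 0
  · rw [hzi]
    by_contra h
    have h1 : g z r ≠ 0 := right_ne_zero_of_mul h
    exact h1 (by rw [hr.next hF hp hg hl hi (Ne.symm hir) hz e h1, hzi, mul_zero])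
  · rw [hi.next hF hp hg hl hr hir hz e' hzi, levelResid_comm hg k r i]

lemma LevelForm.one_le_sum (hF : LevelForm g a lev lam k₁) (hp : Params lam k₁)
    (hg : IsSigned g) (hl : IsLevel g a lev) (k : ℕ) : ∀ y, lev y = k + 1 →
      1 ≤ ∑ w ∈ ends g a lev k, endForm g a w y * endForm g a w y := by
  have key : ∀ k y w, w ∈ ends g a lev k → endForm g a w y ≠ 0 →
      1 ≤ ∑ w ∈ ends g a lev k, endForm g a w y * endForm g a w y := by
    intro k y w hw h
    refine le_trans ?_ (Finset.single_le_sum (f := fun w => endForm g a w y * endForm g a w y)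
      (fun w _ => mul_self_nonneg _) hw)
    have := mul_self_pos.2 h
    omega
  induction k using Nat.strong_induction_on with
  | _ k ih =>
  intro y hy
  cases k with
  | zero => exact key 0 y none (by simp [ends]) ((hl.one y).1 hy)
  | succ k =>
    obtain ⟨i, hyi, hi⟩ := hl.pred y (by omega)
    have hik : lev i = k + 1 := by omega
    have his : IsSingle g a lev k i := by
      refine ⟨hik, ?_⟩
      have h3 := hF.sum_sq_le_two hp hg hl hik
      have h4 := ih k (by omega) i hik
      have h5 := levelResid_self hg (a := a) (lev := lev) k i
      by_contra hne
      have hne' : i ≠ y := by rintro rfl; exact hyi (hg.diag _)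
      have := hF.resid_full hp hg hl hik (by omega) hne' (by omega)
      rw [levelResid_far hl hg k (by omega) hne', hg.symm] at this
      exact hyi this
    obtain ⟨r, hr, h2⟩ := his.exists_rep hF hp hg hl (ih k (by omega))
    refine key (k + 1) y (some r) hr ?_
    have := his.next_all hF hp hg hl (isSingle_of_mem_ends hr) hy h2
    change g r y ≠ 0
    intro h0
    rw [h0, mul_zero] at this
    rw [hg.symm] at hyi
    exact hyi this.symm

/-- The coordinate of a vertex at an end of its own level. -/
noncomputable def ownCoord (g : V → V → ℤ) (a : V → ℤ) (lev : V → ℕ) (k : ℕ) (y : V) :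
    Option V → ℤ
  | none => 0
  | some r => levelResid g a lev k r y

lemma sum_ownCoord_mul (hF : LevelForm g a lev lam k₁) (hp : Params lam k₁)
    (hg : IsSigned g) (hl : IsLevel g a lev) {k : ℕ} {i : V} (hi : IsSingle g a lev k i) :
    ∃ r, IsSingle g a lev k r ∧ levelResid g a lev k r i ≠ 0 ∧ ∀ f : Option V → ℤ,
      ∑ w ∈ ends g a lev (k + 1), ownCoord g a lev k i w * f w =
        levelResid g a lev k r i * f (some r) := by
  obtain ⟨r, hr, hri⟩ := hi.exists_rep hF hp hg hl (hF.one_le_sum hp hg hl k)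
  refine ⟨r, isSingle_of_mem_ends hr, hri, fun f => ?_⟩
  rw [Finset.sum_eq_single_of_mem _ hr]
  · rfl
  · intro w hw hwr
    obtain ⟨s, rfl, -⟩ := mem_ends_succ.1 hw
    have : levelResid g a lev k s i = 0 := by
      by_contra hsi
      have h := (isSingle_of_mem_ends hw).resid_trans hF hp hg hi (isSingle_of_mem_ends hr) hsi
        (by rwa [levelResid_comm hg])
      have h0 : levelResid g a lev k s r = 0 :=
        residGram_ends_of_ne hg hw hr (fun h => hwr (by rw [h]))
      rw [h0, levelResid_comm hg k i r] at h
      exact mul_ne_zero hsi hri h.symm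
    simp [ownCoord, this]

lemma full_of_not_isSingle (hF : LevelForm g a lev lam k₁) (hp : Params lam k₁)
    (hg : IsSigned g) (hl : IsLevel g a lev) {k : ℕ} {i : V} (h : lev i = k + 1)
    (hi : ¬ IsSingle g a lev k i) : levelResid g a lev k i i = 0 := by
  have h3 := hF.sum_sq_le_two hp hg hl h
  have h4 := hF.one_le_sum hp hg hl k i h
  have h5 := levelResid_self hg (a := a) (lev := lev) k i
  have h6 : levelResid g a lev k i i ≠ 1 := fun h' => hi ⟨h, h'⟩
  omega

lemma ownCoord_eq_zero (hF : LevelForm g a lev lam k₁) (hp : Params lam k₁)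
    (hg : IsSigned g) (hl : IsLevel g a lev) {k : ℕ} {i : V} (h : lev i = k + 1)
    (hi : ¬ IsSingle g a lev k i) {w : Option V} (hw : w ∈ ends g a lev (k + 1)) :
    ownCoord g a lev k i w = 0 := by
  obtain ⟨s, rfl, -⟩ := mem_ends_succ.1 hw
  have hs := isSingle_of_mem_ends hw
  change levelResid g a lev k s i = 0
  rw [levelResid_comm hg]
  have := hs.level
  exact hF.resid_full hp hg hl h (full_of_not_isSingle hF hp hg hl h hi)
    (by rintro rfl; exact hi hs) (by omega)

lemma sum_ownCoord_ownCoord (hF : LevelForm g a lev lam k₁) (hp : Params lam k₁)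
    (hg : IsSigned g) (hl : IsLevel g a lev) {k : ℕ} {i j : V} (hi : lev i = k + 1)
    (hj : lev j = k + 1) :
    ∑ w ∈ ends g a lev (k + 1), ownCoord g a lev k i w * ownCoord g a lev k j w =
      levelResid g a lev k i j := by
  have full : ∀ i j, lev i = k + 1 → lev j = k + 1 → ¬ IsSingle g a lev k i →
      levelResid g a lev k i j = 0 := by
    intro i j hi hj his
    by_cases hij : i = j
    · subst hij; exact full_of_not_isSingle hF hp hg hl hi his
    · exact hF.resid_full hp hg hl hi (full_of_not_isSingle hF hp hg hl hi his) hij (by omega)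
  by_cases his : IsSingle g a lev k i
  · by_cases hjs : IsSingle g a lev k j
    · obtain ⟨r, hr, hri, h⟩ := sum_ownCoord_mul hF hp hg hl his
      rw [h]
      change levelResid g a lev k r i * levelResid g a lev k r j = _
      have hir : levelResid g a lev k i r ≠ 0 := by rwa [levelResid_comm hg]
      by_cases hrj : levelResid g a lev k r j = 0
      · rw [hrj, mul_zero]
        by_contra hij
        exact mul_ne_zero hri (Ne.symm hij)
          (by rw [← hr.resid_trans hF hp hg his hjs hri (Ne.symm hij), hrj])
      · rw [his.resid_trans hF hp hg hr hjs hir hrj, levelResid_comm hg k r i]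
    · rw [levelResid_comm hg, full j i hj hi hjs]
      exact Finset.sum_eq_zero fun w hw => by rw [ownCoord_eq_zero hF hp hg hl hj hjs hw, mul_zero]
  · rw [full i j hi hj his]
    exact Finset.sum_eq_zero fun w hw => by rw [ownCoord_eq_zero hF hp hg hl hi his hw, zero_mul]

lemma sum_ownCoord_endForm (hF : LevelForm g a lev lam k₁) (hp : Params lam k₁)
    (hg : IsSigned g) (hl : IsLevel g a lev) {k : ℕ} {i z : V} (hi : lev i = k + 1)
    (hz : lev z = k + 2) :
    ∑ w ∈ ends g a lev (k + 1), ownCoord g a lev k i w * endForm g a w z = g i z := by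
  by_cases his : IsSingle g a lev k i
  · obtain ⟨r, hr, hri, h⟩ := sum_ownCoord_mul hF hp hg hl his
    rw [h]
    exact his.next_all hF hp hg hl hr hz hri
  · rw [Finset.sum_eq_zero fun w hw => by rw [ownCoord_eq_zero hF hp hg hl hi his hw, zero_mul]]
    have hne : i ≠ z := by rintro rfl; omega
    have := hF.resid_full hp hg hl hi (full_of_not_isSingle hF hp hg hl hi his) hne (by omega)
    rw [levelResid_far hl hg k (by omega) hne] at this
    exact this.symm

lemma eq_of_mem_ends {k l : ℕ} {w : Option V} (h : w ∈ ends g a lev k) (h' : w ∈ ends g a lev l) :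
    k = l := by
  cases k <;> cases l
  · rfl
  · simp only [ends, Finset.mem_singleton] at h
    obtain ⟨r, hr, -⟩ := mem_ends_succ.1 h'
    simp [h] at hr
  · simp only [ends, Finset.mem_singleton] at h'
    obtain ⟨r, hr, -⟩ := mem_ends_succ.1 h
    simp [h'] at hr
  · obtain ⟨r, hr, h1, -⟩ := mem_ends_succ.1 h
    obtain ⟨s, hs, h2, -⟩ := mem_ends_succ.1 h'
    rw [hr] at hs
    cases hs
    omega

/-- The vectors representing `2 • 1 + g`. -/
noncomputable def levelVec (g : V → V → ℤ) (a : V → ℤ) (lev : V → ℕ) (y : V) (w : Option V) : ℤ :=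
  (if w ∈ ends g a lev (lev y - 1) then endForm g a w y else 0) +
    if w ∈ ends g a lev (lev y) then ownCoord g a lev (lev y - 1) y w else 0


lemma sum_ite_ends (k l : ℕ) (f h : Option V → ℤ) :
    ∑ w, (if w ∈ ends g a lev k then f w else 0) * (if w ∈ ends g a lev l then h w else 0) =
      if k = l then ∑ w ∈ ends g a lev k, f w * h w else 0 := by
  by_cases hkl : k = l
  · subst hkl
    simp only [if_true, ← Finset.sum_filter, mul_ite, ite_mul, zero_mul, mul_zero]
    refine Finset.sum_congr ?_ fun _ _ => rfl
    ext w
    simp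
  · rw [if_neg hkl]
    refine Finset.sum_eq_zero fun w _ => ?_
    by_cases hw : w ∈ ends g a lev k
    · by_cases hw' : w ∈ ends g a lev l
      · exact absurd (eq_of_mem_ends hw hw') hkl
      · simp [hw']
    · simp [hw]

/-- Positivity of the level forms makes `2 • 1 + g` integrally representable. -/
theorem LevelForm.represents (hF : LevelForm g a lev lam k₁) (hp : Params lam k₁)
    (hg : IsSigned g) (hl : IsLevel g a lev) : Represents g (levelVec g a lev) := by
  have main : ∀ i j, lev i ≤ lev j → ∑ w, levelVec g a lev i w * levelVec g a lev j w =
      (if i = j then 2 else 0) + g i j := by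
    intro i j hij
    have hi := hl.pos i
    unfold levelVec
    simp only [add_mul, mul_add, Finset.sum_add_distrib, sum_ite_ends]
    obtain ⟨k, hk⟩ : ∃ k, lev i = k + 1 := ⟨lev i - 1, by omega⟩
    obtain ⟨l, hj⟩ : ∃ l, lev j = l + 1 := ⟨lev j - 1, by omega⟩
    rw [hk, hj]
    simp only [Nat.add_sub_cancel]
    rcases lt_trichotomy l (k + 1) with h | h | h
    · obtain rfl : l = k := by omega
      simp only [if_true, Nat.succ_ne_self, (Nat.succ_ne_self _).symm, if_false]
      rw [sum_ownCoord_ownCoord hF hp hg hl hk hj]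
      unfold levelResid residGram
      by_cases h : i = j
      · simp only [h, if_true]; ring
      · simp only [h, if_false]; ring
    · subst h
      have h1 : k ≠ k + 1 := by omega
      have h2 : k ≠ k + 1 + 1 := by omega
      have h3 : k + 1 ≠ k + 1 + 1 := by omega
      have h4 : i ≠ j := by rintro rfl; omega
      simp only [h1, h2, h3, h4, if_true, if_false]
      rw [sum_ownCoord_endForm hF hp hg hl hk hj]
      ring
    · have h1 : k ≠ l := by omega
      have h2 : k ≠ l + 1 := by omega
      have h3 : k + 1 ≠ l := by omega
      have h4 : i ≠ j := by rintro rfl; omega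
      have h5 : k + 1 ≠ l + 1 := by omega
      simp only [h1, h2, h3, h4, h5, if_false]
      have h6 : g i j = 0 := by
        by_contra h6
        have := hl.adj j i (by rwa [hg.symm])
        omega
      rw [h6]; ring
  intro i j
  rcases le_total (lev i) (lev j) with h | h
  · rw [main i j h]
    by_cases hij : i = j
    · simp [hij]
    · simp only [hij, if_false]
  · rw [Finset.sum_congr rfl fun w _ => mul_comm _ _, main j i h, hg.symm j i]
    by_cases hij : i = j
    · simp [hij]
    · simp only [hij, Ne.symm hij, if_false]

end

section

variable {V : Type} {g : V → V → ℤ} {a : V → ℤ}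

/-- Any two vertices are joined by a path. -/
def IsConn (g : V → V → ℤ) : Prop := ∀ i j, Relation.ReflTransGen (fun i j => g i j ≠ 0) i j

/-- A vertex is within `k` steps of the support of `a`. -/
def ReachIn (g : V → V → ℤ) (a : V → ℤ) : ℕ → V → Prop
  | 0, i => a i ≠ 0
  | k + 1, i => ∃ j, g i j ≠ 0 ∧ ReachIn g a k j

lemma exists_isLevel (ha : ∀ i, a i = -1 ∨ a i = 0 ∨ a i = 1)
    (h : ∀ i, ∃ j, a j ≠ 0 ∧ Relation.ReflTransGen (fun i j => g i j ≠ 0) i j) :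
    ∃ lev, IsLevel g a lev := by
  have hr : ∀ i, ∃ k, ReachIn g a k i := by
    intro i
    obtain ⟨j, hj, hij⟩ := h i
    induction hij using Relation.ReflTransGen.head_induction_on with
    | refl => exact ⟨0, hj⟩
    | head h1 _ ih =>
      obtain ⟨k, hk⟩ := ih
      exact ⟨k + 1, _, h1, hk⟩
  have adj : ∀ i j, g i j ≠ 0 → Nat.find (hr i) ≤ Nat.find (hr j) + 1 := fun i j hij =>
    Nat.find_min' _ ⟨j, hij, Nat.find_spec (hr j)⟩
  refine ⟨fun i => Nat.find (hr i) + 1, ha, fun i => by omega, fun i => ?_, fun i j hij => ?_,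
    fun i hi => ?_⟩
  · simp only [Nat.add_eq_right, Nat.find_eq_zero]
    rfl
  · have := adj i j hij
    omega
  · have hs := Nat.find_spec (hr i)
    obtain ⟨k, hk⟩ : ∃ k, Nat.find (hr i) = k + 1 := ⟨Nat.find (hr i) - 1, by omega⟩
    rw [hk] at hs
    obtain ⟨j, hij, hj⟩ := hs
    have h1 := Nat.find_min' (hr j) hj
    have h2 := adj i j hij
    exact ⟨j, hij, by omega⟩

/-- The constants obtained by eliminating a path of length `n`. -/
noncomputable def rayConst (lam : ℝ) : ℕ → ℝ
  | 0 => 0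
  | n + 1 => 1 / (lam - rayConst lam n)

lemma rayConst_mem {lam : ℝ} (hlam : 2 ≤ lam) (n : ℕ) :
    0 ≤ rayConst lam n ∧ rayConst lam n ≤ 1 := by
  induction n with
  | zero => simp [rayConst]
  | succ n ih =>
    unfold rayConst
    have : 1 ≤ lam - rayConst lam n := by linarith
    exact ⟨by positivity, (div_le_one (by linarith)).2 this⟩

lemma exists_le_rayConst {lam k₁ : ℝ} (hlam : 2 ≤ lam) (hk : k₁ < 1)
    (hgap : k₁ * (lam - k₁) < 1) : ∃ n, k₁ ≤ rayConst lam n := by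
  by_contra! hc
  have hd : 0 < (1 - k₁ * (lam - k₁)) / lam := div_pos (by linarith) (by linarith)
  have step : ∀ n : ℕ, (n : ℝ) * ((1 - k₁ * (lam - k₁)) / lam) ≤ rayConst lam n := by
    intro n
    induction n with
    | zero => simp [rayConst]
    | succ n ih =>
      have h1 := rayConst_mem hlam n
      have h2 := hc n
      have h3 : rayConst lam (n + 1) = 1 / (lam - rayConst lam n) := rfl
      rw [h3]
      set s := rayConst lam n
      have h4 : 0 < lam - s := by linarith
      have h5 : s + (1 - k₁ * (lam - k₁)) / lam ≤ 1 / (lam - s) := by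
        have h6 : 1 / (lam - s) = s + (1 - s * (lam - s)) / (lam - s) := by field_simp; ring
        rw [h6]
        have h7 : s * (lam - s) ≤ k₁ * (lam - k₁) := by nlinarith
        have h8 : (1 - k₁ * (lam - k₁)) / lam ≤ (1 - s * (lam - s)) / (lam - s) :=
          div_le_div₀ (by linarith) (by linarith) h4 (by linarith)
        linarith
      push_cast
      linarith
  obtain ⟨n, hn⟩ := exists_nat_gt (1 / ((1 - k₁ * (lam - k₁)) / lam))
  rw [div_lt_iff₀ hd] at hn
  linarith [step n, (rayConst_mem hlam n).2]

lemma shiftQuad_unit (hg : IsSigned g) (c : ℝ) (z : V) (ξ : ℝ) :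
    shiftQuad g c (fun _ : Unit => z) (fun _ => ξ) = c * ξ ^ 2 := by
  simp [shiftQuad, shiftGram, hg.diag]; ring

/-- Eliminating a path attached at one end. -/
lemma rayConst_mul_le (hg : IsSigned g) {lam : ℝ} (hlam : 2 ≤ lam) {N : ℕ} (n : ℕ) :
    ∀ (p : ℕ → V), (∀ i j, i < n → j < n → i + 1 < j → g (p i) (p j) = 0) →
    (∀ i j, i < n → j < n → i < j → p i ≠ p j) →
    (∀ i, i + 1 < n → g (p i) (p (i + 1)) ≠ 0) → LocallyPSD g lam (N + n) →
    ∀ (ι : Type) [Fintype ι] (y : ι → V) (α : ι → ℝ), Fintype.card ι ≤ N →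
    (∀ b k, k < n → y b ≠ p k) → (∀ b k, k < n → 0 < k → g (p k) (y b) = 0) →
    rayConst lam n * (∑ b, α b * (g (p 0) (y b) : ℝ)) ^ 2 ≤ shiftQuad g lam y α := by
  induction n generalizing N with
  | zero =>
    intro p _ _ _ h ι _ y α hc _ _
    simp only [rayConst, zero_mul]
    exact h ι y α hc
  | succ n ih =>
    intro p h1 h2 h3 h ι _ y α hc hy1 hy2
    have key : ∀ ξ : ℝ, 0 ≤ shiftQuad g lam y α + 2 * (ξ * ∑ b, α b * (g (p 0) (y b) : ℝ)) +
        (lam - rayConst lam n) * ξ ^ 2 := by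
      intro ξ
      have h5 := ih (N := N + 1) (fun k => p (k + 1))
        (fun i j hi hj hij => h1 _ _ (by omega) (by omega) (by omega))
        (fun i j hi hj hij => h2 _ _ (by omega) (by omega) (by omega))
        (fun i hi => h3 _ (by omega)) (by convert h using 1; omega)
        (ι ⊕ Unit) (Sum.elim y fun _ => p 0) (Sum.elim α fun _ => ξ) (by simpa using hc)
        (by
          rintro (b | b) k hk
          · exact hy1 b _ (by omega)
          · exact h2 _ _ (by omega) (by omega) (by omega))
        (by
          rintro (b | b) k hk hk0
          · exact hy2 b _ (by omega) (by omega)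
          · rw [hg.symm]; exact h1 _ _ (by omega) (by omega) (by omega))
      rw [shiftQuad_sum hg, shiftQuad_unit hg] at h5
      simp only [Finset.univ_unique, Finset.sum_singleton, Fintype.sum_sum_type, Sum.elim_inl,
        Sum.elim_inr] at h5
      have h6 : ∀ b, shiftGram g lam (p 0) (y b) = g (p 0) (y b) := by
        intro b
        unfold shiftGram
        simp only [(hy1 b 0 (by omega)).symm, if_false, zero_add]
      simp only [h6] at h5
      have h7 : rayConst lam n * (∑ b, α b * (g (p (0 + 1)) (y b) : ℝ) +
          ξ * (g (p (0 + 1)) (p 0) : ℝ)) ^ 2 = rayConst lam n * ξ ^ 2 := by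
        cases n with
        | zero => simp [rayConst]
        | succ n =>
          rw [Finset.sum_eq_zero fun b _ => by rw [hy2 b (0 + 1) (by omega) (by omega)]; simp]
          rw [hg.symm]
          have := h3 0 (by omega)
          rcases hg.entries (p 0) (p (0 + 1)) with h | h | h
          · rw [h]; push_cast; ring
          · exact absurd h this
          · rw [h]; push_cast; ring
      rw [h7] at h5
      linarith
    have h8 := rayConst_mem hlam n
    have h9 : 0 < lam - rayConst lam n := by linarith
    set S := ∑ b, α b * (g (p 0) (y b) : ℝ)
    have h10 := key (-S / (lam - rayConst lam n))
    have h11 : 2 * (-S / (lam - rayConst lam n) * S) + (lam - rayConst lam n) *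
      (-S / (lam - rayConst lam n)) ^ 2 = - (1 / (lam - rayConst lam n) * S ^ 2) := by
      field_simp; ring
    change 1 / (lam - rayConst lam n) * S ^ 2 ≤ _
    linarith

end

section

variable {V : Type} {g : V → V → ℤ}

lemma represents_of_root [Fintype V] (hg : IsSigned g) {lam k₁ : ℝ} (hp : Params lam k₁)
    {a : V → ℤ} (h : LocallyPSD g lam (3 + 9 * growTime lam k₁))
    (ha : ∀ i, a i = -1 ∨ a i = 0 ∨ a i = 1)
    (hr : ∀ i, ∃ j, a j ≠ 0 ∧ Relation.ReflTransGen (fun i j => g i j ≠ 0) i j)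
    (hf : ∀ lev, IsLevel g a lev → ∀ (ι : Type) [Fintype ι] (y : ι → V) (α : ι → ℝ),
      Fintype.card ι ≤ 3 + 9 * growTime lam k₁ →
      (∀ b, lev (y b) ≤ 3 * growTime lam k₁ + 2) →
      k₁ * (∑ b, α b * (a (y b) : ℝ)) ^ 2 ≤ shiftQuad g lam y α) :
    ∃ u : V → Option V → ℤ, Represents g u := by
  obtain ⟨lev, hl⟩ := exists_isLevel ha hr
  let _ : LinearOrder V := LinearOrder.lift' (Fintype.equivFin V) (Equiv.injective _)
  refine ⟨_, (levelForm_of_root hg hl hp h ?_).represents hp hg hl⟩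
  intro ι _ y α hc hy W hW hW1
  have hW' : W = {none} := by
    refine Finset.eq_of_subset_of_card_le hW ?_
    rw [hW1]; simp
  rw [hW', Finset.sum_singleton]
  exact hf lev hl ι y α hc fun b => (hy b).2

/-- Ramsey's theorem for two colours. -/
lemma exists_ramsey (s : ℕ) : ∀ m : ℕ, ∃ R : ℕ, ∀ {β : Type} (r : β → β → Prop),
    (∀ x y, r x y → r y x) → ∀ S : Finset β, R ≤ S.card →
    (∃ T ⊆ S, T.card = s ∧ ∀ x ∈ T, ∀ y ∈ T, x ≠ y → ¬ r x y) ∨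
    ∃ T ⊆ S, T.card = m ∧ ∀ x ∈ T, ∀ y ∈ T, x ≠ y → r x y := by
  induction s with
  | zero => exact fun m => ⟨0, fun r _ S _ => Or.inl ⟨∅, by simp, by simp, by simp⟩⟩
  | succ s ihs =>
    intro m
    induction m with
    | zero => exact ⟨0, fun r _ S _ => Or.inr ⟨∅, by simp, by simp, by simp⟩⟩
    | succ m ihm =>
      obtain ⟨R₁, h₁⟩ := ihs (m + 1)
      obtain ⟨R₂, h₂⟩ := ihm
      refine ⟨R₁ + R₂ + 1, fun {β} r hr S hS => ?_⟩
      obtain ⟨x, hx⟩ : S.Nonempty := Finset.card_pos.1 (by omega)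
      have hcard := Finset.card_filter_add_card_filter_not (s := S.erase x) (fun y => r x y)
      rw [Finset.card_erase_of_mem hx] at hcard
      have ext : ∀ (q : β → β → Prop) (_ : ∀ x y, q x y → q y x) (T : Finset β) (k : ℕ),
          (∀ y ∈ T, y ∈ S ∧ y ≠ x ∧ q x y) → T.card = k →
          (∀ y ∈ T, ∀ z ∈ T, y ≠ z → q y z) →
          ∃ T' ⊆ S, T'.card = k + 1 ∧ ∀ y ∈ T', ∀ z ∈ T', y ≠ z → q y z := by
        intro q hq T k hT hTk hTq
        have hxT : x ∉ T := fun h => (hT x h).2.1 rfl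
        refine ⟨insert x T, ?_, by rw [Finset.card_insert_of_notMem hxT, hTk], ?_⟩
        · exact Finset.insert_subset hx fun y hy => (hT y hy).1
        · intro y hy z hz hyz
          rw [Finset.mem_insert] at hy hz
          rcases hy with rfl | hy
          · rcases hz with rfl | hz
            · exact absurd rfl hyz
            · exact (hT z hz).2.2
          · rcases hz with rfl | hz
            · exact hq _ _ (hT y hy).2.2
            · exact hTq y hy z hz hyz
      rcases le_or_gt R₂ ((S.erase x).filter fun y => r x y).card with h | h
      · have hsub : ∀ y ∈ (S.erase x).filter (fun y => r x y), y ∈ S ∧ y ≠ x ∧ r x y := by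
          intro y hy
          simp only [Finset.mem_filter, Finset.mem_erase] at hy
          exact ⟨hy.1.2, hy.1.1, hy.2⟩
        rcases h₂ r hr _ h with ⟨T, hT, hT'⟩ | ⟨T, hT, hT1, hT2⟩
        · exact Or.inl ⟨T, fun y hy => (hsub y (hT hy)).1, hT'⟩
        · exact Or.inr (ext r hr T m (fun y hy => hsub y (hT hy)) hT1 hT2)
      · have hsub : ∀ y ∈ (S.erase x).filter (fun y => ¬ r x y), y ∈ S ∧ y ≠ x ∧ ¬ r x y := by
          intro y hy
          simp only [Finset.mem_filter, Finset.mem_erase] at hy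
          exact ⟨hy.1.2, hy.1.1, hy.2⟩
        rcases h₁ r hr ((S.erase x).filter fun y => ¬ r x y) (by omega) with
          ⟨T, hT, hT1, hT2⟩ | ⟨T, hT, hT'⟩
        · exact Or.inl (ext (fun y z => ¬ r y z) (fun y z h h' => h (hr _ _ h')) T s
            (fun y hy => hsub y (hT hy)) hT1 hT2)
        · exact Or.inr ⟨T, fun y hy => (hsub y (hT hy)).1, hT'⟩

/-- Evaluating the form on vectors supported on a finite set. -/
lemma shiftQuad_subtype (hg : IsSigned g) (c : ℝ) (T : Finset V) (f : V → ℝ) :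
    shiftQuad g c (fun i : T => (i : V)) (fun i => f i) =
      (c * ∑ i ∈ T, f i ^ 2) + ∑ i ∈ T, ∑ j ∈ T.erase i, (g i j : ℝ) * f i * f j := by
  unfold shiftQuad
  rw [Finset.sum_coe_sort T fun i => ∑ j : T, shiftGram g c i j * f i * f j, Finset.mul_sum,
    ← Finset.sum_add_distrib]
  refine Finset.sum_congr rfl fun i hi => ?_
  rw [Finset.sum_coe_sort T fun j => shiftGram g c i j * f i * f j, ← Finset.add_sum_erase T _ hi]
  congr 1
  · simp [shiftGram, hg.diag]; ring
  · refine Finset.sum_congr rfl fun j hj => ?_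
    unfold shiftGram
    simp only [(Finset.ne_of_mem_erase hj).symm, if_false, zero_add]

/-- A clique after switching by `σ`. -/
structure IsSwitchedClique (g : V → V → ℤ) (σ : V → ℤ) (K : Finset V) : Prop where
  sign : ∀ i ∈ K, σ i = 1 ∨ σ i = -1
  adj : ∀ i ∈ K, ∀ j ∈ K, i ≠ j → σ i * σ j * g i j = 1

lemma IsSwitchedClique.mono {σ : V → ℤ} {K K' : Finset V} (h : IsSwitchedClique g σ K)
    (hK : K' ⊆ K) : IsSwitchedClique g σ K' :=
  ⟨fun i hi => h.sign i (hK hi), fun i hi j hj => h.adj i (hK hi) j (hK hj)⟩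

lemma IsSwitchedClique.g_eq {σ : V → ℤ} {K : Finset V} (h : IsSwitchedClique g σ K) {i j : V}
    (hi : i ∈ K) (hj : j ∈ K) (hij : i ≠ j) : g i j = σ i * σ j := by
  have h1 := h.adj i hi j hj hij
  rcases h.sign i hi with h2 | h2 <;> rcases h.sign j hj with h3 | h3 <;> rw [h2, h3] at h1 ⊢ <;>
    linarith

lemma IsSwitchedClique.shiftQuad_eq (hg : IsSigned g) {σ : V → ℤ} {K : Finset V}
    (h : IsSwitchedClique g σ K) (c : ℝ) (x : V → ℝ) :
    shiftQuad g c (fun i : K => (i : V)) (fun i => (σ i : ℝ) * x i) =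
      ((c - 1) * ∑ i ∈ K, x i ^ 2) + (∑ i ∈ K, x i) ^ 2 := by
  have hs : ∀ i ∈ K, (σ i : ℝ) * σ i = 1 := by
    intro i hi
    rcases h.sign i hi with h | h <;> rw [h] <;> norm_num
  rw [shiftQuad_subtype hg c K fun i => (σ i : ℝ) * x i, sq (∑ i ∈ K, x i), Finset.sum_mul_sum,
    Finset.mul_sum, Finset.mul_sum, ← Finset.sum_add_distrib, ← Finset.sum_add_distrib]
  refine Finset.sum_congr rfl fun i hi => ?_
  rw [← Finset.add_sum_erase K _ hi, ← add_assoc]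
  congr 1
  · linear_combination (c * x i ^ 2) * hs i hi
  · refine Finset.sum_congr rfl fun j hj => ?_
    rw [h.g_eq hi (Finset.mem_of_mem_erase hj) (Finset.ne_of_mem_erase hj).symm]
    push_cast
    linear_combination (x i * x j * σ j * σ j) * hs i hi +
      (x i * x j) * hs j (Finset.mem_of_mem_erase hj)

/-- A vertex of large degree has a large switched clique in its neighbourhood. -/
lemma exists_switchedClique (m : ℕ) : ∃ d, ∀ {V : Type} {g : V → V → ℤ}, IsSigned g →
    ∀ {lam : ℝ}, lam ≤ 2.01981 → LocallyPSD g lam 6 → ∀ (x₀ : V) (S : Finset V),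
    (∀ i ∈ S, g x₀ i ≠ 0) → d ≤ S.card →
    ∃ K : Finset V, K.card = m ∧ IsSwitchedClique g (g x₀) K := by
  obtain ⟨R, hR⟩ := exists_ramsey 5 m
  refine ⟨R, fun {V g} hg {lam} hlam h x₀ S hS hd => ?_⟩
  rcases hR (fun i j => g x₀ i * g x₀ j * g i j = 1)
    (fun i j hij => by rw [hg.symm j i]; linarith) S hd with ⟨T, hT, hT5, hTr⟩ | ⟨K, hK, hKm, hKr⟩
  · exfalso
    have hs : ∀ i ∈ T, (g x₀ i : ℝ) * g x₀ i = 1 := by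
      intro i hi
      rcases hg.entries x₀ i with h | h | h
      · rw [h]; norm_num
      · exact absurd h (hS i (hT hi))
      · rw [h]; norm_num
    have h1 := h (Unit ⊕ T) (Sum.elim (fun _ => x₀) fun i => i)
      (Sum.elim (fun _ => 1) fun i => -0.45 * (g x₀ i : ℝ)) (by simp [hT5])
    rw [shiftQuad_sum hg, shiftQuad_unit hg, shiftQuad_subtype hg lam T fun i =>
      -0.45 * (g x₀ i : ℝ)] at h1
    simp only [Finset.univ_unique, Finset.sum_singleton, one_mul] at h1
    rw [Finset.sum_coe_sort T fun i => -0.45 * (g x₀ i : ℝ) * shiftGram g lam i x₀] at h1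
    have h2 : ∑ i ∈ T, -0.45 * (g x₀ i : ℝ) * shiftGram g lam i x₀ = ∑ i ∈ T, (-0.45 : ℝ) := by
      refine Finset.sum_congr rfl fun i hi => ?_
      have hne : i ≠ x₀ := by rintro rfl; exact hS i (hT hi) (hg.diag i)
      unfold shiftGram
      simp only [hne, if_false, zero_add, hg.symm i x₀]
      linear_combination (-0.45) * hs i hi
    have h3 : ∑ i ∈ T, (-0.45 * (g x₀ i : ℝ)) ^ 2 = ∑ i ∈ T, (0.2025 : ℝ) := by
      refine Finset.sum_congr rfl fun i hi => ?_
      linear_combination 0.2025 * hs i hi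
    have h4 : ∑ i ∈ T, ∑ j ∈ T.erase i, (g i j : ℝ) * (-0.45 * (g x₀ i : ℝ)) *
        (-0.45 * (g x₀ j : ℝ)) ≤ 0 := by
      refine Finset.sum_nonpos fun i hi => Finset.sum_nonpos fun j hj => ?_
      have h5 := hTr i hi j (Finset.mem_of_mem_erase hj) (Finset.ne_of_mem_erase hj).symm
      have h6 : g x₀ i * g x₀ j * g i j ≤ 0 := by
        rcases hg.entries x₀ i with h | h | h <;> rcases hg.entries x₀ j with h' | h' | h' <;>
          rcases hg.entries i j with h'' | h'' | h'' <;> rw [h, h', h''] at h5 ⊢ <;> revert h5 <;>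
          decide
      have h7 : ((g x₀ i * g x₀ j * g i j : ℤ) : ℝ) ≤ 0 := by exact_mod_cast h6
      push_cast at h7
      linarith
    rw [h2, h3, Finset.sum_const, Finset.sum_const, hT5] at h1
    norm_num at h1
    norm_num at h4
    linarith
  · refine ⟨K, hKm, fun i hi => ?_, hKr⟩
    rcases hg.entries x₀ i with h | h | h
    · exact Or.inr h
    · exact absurd h (hS i (hK hi))
    · exact Or.inl h

end

section

variable {V : Type} {g : V → V → ℤ} {σ : V → ℤ} {K : Finset V}

lemma IsSwitchedClique.no_conflict (hg : IsSigned g) (hK : IsSwitchedClique g σ K) {lam : ℝ}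
    (hlam : lam ≤ 2.01981) (h : LocallyPSD g lam 11) {y : V} {A B : Finset V} (hA : A ⊆ K.erase y)
    (hB : B ⊆ K.erase y) (hA5 : A.card = 5) (hB5 : B.card = 5) {s t : ℤ}
    (hs : ∀ i ∈ A, σ i * g i y = s) (ht : ∀ i ∈ B, σ i * g i y = t) (hst : t < s) : False := by
  have hAB : Disjoint A B := by
    rw [Finset.disjoint_left]
    intro i hi hi'
    have := hs i hi
    have := ht i hi'
    omega
  have hU : A ∪ B ⊆ K.erase y := Finset.union_subset hA hB
  have hUK := hK.mono (hU.trans (Finset.erase_subset _ _))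
  let x : V → ℝ := fun i => if i ∈ A then 0.49 else -0.49
  have hxA : ∀ i ∈ A, x i = 0.49 := fun i hi => by simp only [x, hi, if_true]
  have hxB : ∀ i ∈ B, x i = -0.49 := fun i hi => by
    simp only [x, Finset.disjoint_right.1 hAB hi, if_false]
  have h1 := h (Unit ⊕ (A ∪ B : Finset V)) (Sum.elim (fun _ => y) fun i => i)
    (Sum.elim (fun _ => -1) fun i => (σ i : ℝ) * x i)
    (by simp [Finset.card_union_of_disjoint hAB, hA5, hB5])
  rw [shiftQuad_sum hg, shiftQuad_unit hg, hUK.shiftQuad_eq hg] at h1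
  simp only [Finset.univ_unique, Finset.sum_singleton] at h1
  rw [Finset.sum_coe_sort (A ∪ B) fun i => (σ i : ℝ) * x i * (-1 * shiftGram g lam i y),
    Finset.sum_union hAB, Finset.sum_union hAB, Finset.sum_union hAB] at h1
  have h2 : ∀ i ∈ A ∪ B, shiftGram g lam i y = g i y := by
    intro i hi
    have := Finset.ne_of_mem_erase (hU hi)
    simp only [shiftGram, this, if_false, zero_add]
  have h3 : ∑ i ∈ A, (σ i : ℝ) * x i * (-1 * shiftGram g lam i y) = ∑ i ∈ A, (-0.49 * (s : ℝ)) := by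
    refine Finset.sum_congr rfl fun i hi => ?_
    rw [h2 i (Finset.mem_union_left _ hi), hxA i hi, ← hs i hi]
    push_cast; ring
  have h4 : ∑ i ∈ B, (σ i : ℝ) * x i * (-1 * shiftGram g lam i y) = ∑ i ∈ B, (0.49 * (t : ℝ)) := by
    refine Finset.sum_congr rfl fun i hi => ?_
    rw [h2 i (Finset.mem_union_right _ hi), hxB i hi, ← ht i hi]
    push_cast; ring
  have h6 : ∑ i ∈ A, x i ^ 2 = ∑ i ∈ A, (0.49 : ℝ) ^ 2 :=
    Finset.sum_congr rfl fun i hi => by rw [hxA i hi]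
  have h7 : ∑ i ∈ B, x i ^ 2 = ∑ i ∈ B, (-0.49 : ℝ) ^ 2 :=
    Finset.sum_congr rfl fun i hi => by rw [hxB i hi]
  rw [h3, h4, h6, h7, Finset.sum_congr rfl hxA,
    Finset.sum_congr rfl hxB] at h1
  simp only [Finset.sum_const, hA5, hB5, nsmul_eq_mul] at h1
  have h5 : (t : ℝ) + 1 ≤ s := by exact_mod_cast hst
  norm_num at h1 hlam
  linarith

lemma IsSwitchedClique.exists_majority (hg : IsSigned g) (hK : IsSwitchedClique g σ K) {lam : ℝ}
    (hlam : lam ≤ 2.01981) (h : LocallyPSD g lam 11) (hc : 16 ≤ K.card) (y : V) :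
    ∃ s : ℤ, (s = -1 ∨ s = 0 ∨ s = 1) ∧
      ((K.erase y).filter fun i => σ i * g i y ≠ s).card ≤ 8 := by
  have conf : ∀ s t : ℤ, s ≠ t → 5 ≤ ((K.erase y).filter fun i => σ i * g i y = s).card →
      5 ≤ ((K.erase y).filter fun i => σ i * g i y = t).card → False := by
    intro s t hst hs ht
    obtain ⟨A, hA, hA5⟩ := Finset.exists_subset_card_eq hs
    obtain ⟨B, hB, hB5⟩ := Finset.exists_subset_card_eq ht
    rcases lt_or_gt_of_ne hst with h' | h'
    · exact hK.no_conflict hg hlam h (hB.trans (Finset.filter_subset _ _))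
        (hA.trans (Finset.filter_subset _ _)) hB5 hA5 (fun i hi => (Finset.mem_filter.1 (hB hi)).2)
        (fun i hi => (Finset.mem_filter.1 (hA hi)).2) h'
    · exact hK.no_conflict hg hlam h (hA.trans (Finset.filter_subset _ _))
        (hB.trans (Finset.filter_subset _ _)) hA5 hB5 (fun i hi => (Finset.mem_filter.1 (hA hi)).2)
        (fun i hi => (Finset.mem_filter.1 (hB hi)).2) h'
  have hval : ∀ i ∈ K.erase y, σ i * g i y = -1 ∨ σ i * g i y = 0 ∨ σ i * g i y = 1 := by
    intro i hi
    rcases hK.sign i (Finset.mem_of_mem_erase hi) with h | h <;>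
      rcases hg.entries i y with h' | h' | h' <;> rw [h, h'] <;> simp
  have h15 : 15 ≤ (K.erase y).card := by
    have := Finset.pred_card_le_card_erase (s := K) (a := y)
    omega
  let c : ℤ → Finset V := fun s => (K.erase y).filter fun i => σ i * g i y = s
  have c1 := conf (-1) 0 (by norm_num)
  have c2 := conf (-1) 1 (by norm_num)
  have c3 := conf 0 1 (by norm_num)
  change 5 ≤ (c _).card → 5 ≤ (c _).card → False at c1 c2 c3
  have hcover : K.erase y ⊆ c (-1) ∪ c 0 ∪ c 1 := by
    intro i hi
    have := hval i hi
    simp only [c, Finset.mem_union, Finset.mem_filter]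
    tauto
  have hle := (Finset.card_le_card hcover).trans (Finset.card_union_le _ _)
  have hle' := Finset.card_union_le (c (-1)) (c 0)
  have hsub : ∀ s t u : ℤ, (∀ i ∈ K.erase y, σ i * g i y = s ∨ σ i * g i y = t ∨ σ i * g i y = u) →
      ((K.erase y).filter fun i => σ i * g i y ≠ s).card ≤ (c t).card + (c u).card := by
    intro s t u hstu
    refine (Finset.card_le_card fun i hi => ?_).trans (Finset.card_union_le _ _)
    rw [Finset.mem_filter] at hi
    have := hstu i hi.1
    simp only [c, Finset.mem_union, Finset.mem_filter]
    tauto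
  by_cases h1 : 5 ≤ (c (-1)).card
  · refine ⟨-1, by simp, (hsub (-1) 0 1 hval).trans ?_⟩
    have := mt (c1 h1) (by simp)
    have := mt (c2 h1) (by simp)
    omega
  · by_cases h2 : 5 ≤ (c 0).card
    · refine ⟨0, by simp, (hsub 0 (-1) 1 fun i hi => by have := hval i hi; tauto).trans ?_⟩
      have := mt (c3 h2) (by simp)
      omega
    · refine ⟨1, by simp, (hsub 1 (-1) 0 fun i hi => by have := hval i hi; tauto).trans ?_⟩
      omega

/-- A large clique gives a positive form. -/
lemma IsSwitchedClique.form_le (hg : IsSigned g) (hK : IsSwitchedClique g σ K) {lam : ℝ}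
    {M N : ℕ} (hM : K.card = M) (hM0 : 1 ≤ M) (hlam : 2 ≤ lam)
    (h : LocallyPSD g lam (N + M)) {ι : Type} [Fintype ι] (y : ι → V) (α : ι → ℝ)
    (hc : Fintype.card ι ≤ N) {a : V → ℤ} (ha : ∀ i ∈ K, ∀ b, i ≠ y b ∧ σ i * g i (y b) = a (y b)) :
    (M : ℝ) / (M + lam - 1) * (∑ b, α b * (a (y b) : ℝ)) ^ 2 ≤ shiftQuad g lam y α := by
  have hs : ∀ i ∈ K, (σ i : ℝ) * σ i = 1 := by
    intro i hi
    rcases hK.sign i hi with h | h <;> rw [h] <;> norm_num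
  have hM0' : (1 : ℝ) ≤ M := by exact_mod_cast hM0
  set S := ∑ b, α b * (a (y b) : ℝ) with hS
  have h1 := h (ι ⊕ K) (Sum.elim y fun i => i)
    (Sum.elim α fun i => (σ i : ℝ) * (-S / (M + lam - 1)))
    (by simp only [Fintype.card_sum, Fintype.card_coe]; omega)
  rw [shiftQuad_sum hg, hK.shiftQuad_eq hg lam fun _ => -S / (M + lam - 1),
    Finset.sum_coe_sort K fun i => (σ i : ℝ) * (-S / (M + lam - 1)) *
      ∑ b, α b * shiftGram g lam i (y b)] at h1
  have h2 : ∑ i ∈ K, (σ i : ℝ) * (-S / (M + lam - 1)) * ∑ b, α b * shiftGram g lam i (y b) =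
      ∑ i ∈ K, -S / (M + lam - 1) * S := by
    refine Finset.sum_congr rfl fun i hi => ?_
    have h3 : ∑ b, α b * shiftGram g lam i (y b) = σ i * S := by
      rw [hS, Finset.mul_sum]
      refine Finset.sum_congr rfl fun b _ => ?_
      obtain ⟨h4, h5⟩ := ha i hi b
      simp only [shiftGram, h4, if_false, zero_add]
      rw [← h5]
      push_cast
      linear_combination (-(α b) * g i (y b)) * hs i hi
    rw [h3]
    linear_combination (-S / (M + lam - 1) * S) * hs i hi
  rw [h2] at h1
  simp only [Finset.sum_const, hM, nsmul_eq_mul] at h1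
  have h0 : (M : ℝ) + lam - 1 ≠ 0 := by linarith
  have h3 : 2 * (M * (-S / (M + lam - 1) * S)) + ((lam - 1) * (M * (-S / (M + lam - 1)) ^ 2) +
      (M * (-S / (M + lam - 1))) ^ 2) = -(M / (M + lam - 1) * S ^ 2) := by
    field_simp; ring
  linarith

/-- Graphs with a vertex of large degree are representable. -/
lemma represents_of_large_degree {lam k₁ : ℝ} (hp : Params lam k₁) : ∃ d N : ℕ,
    ∀ {V : Type} [Fintype V] {g : V → V → ℤ}, IsSigned g → IsConn g → LocallyPSD g lam N →
    ∀ (x₀ : V) (S : Finset V), (∀ i ∈ S, g x₀ i ≠ 0) → d ≤ S.card →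
    ∃ u : V → Option V → ℤ, Represents g u := by
  set N₀ := 3 + 9 * growTime lam k₁ with hN₀
  obtain ⟨M, hM⟩ := exists_nat_gt (k₁ * (lam - 1) / (1 - k₁) + 1)
  have hk := hp.k_lt
  have hk' := hp.k_ge
  have hlam := hp.lam_ge
  have hpos : 0 ≤ k₁ * (lam - 1) / (1 - k₁) :=
    div_nonneg (mul_nonneg (by linarith) (by linarith)) (by linarith)
  have hM1 : (1 : ℝ) < M := by linarith
  have hMk : k₁ ≤ M / (M + lam - 1) := by
    rw [le_div_iff₀ (by linarith)]
    have h1 : k₁ * (lam - 1) / (1 - k₁) < M := by linarith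
    rw [div_lt_iff₀ (by linarith)] at h1
    linarith
  obtain ⟨d, hd⟩ := exists_switchedClique (9 * N₀ + M + 16)
  refine ⟨d, N₀ + M + 11, fun {V _ g} hg hconn h x₀ S hS hSd => ?_⟩
  obtain ⟨K, hKc, hK⟩ := hd hg hp.lam_le (h.mono (by omega)) x₀ S hS hSd
  choose a ha ha8 using hK.exists_majority hg hp.lam_le (h.mono (by omega)) (by omega)
  have haK : ∀ y ∈ K, a y ≠ 0 := by
    intro y hy h0
    have h1 := ha8 y
    rw [Finset.filter_true_of_mem, Finset.card_erase_of_mem hy] at h1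
    · omega
    · intro i hi
      rw [hK.g_eq (Finset.mem_of_mem_erase hi) hy (Finset.ne_of_mem_erase hi), h0]
      rcases hK.sign i (Finset.mem_of_mem_erase hi) with h | h <;> rcases hK.sign y hy with h' | h'
        <;> rw [h, h'] <;> norm_num
  obtain ⟨y₀, hy₀⟩ : K.Nonempty := Finset.card_pos.1 (by omega)
  refine represents_of_root hg hp (h.mono (by omega)) ha (fun i => ⟨y₀, haK y₀ hy₀, hconn i y₀⟩) ?_
  intro lev _ ι _ y α hc _
  let bad : Finset V := Finset.univ.biUnion fun b =>
    insert (y b) ((K.erase (y b)).filter fun i => g x₀ i * g i (y b) ≠ a (y b))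
  have hbad : bad.card ≤ 9 * N₀ := by
    refine (Finset.card_biUnion_le_card_mul _ _ 9 fun b _ => ?_).trans ?_
    · refine (Finset.card_insert_le _ _).trans ?_
      have := ha8 (y b)
      omega
    · rw [Finset.card_univ, mul_comm]
      exact Nat.mul_le_mul_left _ hc
  obtain ⟨K', hK', hK'c⟩ : ∃ K' ⊆ K \ bad, K'.card = M := by
    refine Finset.exists_subset_card_eq ?_
    have := Finset.le_card_sdiff bad K
    omega
  have hcl : ∀ i ∈ K', ∀ b, i ≠ y b ∧ g x₀ i * g i (y b) = a (y b) := by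
    intro i hi b
    obtain ⟨hiK, hib⟩ := Finset.mem_sdiff.1 (hK' hi)
    have h1 : i ≠ y b := by
      rintro rfl
      exact hib (Finset.mem_biUnion.2 ⟨b, Finset.mem_univ _, Finset.mem_insert_self _ _⟩)
    refine ⟨h1, ?_⟩
    by_contra h2
    exact hib (Finset.mem_biUnion.2 ⟨b, Finset.mem_univ _, Finset.mem_insert_of_mem
      (Finset.mem_filter.2 ⟨Finset.mem_erase.2 ⟨h1, hiK⟩, h2⟩)⟩)
  refine le_trans ?_ ((hK.mono (hK'.trans Finset.sdiff_subset)).form_le hg hK'c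
    (by exact_mod_cast hM1.le) (by linarith) (h.mono (N := N₀ + M + 11) (by omega)) y α hc hcl)
  exact mul_le_mul_of_nonneg_right hMk (sq_nonneg _)

end

section

variable {V : Type} {g : V → V → ℤ}

lemma IsSigned.comp {W : Type} (hg : IsSigned g) (f : W → V) :
    IsSigned fun i j => g (f i) (f j) :=
  ⟨fun i j => hg.symm _ _, fun i => hg.diag _, fun i j => hg.entries _ _⟩

lemma shiftQuad_comp {W : Type} {f : W → V} (hf : Function.Injective f) (c : ℝ) {ι : Type}
    [Fintype ι] (y : ι → W) (α : ι → ℝ) :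
    shiftQuad (fun i j => g (f i) (f j)) c y α = shiftQuad g c (fun b => f (y b)) α := by
  simp only [shiftQuad, shiftGram, hf.eq_iff]

lemma LocallyPSD.comp {W : Type} {f : W → V} (hf : Function.Injective f) {c : ℝ} {N : ℕ}
    (h : LocallyPSD g c N) : LocallyPSD (fun i j => g (f i) (f j)) c N := by
  intro ι _ y α hc
  rw [shiftQuad_comp hf]
  exact h ι _ α hc

lemma shiftQuad_add (c d : ℝ) [Fintype V] {ι : Type} [Fintype ι] (y : ι → V) (α : ι → ℝ) :
    shiftQuad g (c + d) y α =
      shiftQuad g c y α + d * ∑ v, (∑ b, if y b = v then α b else 0) ^ 2 := by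
  have h1 : ∑ v, (∑ b, if y b = v then α b else 0) ^ 2 =
      ∑ a, ∑ b, (if y a = y b then (1 : ℝ) else 0) * α a * α b := by
    have h2 : ∀ v, (∑ b, if y b = v then α b else 0) ^ 2 =
        ∑ a, ∑ b, (if y a = v then α a else 0) * (if y b = v then α b else 0) := by
      intro v
      rw [sq, Finset.sum_mul_sum]
    rw [Finset.sum_congr rfl fun v _ => h2 v, Finset.sum_comm]
    refine Finset.sum_congr rfl fun a _ => ?_
    rw [Finset.sum_comm]
    refine Finset.sum_congr rfl fun b _ => ?_
    rw [Finset.sum_eq_single (y a)]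
    · by_cases h : y a = y b
      · simp [h]
      · simp [h, Ne.symm h]
    · intro v _ hv
      simp [Ne.symm hv]
    · simp
  rw [h1]
  simp only [shiftQuad, Finset.mul_sum]
  rw [← Finset.sum_add_distrib]
  refine Finset.sum_congr rfl fun a _ => ?_
  rw [← Finset.sum_add_distrib]
  refine Finset.sum_congr rfl fun b _ => ?_
  simp only [shiftGram]
  split_ifs <;> ring

lemma Represents.shiftQuad_two {W : Type} [Fintype W] {u : V → W → ℤ} (hu : Represents g u)
    {ι : Type} [Fintype ι] (y : ι → V) (α : ι → ℝ) :
    shiftQuad g 2 y α = ∑ w, (∑ b, α b * (u (y b) w : ℝ)) ^ 2 := by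
  have h1 : ∀ i j, shiftGram g 2 i j = ∑ w, (u i w : ℝ) * u j w := by
    intro i j
    have := congrArg (Int.cast : ℤ → ℝ) (hu i j)
    push_cast at this
    rw [this, shiftGram]
  have h2 : ∀ w, (∑ b, α b * (u (y b) w : ℝ)) ^ 2 =
      ∑ a, ∑ b, α a * (u (y a) w : ℝ) * (α b * u (y b) w) := fun w => by
    rw [sq, Finset.sum_mul_sum]
  simp only [shiftQuad, h1, h2]
  rw [Finset.sum_comm]
  refine Eq.trans ?_ Finset.sum_comm
  rw [Finset.sum_comm]
  refine Finset.sum_congr rfl fun a _ => ?_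
  rw [Finset.sum_comm]
  refine Finset.sum_congr rfl fun b _ => ?_
  rw [Finset.sum_mul, Finset.sum_mul]
  exact Finset.sum_congr rfl fun w _ => by ring

lemma Represents.sq_le_shiftQuad [Fintype V] {W : Type} [Fintype W] {u : V → W → ℤ}
    (hu : Represents g u) {c : ℝ} (hc : 2 ≤ c) {ι : Type} [Fintype ι] (y : ι → V) (α : ι → ℝ)
    (w : W) : (∑ b, α b * (u (y b) w : ℝ)) ^ 2 ≤ shiftQuad g c y α := by
  have h1 := shiftQuad_add (g := g) 2 (c - 2) y α
  rw [add_sub_cancel] at h1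
  rw [h1, hu.shiftQuad_two]
  have h2 : 0 ≤ (c - 2) * ∑ v, (∑ b, if y b = v then α b else 0) ^ 2 :=
    mul_nonneg (by linarith) (Finset.sum_nonneg fun v _ => sq_nonneg _)
  have h3 := Finset.single_le_sum (f := fun w => (∑ b, α b * (u (y b) w : ℝ)) ^ 2)
    (fun w _ => sq_nonneg _) (Finset.mem_univ w)
  linarith

lemma Represents.norm {W : Type} [Fintype W] {u : V → W → ℤ} (hg : IsSigned g)
    (hu : Represents g u) (i : V) : ∑ w, u i w * u i w = 2 := by
  rw [hu i i, if_pos rfl, hg.diag]; rfl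

lemma Represents.entries {W : Type} [Fintype W] {u : V → W → ℤ} (hg : IsSigned g)
    (hu : Represents g u) (i : V) (w : W) : u i w = -1 ∨ u i w = 0 ∨ u i w = 1 := by
  have h1 := Finset.single_le_sum (f := fun w => u i w * u i w)
    (fun w _ => mul_self_nonneg _) (Finset.mem_univ w)
  rw [hu.norm hg] at h1
  have h2 : u i w ≤ 1 := by nlinarith
  have h3 : -1 ≤ u i w := by nlinarith
  omega

/-- Vertices sharing a coordinate are close. -/
lemma Represents.close {W : Type} [Fintype W] {u : V → W → ℤ} (hg : IsSigned g)
    (hu : Represents g u) {x y z : V} {w : W} (hx : u x w ≠ 0) (hy : u y w ≠ 0)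
    (hz : g z x ≠ 0) : y = x ∨ g y x ≠ 0 ∨ y = z ∨ g y z ≠ 0 := by
  by_contra! hc
  obtain ⟨h1, h2, h3, h4⟩ := hc
  have hxy := hu y x
  rw [if_neg h1, h2] at hxy
  have hyz := hu y z
  rw [if_neg h3, h4] at hyz
  have hzx : z ≠ x := fun h => hz (by rw [h, hg.diag])
  have hxz := hu z x
  rw [if_neg hzx, zero_add] at hxz
  have hpar : (2 : ℤ) ∣ ∑ w, |u y w| * |u x w| := by
    have : ∑ w, |u y w| * |u x w| = ∑ w, (|u y w| * |u x w| - u y w * u x w) := by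
      rw [Finset.sum_sub_distrib, hxy]; simp
    rw [this]
    refine Finset.dvd_sum fun w _ => ?_
    rcases hu.entries hg y w with h | h | h <;> rcases hu.entries hg x w with h' | h' | h' <;>
      rw [h, h'] <;> decide
  have hpos : 1 ≤ ∑ w, |u y w| * |u x w| :=
    (Int.one_le_abs (mul_ne_zero hy hx)).trans (by
      rw [abs_mul]
      exact Finset.single_le_sum (f := fun w => |u y w| * |u x w|)
        (fun w _ => mul_nonneg (abs_nonneg _) (abs_nonneg _)) (Finset.mem_univ w))
  have hsum : ∑ w, (|u y w| - |u x w|) ^ 2 = 4 - 2 * ∑ w, |u y w| * |u x w| := by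
    have : ∀ w, (|u y w| - |u x w|) ^ 2 = u y w * u y w + u x w * u x w -
        2 * (|u y w| * |u x w|) := by
      intro w
      have e1 := abs_mul_abs_self (u y w)
      have e2 := abs_mul_abs_self (u x w)
      linear_combination e1 + e2
    simp only [this]
    rw [Finset.sum_sub_distrib, Finset.sum_add_distrib, hu.norm hg, hu.norm hg, ← Finset.mul_sum]
    ring
  have hzero : ∑ w, (|u y w| - |u x w|) ^ 2 = 0 :=
    le_antisymm (by omega) (Finset.sum_nonneg fun w _ => sq_nonneg _)
  rw [Finset.sum_eq_zero_iff_of_nonneg fun w _ => sq_nonneg _] at hzero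
  have hd : (2 : ℤ) ∣ ∑ w, (u y w * u z w - u z w * u x w) := by
    refine Finset.dvd_sum fun w _ => ?_
    have h5 := hzero w (Finset.mem_univ w)
    have h6 : |u y w| = |u x w| := by
      rw [sq_eq_zero_iff] at h5; linarith
    rcases abs_eq_abs.1 h6 with h7 | h7 <;> rw [h7]
    · exact ⟨0, by ring⟩
    · exact ⟨-(u x w * u z w), by ring⟩
  rw [Finset.sum_sub_distrib, hyz, hxz] at hd
  rcases hg.entries z x with h | h | h
  · rw [h] at hd; norm_num at hd
  · exact hz h
  · rw [h] at hd; norm_num at hd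

lemma exists_geodesic {a : V → ℤ} {lev : V → ℕ} (hl : IsLevel g a lev) (m : ℕ) :
    ∀ v, lev v = m + 1 → ∃ c : ℕ → V, (∀ k ≤ m, lev (c k) = k + 1) ∧
      ∀ k < m, g (c (k + 1)) (c k) ≠ 0 := by
  suffices h : ∀ v, lev v = m + 1 → ∃ c : ℕ → V, c m = v ∧ (∀ k ≤ m, lev (c k) = k + 1) ∧
      ∀ k < m, g (c (k + 1)) (c k) ≠ 0 from fun v hv => (h v hv).imp fun c hc => hc.2
  induction m with
  | zero => exact fun v hv => ⟨fun _ => v, rfl, fun k hk => by simp_all, by simp⟩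
  | succ m ih =>
    intro v hv
    obtain ⟨j, hj, hlj⟩ := hl.pred v (by omega)
    obtain ⟨c, hcm, h1, h2⟩ := ih j (by omega)
    refine ⟨fun k => if k = m + 1 then v else c k, by simp, fun k hk => ?_, fun k hk => ?_⟩
    · by_cases h : k = m + 1
      · simp [h, hv]
      · simp only [h, if_false]
        exact h1 k (by omega)
    · have h' : k ≠ m + 1 := by omega
      by_cases h : k = m
      · subst h
        simp [hcm, hj]
      · have h'' : k + 1 ≠ m + 1 := by omega
        simp only [h', h'', if_false]
        exact h2 k (by omega)

/-- Graphs with a vertex far away from another one are representable. -/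
lemma represents_of_far {lam k₁ : ℝ} (hp : Params lam k₁) : ∃ D N : ℕ,
    ∀ {V : Type} [Fintype V] {g : V → V → ℤ}, IsSigned g → IsConn g → LocallyPSD g lam N →
    ∀ (x₀ : V) (lev : V → ℕ), IsLevel g (fun i => if i = x₀ then 1 else 0) lev →
    ∀ v, D ≤ lev v → ∃ u : V → Option V → ℤ, Represents g u := by
  have hlam2 : 2 ≤ lam := by linarith [hp.lam_ge]
  obtain ⟨n, hn⟩ := exists_le_rayConst hlam2 hp.k_lt hp.gap
  set T := growTime lam k₁ with hT
  set L := 3 * T + 3 with hL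
  refine ⟨L + n + 3, 3 + 9 * T + n, fun {V _ g} hg hconn h x₀ lev hl v hv => ?_⟩
  obtain ⟨m, hm⟩ : ∃ m, lev v = m + 1 := ⟨lev v - 1, by omega⟩
  obtain ⟨c, hc1, hc2⟩ := exists_geodesic hl m v hm
  have hlev1 : ∀ i, lev i = 1 ↔ i = x₀ := fun i => by rw [hl.one]; simp
  have hx0 : c 0 = x₀ := (hlev1 _).1 (hc1 0 (by omega))
  let V' := {y : V // lev y ≤ L + 1}
  let g' : V' → V' → ℤ := fun i j => g i j
  have hg' : IsSigned g' := hg.comp _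
  have hinj : Function.Injective (Subtype.val : V' → V) := Subtype.val_injective
  have hx0' : lev x₀ = 1 := (hlev1 _).2 rfl
  let x' : V' := ⟨x₀, by omega⟩
  have hreach : ∀ k, ∀ y : V', lev y = k → Relation.ReflTransGen (fun i j => g' i j ≠ 0) y x' := by
    intro k
    induction k with
    | zero => intro y hy; have := hl.pos y; omega
    | succ k ih =>
      intro y hy
      by_cases hk : k = 0
      · have : y = x' := Subtype.ext ((hlev1 _).1 (by omega))
        rw [this]
      · obtain ⟨j, hj, hlj⟩ := hl.pred y (by omega)
        have := y.2
        exact Relation.ReflTransGen.head (b := ⟨j, by omega⟩) hj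
          (ih ⟨j, by omega⟩ (by simp only; omega))
  have hsymm : Std.Symm (fun i j : V' => g' i j ≠ 0) := ⟨fun i j h => by rwa [hg'.symm]⟩
  have hreach' : ∀ y z : V', Relation.ReflTransGen (fun i j => g' i j ≠ 0) y z := fun y z =>
    (hreach _ y rfl).trans (Relation.ReflTransGen.stdSymm.symm _ _ (hreach _ z rfl))
  obtain ⟨u, hu⟩ : ∃ u : V' → Option V' → ℤ, Represents g' u := by
    refine represents_of_root (a := fun y => g (c (L + 1)) y) hg' hp
      ((h.mono (by omega)).comp hinj) (fun i => hg.entries _ _)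
      (fun i => ⟨⟨c L, (hc1 L (by omega)).le⟩, hc2 L (by omega), hreach' _ _⟩) ?_
    intro _ _ ι _ y α hc _
    rw [shiftQuad_comp hinj]
    refine le_trans (mul_le_mul_of_nonneg_right hn (sq_nonneg _)) ?_
    refine rayConst_mul_le hg hlam2 n (fun k => c (L + 1 + k)) ?_ ?_ ?_ h ι _ α hc ?_ ?_
    · intro i j hi hj hij
      by_contra hne
      have h1 := hl.adj _ _ hne
      have h2 := hl.adj _ _ ((hg.symm _ _).trans_ne hne)
      rw [hc1 _ (by omega), hc1 _ (by omega)] at h2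
      omega
    · intro i j hi hj hij heq
      have := congrArg lev heq
      rw [hc1 _ (by omega), hc1 _ (by omega)] at this
      omega
    · intro i hi
      rw [hg.symm]
      exact hc2 (L + 1 + i) (by omega)
    · intro b k hk heq
      have := (y b).2
      rw [heq, hc1 _ (by omega)] at this
      omega
    · intro b k hk hk0
      by_contra hne
      have := hl.adj _ _ hne
      have := (y b).2
      rw [hc1 _ (by omega)] at *
      omega
  obtain ⟨w, hw⟩ : ∃ w, u x' w ≠ 0 := by
    by_contra! hc
    have := hu.norm hg' x'
    simp [hc] at this
  let a : V → ℤ := fun y => if hy : lev y ≤ L + 1 then u ⟨y, hy⟩ w else 0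
  have hanz : ∀ y, a y ≠ 0 → lev y ≤ 3 := by
    intro y hy
    by_cases hy' : lev y ≤ L + 1
    · simp only [a, hy', dif_pos] at hy
      have hc10 : g (c 1) x₀ ≠ 0 := hx0 ▸ hc2 0 (by omega)
      have hlc := hc1 1 (by omega)
      rcases hu.close hg' (x := x') (y := ⟨y, hy'⟩) (z := ⟨c 1, by omega⟩) hw hy hc10 with
        h1 | h1 | h1 | h1
      · have := congrArg (fun y : V' => lev y) h1
        simp only [x'] at this
        omega
      · have := hl.adj _ _ h1
        simp only [x'] at this
        omega
      · have := congrArg (fun y : V' => lev y) h1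
        simp only at this
        omega
      · have := hl.adj _ _ h1
        simp only at this
        omega
    · simp only [a, hy', dif_neg, not_false_eq_true, ne_eq, not_true] at hy
  refine represents_of_root (a := a) hg hp (h.mono (by omega)) ?_ (fun i => ⟨x₀, ?_, hconn _ _⟩) ?_
  · intro i
    by_cases hi : lev i ≤ L + 1
    · simp only [a, hi, dif_pos]
      exact hu.entries hg' _ _
    · simp only [a, hi, dif_neg, not_false_eq_true]
      simp
  · have : lev x₀ ≤ L + 1 := by omega
    simp only [a, this, dif_pos]
    exact hw
  · intro lev' hl' ι _ y α _ hy
    have hcmp : ∀ k y, lev' y = k → lev y ≤ k + 2 := by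
      intro k
      induction k with
      | zero => intro y hy; have := hl'.pos y; omega
      | succ k ih =>
        intro y hy
        by_cases hk : k = 0
        · have := hanz y ((hl'.one y).1 (by omega))
          omega
        · obtain ⟨j, hj, hlj⟩ := hl'.pred y (by omega)
          have h1 := ih j (by omega)
          have h2 := hl.adj _ _ hj
          omega
    have hyV : ∀ b, lev (y b) ≤ L + 1 := fun b => by
      have := hcmp _ (y b) rfl
      have := hy b
      omega
    have h1 := hu.sq_le_shiftQuad hlam2 (fun b => (⟨y b, hyV b⟩ : V')) α w
    rw [shiftQuad_comp hinj] at h1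
    have h2 : ∀ b, a (y b) = u ⟨y b, hyV b⟩ w := fun b => by simp only [a, hyV b, dif_pos]
    simp only [h2]
    refine le_trans ?_ h1
    have := hp.k_lt
    nlinarith [sq_nonneg (∑ b, α b * (u ⟨y b, hyV b⟩ w : ℝ))]

end

section

lemma lamStar_sq {β s : ℝ} (hβ : β ^ 3 = β + 1) (hs : s = √β + (√β)⁻¹) :
    0 < s ∧ s ^ 2 = β ^ 2 + β + 1 ∧ 1.3247 < β ∧ β < 1.32472 := by
  have h1 : 1.3247 < β := by
    by_contra! h
    rcases le_or_gt β 1 with h' | h'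
    · rcases le_or_gt β (-1) with h2 | h2
      · nlinarith [mul_nonneg (by linarith : (0 : ℝ) ≤ -β - 1) (sq_nonneg β)]
      · nlinarith [mul_nonneg (by linarith : (0 : ℝ) ≤ 1 - β) (sq_nonneg (β + 1)), sq_nonneg β]
    · nlinarith [mul_nonneg (by linarith : (0 : ℝ) ≤ 1.3247 - β) (sq_nonneg β),
        mul_nonneg (by linarith : (0 : ℝ) ≤ 1.3247 - β) (by linarith : (0 : ℝ) ≤ β)]
  have h2 : β < 1.32472 := by
    by_contra! h
    nlinarith [mul_nonneg (by linarith : (0 : ℝ) ≤ β - 1.32472) (sq_nonneg β),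
        mul_nonneg (by linarith : (0 : ℝ) ≤ β - 1.32472) (by linarith : (0 : ℝ) ≤ β)]
  have h3 : 0 < √β := Real.sqrt_pos.2 (by linarith)
  have h4 : √β ^ 2 = β := Real.sq_sqrt (by linarith)
  refine ⟨by rw [hs]; positivity, ?_, h1, h2⟩
  have h5 : s ^ 2 = β + 2 + β⁻¹ := by
    rw [hs, add_sq, inv_pow, h4, mul_assoc, mul_inv_cancel₀ h3.ne']
    ring
  have h6 : β⁻¹ = β ^ 2 - 1 := by
    rw [inv_eq_iff_eq_inv, eq_comm]
    refine inv_eq_of_mul_eq_one_left ?_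
    linear_combination hβ
  rw [h5, h6]; ring

lemma exists_params {β s lam : ℝ} (hβ : β ^ 3 = β + 1) (hs : s = √β + (√β)⁻¹)
    (h1 : 2.0197 ≤ lam) (h2 : lam < s) : ∃ k₁, Params lam k₁ := by
  obtain ⟨hs0, hs2, hb1, hb2⟩ := lamStar_sq hβ hs
  have hs3 : s ≤ 2.01981 := by
    by_contra! h
    nlinarith
  have hroot : (s ^ 2) ^ 3 - 5 * (s ^ 2) ^ 2 + 4 * s ^ 2 - 1 = 0 := by
    rw [hs2]
    linear_combination (β ^ 3 + 3 * β ^ 2 + 2 * β + 1) * hβ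
  have hL : lam ^ 2 < s ^ 2 := by nlinarith
  have hL4 : 4 ≤ lam ^ 2 := by nlinarith
  have hcub : (lam ^ 2) ^ 3 - 5 * (lam ^ 2) ^ 2 + 4 * lam ^ 2 - 1 < 0 := by
    generalize lam ^ 2 = l at *
    generalize s ^ 2 = m at *
    have : 0 < (m - l) * (m * (m - 5) + l * (l - 5) + m * l + 4) := by
      refine mul_pos (by linarith) ?_
      nlinarith [mul_nonneg (by linarith : 0 ≤ m - 4) (by linarith : 0 ≤ l - 4)]
    nlinarith
  have hden : 0 < 2 * lam ^ 2 - 1 := by linarith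
  set κ := (lam ^ 3 - lam) / (2 * lam ^ 2 - 1) with hκ
  have hκd : κ * (2 * lam ^ 2 - 1) = lam ^ 3 - lam := div_mul_cancel₀ _ hden.ne'
  have hκ1 : 0.8687 ≤ κ := by
    rw [hκ, le_div_iff₀ hden]
    nlinarith [mul_nonneg (by linarith : 0 ≤ lam - 2.0197) (sq_nonneg lam),
      mul_nonneg (by linarith : 0 ≤ lam - 2.0197) (by linarith : 0 ≤ lam)]
  have hκ2 : κ ≤ 0.9 := by
    rw [hκ, div_le_iff₀ hden]
    nlinarith [mul_nonneg (by linarith : 0 ≤ 2.01981 - lam) (sq_nonneg lam),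
      mul_nonneg (by linarith : 0 ≤ 2.01981 - lam) (by linarith : 0 ≤ lam)]
  have hgap : κ * (lam - κ) < 1 := by
    have h3 : κ * (lam - κ) * (2 * lam ^ 2 - 1) ^ 2 = (lam ^ 3 - lam) *
        (lam * (2 * lam ^ 2 - 1) - (lam ^ 3 - lam)) := by
      rw [← hκd]; ring
    have h4 : 0 < (2 * lam ^ 2 - 1) ^ 2 := by positivity
    by_contra! h5
    have := mul_le_mul_of_nonneg_right h5 h4.le
    rw [h3] at this
    nlinarith
  refine ⟨κ + min (1 - κ * (lam - κ)) 0.01, ?_⟩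
  set ε := min (1 - κ * (lam - κ)) 0.01 with hε
  have hε0 : 0 < ε := lt_min (by linarith) (by norm_num)
  have hε1 : ε ≤ 1 - κ * (lam - κ) := min_le_left _ _
  have hε2 : ε ≤ 0.01 := min_le_right _ _
  refine ⟨h1, by linarith, by linarith, by linarith, ?_, ?_⟩
  · nlinarith [mul_nonneg hε0.le (by linarith : 0 ≤ 1 - (lam - 2 * κ)), mul_pos hε0 hε0]
  · nlinarith [mul_pos hε0 hden]

variable {V : Type} [Fintype V] {g : V → V → ℤ}

lemma card_level_le {a : V → ℤ} {lev : V → ℕ} (hl : IsLevel g a lev) {d m : ℕ}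
    (hd : ∀ x, (Finset.univ.filter fun i => g x i ≠ 0).card ≤ d)
    (hsymm : ∀ i j, g i j = g j i)
    (h1 : (Finset.univ.filter fun i => lev i ≤ 1).card ≤ m) (k : ℕ) :
    (Finset.univ.filter fun i => lev i ≤ k + 1).card ≤ m * (d + 1) ^ k := by
  induction k with
  | zero => simpa using h1
  | succ k ih =>
    have hsub : (Finset.univ.filter fun i => lev i ≤ k + 1 + 1) ⊆
        (Finset.univ.filter fun i => lev i ≤ k + 1).biUnion fun z =>
          insert z (Finset.univ.filter fun i => g z i ≠ 0) := by
      intro i hi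
      have hi' := (Finset.mem_filter.1 hi).2
      rw [Finset.mem_biUnion]
      by_cases h : lev i ≤ k + 1
      · exact ⟨i, Finset.mem_filter.2 ⟨Finset.mem_univ _, h⟩, Finset.mem_insert_self _ _⟩
      · obtain ⟨j, hj, hlj⟩ := hl.pred i (by omega)
        refine ⟨j, Finset.mem_filter.2 ⟨Finset.mem_univ _, by omega⟩,
          Finset.mem_insert_of_mem (Finset.mem_filter.2 ⟨Finset.mem_univ _, ?_⟩)⟩
        rwa [hsymm]
    refine (Finset.card_le_card hsub).trans ((Finset.card_biUnion_le_card_mul _ _ (d + 1)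
      fun z _ => (Finset.card_insert_le _ _).trans (Nat.succ_le_succ (hd z))).trans ?_)
    rw [pow_succ, ← mul_assoc]
    exact Nat.mul_le_mul_right _ ih

end

/-- Large connected signed graphs whose forms are locally positive semidefinite below the
threshold are representable. -/
theorem exists_represents {lam k₁ : ℝ} (hp : Params lam k₁) : ∃ N : ℕ,
    ∀ {V : Type} [Fintype V] {g : V → V → ℤ}, IsSigned g → IsConn g → LocallyPSD g lam N →
    N < Fintype.card V → ∃ u : V → Option V → ℤ, Represents g u := by
  obtain ⟨d, N₁, h₁⟩ := represents_of_large_degree hp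
  obtain ⟨D, N₂, h₂⟩ := represents_of_far hp
  refine ⟨N₁ + N₂ + (d + 1) ^ D, fun {V _ g} hg hconn h hc => ?_⟩
  obtain ⟨x₀⟩ : Nonempty V := Fintype.card_pos_iff.1 (by omega)
  by_cases hdeg : ∃ x, d ≤ (Finset.univ.filter fun i => g x i ≠ 0).card
  · obtain ⟨x, hx⟩ := hdeg
    exact h₁ hg hconn (h.mono (by omega)) x _ (fun i hi => (Finset.mem_filter.1 hi).2) hx
  push Not at hdeg
  obtain ⟨lev, hl⟩ := exists_isLevel (g := g) (a := fun i => if i = x₀ then 1 else 0)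
    (fun i => by by_cases h : i = x₀ <;> simp [h]) (fun i => ⟨x₀, by simp, hconn _ _⟩)
  by_cases hfar : ∃ v, D ≤ lev v
  · obtain ⟨v, hv⟩ := hfar
    exact h₂ hg hconn (h.mono (by omega)) x₀ lev hl v hv
  push Not at hfar
  exfalso
  have h1 := card_level_le hl (m := 1) (fun x => (hdeg x).le) hg.symm (by
    refine Finset.card_le_one.2 fun i hi j hj => ?_
    have key : ∀ i, lev i ≤ 1 → i = x₀ := fun i hi => by
      have := (hl.one i).1 (le_antisymm hi (hl.pos i))
      by_contra hne
      simp [hne] at this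
    rw [key i (Finset.mem_filter.1 hi).2, key j (Finset.mem_filter.1 hj).2]) D
  rw [Finset.filter_true_of_mem fun i _ => by have := hfar i; omega, Finset.card_univ] at h1
  omega

section Forests

/-- Forests of height at most `h` with node labels in `L`. -/
def Forest (L : Type) : ℕ → Type
  | 0 => PUnit
  | h + 1 => List (L × Forest L h)

/-- Label preserving embeddability of forests. -/
def Forest.Le {L : Type} : ∀ h : ℕ, Forest L h → Forest L h → Prop
  | 0 => fun _ _ => True
  | h + 1 => List.SublistForall₂ fun a b : L × Forest L h => a.1 = b.1 ∧ Forest.Le h a.2 b.2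

lemma Forest.isPreorder_le {L : Type} (h : ℕ) : IsPreorder (Forest L h) (Forest.Le h) := by
  induction h with
  | zero => exact { refl := fun _ => trivial, trans := fun _ _ _ _ _ => trivial }
  | succ h ih =>
    have : IsPreorder (L × Forest L h) fun a b => a.1 = b.1 ∧ Forest.Le h a.2 b.2 :=
      { refl := fun a => ⟨rfl, ih.refl _⟩
        trans := fun a b c hab hbc => ⟨hab.1.trans hbc.1, ih.trans _ _ _ hab.2 hbc.2⟩ }
    exact
      { refl := (inferInstance : Std.Refl (List.SublistForall₂ fun a b : L × Forest L h =>
          a.1 = b.1 ∧ Forest.Le h a.2 b.2)).refl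
        trans := (inferInstance : IsTrans _ (List.SublistForall₂ fun a b : L × Forest L h =>
          a.1 = b.1 ∧ Forest.Le h a.2 b.2)).trans }

lemma Forest.wellQuasiOrdered_le {L : Type} [Finite L] (h : ℕ) :
    WellQuasiOrdered (Forest.Le (L := L) h) := by
  induction h with
  | zero => exact fun _ => ⟨0, 1, Nat.zero_lt_one, trivial⟩
  | succ h ih =>
    have := Forest.isPreorder_le (L := L) h
    have hprod : WellQuasiOrdered fun a b : L × Forest L h => a.1 = b.1 ∧ Forest.Le h a.2 b.2 :=
      WellQuasiOrdered.prod (r := fun a b : L => a = b) (Finite.wellQuasiOrdered _) ih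
    have : IsPreorder (L × Forest L h) fun a b => a.1 = b.1 ∧ Forest.Le h a.2 b.2 :=
      { refl := fun a => ⟨rfl, this.refl _⟩
        trans := fun a b c hab hbc => ⟨hab.1.trans hbc.1, this.trans _ _ _ hab.2 hbc.2⟩ }
    have h2 := Set.PartiallyWellOrderedOn.partiallyWellOrderedOn_sublistForall₂ _
      (Set.partiallyWellOrderedOn_univ_iff.2 hprod)
    rw [show {l : List (L × Forest L h) | ∀ x, x ∈ l → x ∈ Set.univ} = Set.univ by simp] at h2
    exact Set.partiallyWellOrderedOn_univ_iff.1 h2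

variable {M : Type} {K : ℕ} {W W' : Type}

/-- The edge data from a node to its ancestors. -/
def ancLabel (K : ℕ) (E : W → W → M) (anc : ℕ → Option W) (w : W) : Fin K → Option M :=
  fun k => (anc k).map (E w)

/-- The list part of the realization predicate. -/
def RealizesList {L F : Type} (r : W → W → Prop) (lab : W → L)
    (sub : W → Finset W → F → Prop) : Finset W → List (L × F) → Prop
  | C, [] => C = ∅
  | C, p :: ts => ∃ w C₁ C₂, w ∉ C₁ ∧ Disjoint (insert w C₁) C₂ ∧ C = insert w C₁ ∪ C₂ ∧
      (∀ x ∈ insert w C₁, ∀ y ∈ C₂, ¬ r x y) ∧ p.1 = lab w ∧ sub w C₁ p.2 ∧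
      RealizesList r lab sub C₂ ts

/-- A forest describes the structure on the set `C`, all edges being between a node and one of
its ancestors. -/
def Realizes (K : ℕ) (E : W → W → M) (r : W → W → Prop) :
    ∀ h : ℕ, (ℕ → Option W) → Finset W → Forest (Fin K → Option M) h → Prop
  | 0 => fun _ C _ => C = ∅
  | h + 1 => fun anc => RealizesList (F := Forest (Fin K → Option M) h) r (ancLabel K E anc)
      fun w C₁ f => Realizes K E r h (Function.update anc h (some w)) C₁ f

lemma Realizes.exists_embedding {E : W → W → M} {r : W → W → Prop} (hr : ∀ x y, r x y → r y x)
    (hirr : ∀ x, ¬ r x x)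
    {E' : W' → W' → M} {r' : W' → W' → Prop} [Nonempty W'] (h : ℕ) :
    ∀ (anc : ℕ → Option W) (anc' : ℕ → Option W') (C : Finset W) (C' : Finset W')
      (t t' : Forest (Fin K → Option M) h), h ≤ K → (∀ k < h, anc k = none) →
      (∀ k < h, anc' k = none) → Forest.Le h t t' →
      Realizes K E r h anc C t → Realizes K E' r' h anc' C' t' →
      ∃ φ : W → W', Set.InjOn φ C ∧ (∀ x ∈ C, φ x ∈ C') ∧
        (∀ x ∈ C, ∀ y ∈ C, r x y → E' (φ x) (φ y) = E x y ∨ E' (φ y) (φ x) = E y x) ∧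
        ∀ x ∈ C, ancLabel K E' anc' (φ x) = ancLabel K E anc x := by
  induction h with
  | zero =>
    intro anc anc' C C' t t' _ _ _ _ h1 _
    change C = ∅ at h1
    subst h1
    exact ⟨fun _ => Classical.arbitrary _, by simp⟩
  | succ h ih =>
    intro anc anc' C C' t t' hK hn hn' hle
    change List.SublistForall₂ _ t t' at hle
    induction hle generalizing C C' with
    | nil =>
      intro h1 _
      change C = ∅ at h1
      subst h1
      exact ⟨fun _ => Classical.arbitrary _, by simp⟩
    | @cons_right p l₁ l₂ _ ih2 =>
      rintro h1 ⟨w', C₁', C₂', _, _, hC', _, _, _, h2⟩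
      obtain ⟨φ, i1, i2, i3, i4⟩ := ih2 C C₂' h1 h2
      exact ⟨φ, i1, fun x hx => hC' ▸ Finset.mem_union_right _ (i2 x hx), i3, i4⟩
    | @cons p p' l₁ l₂ hp _ ih2 =>
      rintro ⟨w, C₁, C₂, hw, hdis, hC, hno, hlab, hsub, hrest⟩
        ⟨w', C₁', C₂', hw', hdis', hC', hno', hlab', hsub', hrest'⟩
      obtain ⟨φ, i1, i2, i3, i4⟩ := ih _ _ C₁ C₁' p.2 p'.2 (by omega)
        (fun k hk => by rw [Function.update_of_ne (by omega), hn k (by omega)])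
        (fun k hk => by rw [Function.update_of_ne (by omega), hn' k (by omega)]) hp.2 hsub hsub'
      obtain ⟨ψ, j1, j2, j3, j4⟩ := ih2 C₂ C₂' hrest hrest'
      have hroot : ancLabel K E' anc' w' = ancLabel K E anc w := by
        rw [← hlab, ← hlab', hp.1]
      have hE : ∀ x ∈ C₁, E' (φ x) w' = E x w := by
        intro x hx
        have := congrFun (i4 x hx) ⟨h, by omega⟩
        simpa [ancLabel] using this
      have hanc : ∀ x ∈ C₁, ancLabel K E' anc' (φ x) = ancLabel K E anc x := by
        intro x hx
        funext k
        by_cases hk : (k : ℕ) = h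
        · simp [ancLabel, hk, hn h (by omega), hn' h (by omega)]
        · have := congrFun (i4 x hx) k
          simpa [ancLabel, hk] using this
      let χ : W → W' := fun x => if x = w then w' else if x ∈ C₁ then φ x else ψ x
      have χw : χ w = w' := by simp [χ]
      have χ1 : ∀ x ∈ C₁, χ x = φ x := fun x hx => by
        have : x ≠ w := fun h => hw (h ▸ hx)
        simp [χ, this, hx]
      have χ2 : ∀ x ∈ C₂, χ x = ψ x := fun x hx => by
        have h1 := Finset.disjoint_right.1 hdis hx
        rw [Finset.mem_insert, not_or] at h1
        simp [χ, h1.1, h1.2]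
      have hcase : ∀ x ∈ C, x = w ∨ x ∈ C₁ ∨ x ∈ C₂ := fun x hx => by
        rw [hC, Finset.mem_union, Finset.mem_insert, or_assoc] at hx
        exact hx
      have hdw : ∀ z ∈ C₂', z ≠ w' := fun z hz h => Finset.disjoint_right.1 hdis' hz
        (h ▸ Finset.mem_insert_self _ _)
      have hd1 : ∀ z ∈ C₂', z ∉ C₁' := fun z hz h => Finset.disjoint_right.1 hdis' hz
        (Finset.mem_insert_of_mem h)
      have hw1 : ∀ z ∈ C₁', z ≠ w' := fun z hz h => hw' (h ▸ hz)
      have hwC : w ∈ insert w C₁ := Finset.mem_insert_self _ _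
      refine ⟨χ, ?_, ?_, ?_, ?_⟩
      · intro x hx y hy hxy
        rcases hcase x hx with rfl | h1 | h1 <;> rcases hcase y hy with h2 | h2 | h2
        · exact h2.symm
        · rw [χw, χ1 y h2] at hxy
          exact absurd hxy.symm (hw1 _ (i2 y h2))
        · rw [χw, χ2 y h2] at hxy
          exact absurd hxy.symm (hdw _ (j2 y h2))
        · rw [h2, χw, χ1 x h1] at hxy
          exact absurd hxy (hw1 _ (i2 x h1))
        · rw [χ1 x h1, χ1 y h2] at hxy
          exact i1 h1 h2 hxy
        · rw [χ1 x h1, χ2 y h2] at hxy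
          exact absurd (hxy ▸ i2 x h1) (hd1 _ (j2 y h2))
        · rw [h2, χw, χ2 x h1] at hxy
          exact absurd hxy (hdw _ (j2 x h1))
        · rw [χ2 x h1, χ1 y h2] at hxy
          exact absurd (hxy ▸ i2 y h2) (hd1 _ (j2 x h1))
        · rw [χ2 x h1, χ2 y h2] at hxy
          exact j1 h1 h2 hxy
      · intro x hx
        rw [hC', Finset.mem_union, Finset.mem_insert, or_assoc]
        rcases hcase x hx with rfl | h1 | h1
        · exact Or.inl χw
        · exact Or.inr (Or.inl (χ1 x h1 ▸ i2 x h1))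
        · exact Or.inr (Or.inr (χ2 x h1 ▸ j2 x h1))
      · intro x hx y hy hxy
        rcases hcase x hx with rfl | h1 | h1 <;> rcases hcase y hy with h2 | h2 | h2
        · exact absurd (h2 ▸ hxy) (hirr _)
        · rw [χw, χ1 y h2]
          exact Or.inr (hE y h2)
        · exact absurd hxy (hno _ hwC y h2)
        · rw [h2, χw, χ1 x h1]
          exact Or.inl (hE x h1)
        · rw [χ1 x h1, χ1 y h2]
          exact i3 x h1 y h2 hxy
        · exact absurd hxy (hno _ (Finset.mem_insert_of_mem h1) y h2)
        · exact absurd (hr _ _ (h2 ▸ hxy)) (hno _ hwC x h1)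
        · exact absurd (hr _ _ hxy) (hno _ (Finset.mem_insert_of_mem h2) x h1)
        · rw [χ2 x h1, χ2 y h2]
          exact j3 x h1 y h2 hxy
      · intro x hx
        rcases hcase x hx with rfl | h1 | h1
        · rw [χw, hroot]
        · rw [χ1 x h1, hanc x h1]
        · rw [χ2 x h1, j4 x h1]

/-- Reachability inside a set. -/
def ReachWithin (r : W → W → Prop) (C : Finset W) : W → W → Prop :=
  Relation.ReflTransGen fun a b => r a b ∧ a ∈ C ∧ b ∈ C

/-- All paths in `C` starting at `w` have at most `h` vertices. -/
def ShortFrom (r : W → W → Prop) (C : Finset W) (h : ℕ) (w : W) : Prop :=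
  ∀ p : List W, (w :: p).Nodup → (w :: p).IsChain r → (∀ y ∈ p, y ∈ C) → (w :: p).length ≤ h

lemma ReachWithin.restrict {r : W → W → Prop} {C D : Finset W} {x y : W}
    (h : ReachWithin r C x y) (hx : x ∈ D)
    (hD : ∀ a ∈ D, ∀ b ∈ C, r a b → b ∈ D) : ReachWithin r D x y ∧ y ∈ D := by
  induction h with
  | refl => exact ⟨Relation.ReflTransGen.refl, hx⟩
  | tail _ hab ih =>
    have := hD _ ih.2 _ hab.2.2 hab.1
    exact ⟨ih.1.tail ⟨hab.1, ih.2, this⟩, this⟩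

lemma ReachWithin.exists_last {r : W → W → Prop} {D : Finset W} {x w : W}
    (h : ReachWithin r D x w) (hxw : x ≠ w) : ∃ y ∈ D.erase w, r y w ∧
      ReachWithin r (D.erase w) x y := by
  induction h using Relation.ReflTransGen.head_induction_on with
  | refl => exact absurd rfl hxw
  | @head a c hac _ ih =>
    have haD : a ∈ D.erase w := Finset.mem_erase.2 ⟨hxw, hac.2.1⟩
    by_cases hcw : c = w
    · subst hcw
      exact ⟨a, haD, hac.1, Relation.ReflTransGen.refl⟩
    · obtain ⟨y, hy, hyw, hcy⟩ := ih hcw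
      exact ⟨y, hy, hyw, hcy.head ⟨hac.1, haD, Finset.mem_erase.2 ⟨hcw, hac.2.2⟩⟩⟩

lemma exists_realizes {E : W → W → M} {r : W → W → Prop} (hr : ∀ x y, r x y → r y x)
    (h : ℕ) : ∀ (anc : ℕ → Option W) (C : Finset W),
      (∀ x ∈ C, ∃ w ∈ C, ReachWithin r C x w ∧ ShortFrom r C h w) →
      ∃ t, Realizes K E r h anc C t := by
  induction h with
  | zero =>
    intro anc C hC
    refine ⟨PUnit.unit, ?_⟩
    change C = ∅
    by_contra hne
    obtain ⟨x, hx⟩ := Finset.nonempty_iff_ne_empty.2 hne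
    obtain ⟨w, _, _, hw⟩ := hC x hx
    have := hw [] (by simp) (by simp) (by simp)
    simp at this
  | succ h ih =>
    intro anc C
    induction hn : C.card using Nat.strong_induction_on generalizing C with
    | _ n ihn =>
    intro hC
    rcases C.eq_empty_or_nonempty with rfl | ⟨x, hx⟩
    · exact ⟨([] : List _), rfl⟩
    obtain ⟨w, hwC, -, hw⟩ := hC x hx
    set D := C.filter fun y => ReachWithin r C w y with hD
    have hDC : D ⊆ C := Finset.filter_subset _ _
    have hwD : w ∈ D := Finset.mem_filter.2 ⟨hwC, Relation.ReflTransGen.refl⟩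
    have hcl : ∀ a ∈ D, ∀ b ∈ C, r a b → b ∈ D := fun a ha b hb hab =>
      Finset.mem_filter.2 ⟨hb, (Finset.mem_filter.1 ha).2.tail ⟨hab, hDC ha, hb⟩⟩
    have hcl2 : ∀ a ∈ C \ D, ∀ b ∈ C, r a b → b ∈ C \ D := fun a ha b hb hab =>
      Finset.mem_sdiff.2 ⟨hb, fun hbD => (Finset.mem_sdiff.1 ha).2
        (hcl b hbD a (Finset.mem_sdiff.1 ha).1 (hr _ _ hab))⟩
    have hins : insert w (D.erase w) = D := Finset.insert_erase hwD
    have hsymm : ∀ {y}, ReachWithin r D w y → ReachWithin r D y w := by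
      intro y hy
      induction hy with
      | refl => exact Relation.ReflTransGen.refl
      | tail _ hab ih => exact ih.head ⟨hr _ _ hab.1, hab.2.2, hab.2.1⟩
    obtain ⟨f, hf⟩ := ih (Function.update anc h (some w)) (D.erase w) (by
      intro y hy
      have hyD := Finset.mem_of_mem_erase hy
      have hwy := ((Finset.mem_filter.1 hyD).2.restrict hwD hcl).1
      obtain ⟨z, hz, hzw, hyz⟩ := (hsymm hwy).exists_last (Finset.ne_of_mem_erase hy)
      refine ⟨z, hz, hyz, fun p hp1 hp2 hp3 => ?_⟩
      have := hw (z :: p) (List.nodup_cons.2 ⟨?_, hp1⟩) (List.IsChain.cons_cons (hr _ _ hzw) hp2) ?_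
      · simpa using this
      · intro hmem
        rcases List.mem_cons.1 hmem with rfl | hmem
        · exact Finset.ne_of_mem_erase hz rfl
        · exact Finset.ne_of_mem_erase (hp3 _ hmem) rfl
      · intro y hy
        rcases List.mem_cons.1 hy with rfl | hy
        · exact hDC (Finset.mem_of_mem_erase hz)
        · exact hDC (Finset.mem_of_mem_erase (hp3 _ hy)))
    obtain ⟨ts, hts⟩ := ihn (C \ D).card (by
      rw [← hn]
      refine Finset.card_lt_card ⟨Finset.sdiff_subset, fun hsub => ?_⟩
      exact (Finset.mem_sdiff.1 (hsub hwC)).2 hwD) (C \ D) rfl (by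
      intro y hy
      obtain ⟨v, hv, hyv, hs⟩ := hC y (Finset.mem_sdiff.1 hy).1
      obtain ⟨h1, h2⟩ := hyv.restrict hy hcl2
      exact ⟨v, h2, h1, fun p hp1 hp2 hp3 => hs p hp1 hp2 fun z hz =>
        (Finset.mem_sdiff.1 (hp3 z hz)).1⟩)
    refine ⟨((ancLabel K E anc w, f) :: ts : List (_ × _)), w, D.erase w, C \ D, by simp, ?_, ?_,
      ?_, rfl, hf, hts⟩
    · rw [hins]
      exact Finset.disjoint_sdiff
    · rw [hins, Finset.union_sdiff_of_subset hDC]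
    · rw [hins]
      intro a ha b hb hab
      exact (Finset.mem_sdiff.1 hb).2 (hcl a ha b (Finset.mem_sdiff.1 hb).1 hab)

end Forests

section

variable {V : Type} [Fintype V] {g : V → V → ℤ}

/-- The form restricted to the vertex set `S` is positive semidefinite. -/
def PSDOn (g : V → V → ℤ) (c : ℝ) (S : Finset V) : Prop :=
  ∀ x : V → ℝ, 0 ≤ ∑ i ∈ S, ∑ j ∈ S, shiftGram g c i j * x i * x j

/-- A signed graph that is minimal with respect to not being positive semidefinite. -/
structure IsMinBad (g : V → V → ℤ) (c : ℝ) : Prop where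
  signed : IsSigned g
  bad : ¬ PSDOn g c Finset.univ
  proper : ∀ S : Finset V, S ≠ Finset.univ → PSDOn g c S

lemma PSDOn.shiftQuad_nonneg {c : ℝ} {S : Finset V} (h : PSDOn g c S) {ι : Type} [Fintype ι]
    (y : ι → V) (α : ι → ℝ) (hy : ∀ b, y b ∈ S) : 0 ≤ shiftQuad g c y α := by
  have h1 := h fun v => ∑ b, if y b = v then α b else 0
  suffices h2 : shiftQuad g c y α = ∑ i ∈ S, ∑ j ∈ S, shiftGram g c i j *
      (∑ b, if y b = i then α b else 0) * (∑ b, if y b = j then α b else 0) by rwa [h2]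
  have h3 : ∀ i j, shiftGram g c i j * (∑ b, if y b = i then α b else 0) *
      (∑ b, if y b = j then α b else 0) = ∑ a, ∑ b,
        if y b = j then (if y a = i then shiftGram g c i j * α a * α b else 0) else 0 := by
    intro i j
    rw [mul_assoc, Finset.sum_mul_sum, Finset.mul_sum]
    refine Finset.sum_congr rfl fun a _ => ?_
    rw [Finset.mul_sum]
    refine Finset.sum_congr rfl fun b _ => ?_
    split_ifs <;> ring
  simp only [h3]
  have h4 : ∀ i, ∑ j ∈ S, ∑ a, ∑ b,
        (if y b = j then (if y a = i then shiftGram g c i j * α a * α b else 0) else 0) =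
      ∑ a, ∑ b, if y a = i then shiftGram g c i (y b) * α a * α b else 0 := by
    intro i
    rw [Finset.sum_comm]
    refine Finset.sum_congr rfl fun a _ => ?_
    rw [Finset.sum_comm]
    refine Finset.sum_congr rfl fun b _ => ?_
    rw [Finset.sum_ite_eq S (y b)]
    simp only [hy b, if_true]
  simp only [h4]
  rw [Finset.sum_comm]
  refine Finset.sum_congr rfl fun a _ => ?_
  rw [Finset.sum_comm]
  refine Finset.sum_congr rfl fun b _ => ?_
  rw [Finset.sum_ite_eq S (y a)]
  simp only [hy a, if_true]

lemma IsMinBad.locallyPSD {c : ℝ} (h : IsMinBad g c) {N : ℕ} (hN : N < Fintype.card V) :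
    LocallyPSD g c N := by
  intro ι _ y α hc
  refine (h.proper (Finset.univ.image y) fun heq => ?_).shiftQuad_nonneg y α
    fun b => Finset.mem_image_of_mem _ (Finset.mem_univ _)
  have h1 : (Finset.univ.image y).card ≤ Fintype.card ι := Finset.card_image_le
  rw [heq, Finset.card_univ] at h1
  omega

lemma IsMinBad.isConn {c : ℝ} (h : IsMinBad g c) : IsConn g := by
  intro i j
  by_contra hij
  set S := Finset.univ.filter fun k => Relation.ReflTransGen (fun i j => g i j ≠ 0) i k with hS
  have hiS : i ∈ S := Finset.mem_filter.2 ⟨Finset.mem_univ _, Relation.ReflTransGen.refl⟩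
  have hjS : j ∉ S := fun hj => hij (Finset.mem_filter.1 hj).2
  have h0 : ∀ a ∈ S, ∀ b ∈ Sᶜ, shiftGram g c a b = 0 := by
    intro a ha b hb
    rw [Finset.mem_compl] at hb
    have h1 : a ≠ b := fun h => hb (h ▸ ha)
    have h2 : g a b = 0 := by
      by_contra h2
      exact hb (Finset.mem_filter.2 ⟨Finset.mem_univ _, (Finset.mem_filter.1 ha).2.tail h2⟩)
    simp [shiftGram, h1, h2]
  have h0' : ∀ a ∈ Sᶜ, ∀ b ∈ S, shiftGram g c a b = 0 := fun a ha b hb => by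
    rw [h.signed.shiftGram_comm, h0 b hb a ha]
  refine h.bad fun x => ?_
  have h1 := h.proper S (fun h => hjS (h ▸ Finset.mem_univ j)) x
  have h2 := h.proper Sᶜ (fun h => Finset.mem_compl.1 (h ▸ Finset.mem_univ i) hiS) x
  rw [← Finset.sum_add_sum_compl S]
  have e1 : ∑ i ∈ S, ∑ j, shiftGram g c i j * x i * x j =
      ∑ i ∈ S, ∑ j ∈ S, shiftGram g c i j * x i * x j := by
    refine Finset.sum_congr rfl fun a ha => ?_
    rw [← Finset.sum_add_sum_compl S, add_eq_left]
    exact Finset.sum_eq_zero fun b hb => by rw [h0 a ha b hb]; ring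
  have e2 : ∑ i ∈ Sᶜ, ∑ j, shiftGram g c i j * x i * x j =
      ∑ i ∈ Sᶜ, ∑ j ∈ Sᶜ, shiftGram g c i j * x i * x j := by
    refine Finset.sum_congr rfl fun a ha => ?_
    rw [← Finset.sum_add_sum_compl S, add_eq_right]
    exact Finset.sum_eq_zero fun b hb => by rw [h0' a ha b hb]; ring
  rw [e1, e2]
  exact add_nonneg h1 h2

lemma LocallyPSD.mono_left {c c' : ℝ} {N : ℕ} (h : LocallyPSD g c N) (hc : c ≤ c') :
    LocallyPSD g c' N := by
  intro ι _ y α hcard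
  have h1 := shiftQuad_add (g := g) c (c' - c) y α
  rw [add_sub_cancel] at h1
  rw [h1]
  exact add_nonneg (h ι y α hcard)
    (mul_nonneg (by linarith) (Finset.sum_nonneg fun v _ => sq_nonneg _))

lemma Represents.psdOn_univ {W : Type} [Fintype W] {u : V → W → ℤ} (hu : Represents g u) {c : ℝ}
    (hc : 2 ≤ c) : PSDOn g c Finset.univ := by
  intro x
  have h1 := shiftQuad_add (g := g) 2 (c - 2) (fun i : V => i) x
  rw [add_sub_cancel, hu.shiftQuad_two] at h1
  change 0 ≤ shiftQuad g c (fun i : V => i) x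
  rw [h1]
  exact add_nonneg (Finset.sum_nonneg fun w _ => sq_nonneg _)
    (mul_nonneg (by linarith) (Finset.sum_nonneg fun v _ => sq_nonneg _))

variable {W : Type} [Fintype W] {u : V → W → ℤ}

lemma Represents.exists_support (hg : IsSigned g) (hu : Represents g u) (i : V) {x : W}
    (hx : u i x ≠ 0) : ∃ y, x ≠ y ∧ u i y ≠ 0 ∧ ∀ z, z ≠ x → z ≠ y → u i z = 0 := by
  have h1 := hu.norm hg i
  have hsq : ∀ w, u i w ≠ 0 → u i w * u i w = 1 := fun w hw => by
    rcases hu.entries hg i w with h | h | h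
    · rw [h]; rfl
    · exact absurd h hw
    · rw [h]; rfl
  rw [← Finset.add_sum_erase _ _ (Finset.mem_univ x), hsq x hx] at h1
  obtain ⟨y, hy, hy0⟩ : ∃ y ∈ Finset.univ.erase x, u i y ≠ 0 := by
    by_contra! hc
    rw [Finset.sum_eq_zero fun y hy => by rw [hc y hy]; rfl] at h1
    norm_num at h1
  rw [← Finset.add_sum_erase _ _ hy, hsq y hy0] at h1
  have h2 : ∑ z ∈ (Finset.univ.erase x).erase y, u i z * u i z = 0 := by omega
  rw [Finset.sum_eq_zero_iff_of_nonneg fun z _ => mul_self_nonneg _] at h2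
  refine ⟨y, (Finset.ne_of_mem_erase hy).symm, hy0, fun z hzx hzy => ?_⟩
  exact mul_self_eq_zero.1 (h2 z (by simp [hzx, hzy]))

/-- Two coordinates are adjacent when some vector is supported on them. -/
def CoordAdj (u : V → W → ℤ) (x y : W) : Prop := x ≠ y ∧ ∃ i, u i x ≠ 0 ∧ u i y ≠ 0

/-- A path of coordinates gives vectors with a signed sum of small norm. -/
lemma Represents.exists_path_sum (hg : IsSigned g) (hu : Represents g u) :
    ∀ (p : List W) (w : W), (w :: p).Nodup → (w :: p).IsChain (CoordAdj u) →
    ∃ (S : Finset V) (α : V → ℝ) (z : W) (ε : ℝ), S.card = p.length ∧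
      (∀ i ∈ S, α i ^ 2 = 1) ∧ (∀ i ∈ S, ∀ x, u i x ≠ 0 → x ∈ w :: p) ∧ ε ^ 2 = 1 ∧
      ∀ x, ∑ i ∈ S, α i * (u i x : ℝ) = (if x = w then 1 else 0) + ε * (if x = z then 1 else 0)
  | [], w, _, _ => ⟨∅, fun _ => 0, w, -1, by simp, by simp, by simp, by norm_num,
    fun x => by by_cases h : x = w <;> simp [h]⟩
  | v :: p, w, hnd, hch => by
    obtain ⟨S, α, z, ε, hS, hα, hsupp, hε, hsum⟩ :=
      Represents.exists_path_sum hg hu p v (List.nodup_cons.1 hnd).2 hch.tail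
    obtain ⟨hwv, i, hiw, hiv⟩ : CoordAdj u w v := (List.isChain_cons_cons.1 hch).1
    have hw : w ∉ v :: p := (List.nodup_cons.1 hnd).1
    have hiS : i ∉ S := fun hi => hw (hsupp i hi w hiw)
    obtain ⟨y, hwy, hiy, hz⟩ := hu.exists_support hg i hiw
    have hyv : y = v := by
      by_contra hne
      exact hiv (hz v hwv.symm (Ne.symm hne))
    subst hyv
    have sq1 : ∀ x, u i x ≠ 0 → (u i x : ℝ) ^ 2 = 1 := fun x hx => by
      rcases hu.entries hg i x with h | h | h
      · rw [h]; norm_num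
      · exact absurd h hx
      · rw [h]; norm_num
    have hs := sq1 w hiw
    have ht := sq1 y hiy
    refine ⟨insert i S, fun j => if j = i then (u i w : ℝ) else -(u i w * u i y) * α j, z,
      -(u i w * u i y) * ε, ?_, ?_, ?_, ?_, ?_⟩
    · rw [Finset.card_insert_of_notMem hiS, hS, List.length_cons]
    · intro j hj
      by_cases hji : j = i
      · simp only [hji, if_true, hs]
      · simp only [hji, if_false]
        have := hα j ((Finset.mem_insert.1 hj).resolve_left hji)
        rw [mul_pow, this, neg_sq, mul_pow, hs, ht]; norm_num
    · intro j hj x hx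
      rcases Finset.mem_insert.1 hj with rfl | hj
      · by_contra hne
        rw [List.mem_cons, List.mem_cons] at hne
        exact hx (hz x (by tauto) (by tauto))
      · exact List.mem_cons_of_mem _ (hsupp j hj x hx)
    · rw [mul_pow, hε, neg_sq, mul_pow, hs, ht]; norm_num
    · intro x
      rw [Finset.sum_insert hiS]
      have h1 : ∑ j ∈ S, (if j = i then (u i w : ℝ) else -(u i w * u i y) * α j) * (u j x : ℝ) =
          -(u i w * u i y) * ∑ j ∈ S, α j * (u j x : ℝ) := by
        rw [Finset.mul_sum]
        refine Finset.sum_congr rfl fun j hj => ?_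
        have : j ≠ i := fun h => hiS (h ▸ hj)
        simp only [this, if_false]
        ring
      rw [h1, hsum x]
      simp only [if_true]
      have h2 : (u i x : ℝ) =
          u i w * (if x = w then 1 else 0) + u i y * (if x = y then 1 else 0) := by
        by_cases hxw : x = w
        · subst hxw
          simp [hwy]
        · by_cases hxy : x = y
          · subst hxy
            simp [hxw]
          · rw [hz x hxw hxy]
            simp [hxw, hxy]
      rw [h2]
      linear_combination (if x = w then 1 else 0) * hs

lemma IsMinBad.shortFrom {c : ℝ} (h : IsMinBad g c) (hu : Represents g u) {k : ℕ}
    (hk : 4 < (2 - c) * k) (hkc : k < Fintype.card V) (w : W) :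
    ShortFrom (CoordAdj u) Finset.univ k w := by
  intro p hnd hch _
  by_contra! hlen
  obtain ⟨S, α, z, ε, hS, hα, -, hε, hsum⟩ := hu.exists_path_sum h.signed (p.take k) w
    (by
      have : w :: p.take k = (w :: p).take (k + 1) := rfl
      rw [this]
      exact hnd.sublist (List.take_sublist _ _))
    (by
      have : w :: p.take k = (w :: p).take (k + 1) := rfl
      rw [this]
      exact hch.take _)
  have hSk : S.card = k := by
    rw [hS, List.length_take]
    simp only [List.length_cons] at hlen
    omega
  have h1 := h.locallyPSD hkc S (fun i => (i : V)) (fun i => α i) (by simp [hSk])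
  have h2 := shiftQuad_add (g := g) 2 (c - 2) (fun i : S => (i : V)) (fun i => α i)
  rw [add_sub_cancel, hu.shiftQuad_two] at h2
  have h3 : ∀ x, ∑ b : S, α b * (u b x : ℝ) =
      (if x = w then 1 else 0) + ε * (if x = z then 1 else 0) := fun x => by
    rw [← hsum x, Finset.sum_coe_sort S fun i => α i * (u i x : ℝ)]
  have h4 : ∀ v, (∑ b : S, if (b : V) = v then α b else 0) ^ 2 = if v ∈ S then 1 else 0 := by
    intro v
    rw [Finset.sum_coe_sort S fun i => if i = v then α i else 0, Finset.sum_ite_eq']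
    by_cases hv : v ∈ S
    · simp only [hv, if_true, hα v hv]
    · simp only [hv, if_false]; norm_num
  simp only [h3, h4] at h2
  rw [Finset.sum_ite_mem, Finset.univ_inter, Finset.sum_const, hSk, nsmul_eq_mul, mul_one] at h2
  have h5 : ∑ x, ((if x = w then (1 : ℝ) else 0) + ε * (if x = z then 1 else 0)) ^ 2 ≤
      ∑ x, (2 * (if x = w then 1 else 0) + 2 * (if x = z then 1 else 0)) := by
    refine Finset.sum_le_sum fun x _ => ?_
    split_ifs <;> nlinarith [sq_nonneg (ε - 1)]
  rw [Finset.sum_add_distrib, ← Finset.mul_sum, ← Finset.mul_sum] at h5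
  simp only [Finset.sum_ite_eq', Finset.mem_univ, if_true] at h5
  nlinarith

end

section

/-- The sign encoded by a Boolean. -/
def boolSign (s : Bool) : ℤ := if s then 1 else -1

/-- The vectors `± e_x ± e_y` present in a representation. -/
def coordEdges {V W : Type} (u : V → W → ℤ) (x y : W) : Bool → Bool → Prop := fun s t =>
  ∃ i, ∀ z, u i z = (if z = x then boolSign s else 0) + (if z = y then boolSign t else 0)

lemma exists_boolSign {a : ℤ} (h : a = -1 ∨ a = 0 ∨ a = 1) (h0 : a ≠ 0) : ∃ s, a = boolSign s := by
  rcases h with h | h | h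
  · exact ⟨false, h⟩
  · exact absurd h h0
  · exact ⟨true, h⟩

/-- An injective map of coordinates carrying vectors to vectors gives an induced embedding. -/
lemma Represents.exists_embedding {V V' W W' : Type} [Fintype V] [Fintype W] [Fintype W']
    {g : V → V → ℤ} {g' : V' → V' → ℤ} (hg : IsSigned g) (hg' : IsSigned g')
    {u : V → W → ℤ} {u' : V' → W' → ℤ} (hu : Represents g u) (hu' : Represents g' u') {φ : W → W'}
    (hφ : Function.Injective φ)
    (h : ∀ x y, CoordAdj u x y → coordEdges u' (φ x) (φ y) = coordEdges u x y ∨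
      coordEdges u' (φ y) (φ x) = coordEdges u y x) :
    ∃ f : V → V', Function.Injective f ∧ ∀ i j, g i j = g' (f i) (f j) := by
  have key : ∀ i, ∃ i', (∀ z, u' i' (φ z) = u i z) ∧ ∀ z', z' ∉ Set.range φ → u' i' z' = 0 := by
    intro i
    obtain ⟨x, hx⟩ : ∃ x, u i x ≠ 0 := by
      by_contra! hc
      have := hu.norm hg i
      simp [hc] at this
    obtain ⟨y, hxy, hy, hz⟩ := hu.exists_support hg i hx
    obtain ⟨s, hs⟩ := exists_boolSign (hu.entries hg i x) hx
    obtain ⟨t, ht⟩ := exists_boolSign (hu.entries hg i y) hy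
    have hform : ∀ z, u i z =
        (if z = x then boolSign s else 0) + (if z = y then boolSign t else 0) := by
      intro z
      by_cases h1 : z = x
      · subst h1; simp [hs, hxy]
      · by_cases h2 : z = y
        · subst h2; simp [ht, h1]
        · simp [h1, h2, hz z h1 h2]
    obtain ⟨i', hi'⟩ : ∃ i', ∀ z', u' i' z' =
        (if z' = φ x then boolSign s else 0) + (if z' = φ y then boolSign t else 0) := by
      rcases h x y ⟨hxy, i, hx, hy⟩ with h1 | h1
      · have h2 : coordEdges u x y s t := ⟨i, hform⟩
        rw [← h1] at h2
        exact h2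
      · have h2 : coordEdges u y x t s := ⟨i, fun z => by rw [hform z, add_comm]⟩
        rw [← h1] at h2
        obtain ⟨i', hi'⟩ := h2
        exact ⟨i', fun z => by rw [hi' z, add_comm]⟩
    refine ⟨i', fun z => ?_, fun z' hz' => ?_⟩
    · rw [hi', hform]
      simp only [hφ.eq_iff]
    · have h1 : z' ≠ φ x := fun h => hz' ⟨x, h.symm⟩
      have h2 : z' ≠ φ y := fun h => hz' ⟨y, h.symm⟩
      rw [hi']
      simp [h1, h2]
  choose f hf1 hf2 using key
  have hgram : ∀ i j, (if i = j then (2 : ℤ) else 0) + g i j =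
      (if f i = f j then 2 else 0) + g' (f i) (f j) := by
    intro i j
    rw [← hu i j, ← hu' (f i) (f j)]
    refine Fintype.sum_of_injective φ hφ _ _ (fun z' hz' => ?_) fun z => ?_
    · rw [hf2 i z' hz', zero_mul]
    · rw [hf1, hf1]
  have hinj : Function.Injective f := by
    intro i j hij
    by_contra hne
    have h1 := hgram i j
    rw [if_neg hne, if_pos hij, hij, hg'.diag] at h1
    rcases hg.entries i j with h2 | h2 | h2 <;> rw [h2] at h1 <;> norm_num at h1
  refine ⟨f, hinj, fun i j => ?_⟩
  have h1 := hgram i j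
  simp only [hinj.eq_iff] at h1
  linarith

lemma IsMinBad.not_embeds {V V' : Type} [Fintype V] [Fintype V'] {g : V → V → ℤ}
    {g' : V' → V' → ℤ} {c : ℝ} (h : IsMinBad g c) (h' : IsMinBad g' c)
    (hcard : Fintype.card V < Fintype.card V') {f : V → V'} (hf : Function.Injective f)
    (hfg : ∀ i j, g i j = g' (f i) (f j)) : False := by
  refine h.bad fun x => ?_
  have h1 : Finset.univ.image f ≠ Finset.univ := fun heq => by
    have := Finset.card_image_le (s := Finset.univ) (f := f)
    rw [heq, Finset.card_univ, Finset.card_univ] at this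
    omega
  have h2 := (h'.proper _ h1).shiftQuad_nonneg f x fun b =>
    Finset.mem_image_of_mem _ (Finset.mem_univ _)
  have h3 : g = fun i j => g' (f i) (f j) := funext fun i => funext fun j => hfg i j
  have h4 := shiftQuad_comp (g := g') hf c (fun i : V => i) x
  rw [← h3] at h4
  rw [← h4] at h2
  exact h2

/-- Below two, representable minimal signed graphs have bounded order. -/
lemma bounded_of_lt_two {c : ℝ} (hc : c < 2) : ∃ N : ℕ, ∀ {V : Type} [Fintype V]
    {g : V → V → ℤ}, IsMinBad g c → (∃ u : V → Option V → ℤ, Represents g u) →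
    Fintype.card V ≤ N := by
  obtain ⟨k, hk⟩ := exists_nat_gt (4 / (2 - c))
  have hk' : 4 < (2 - c) * k := by
    rw [div_lt_iff₀ (by linarith)] at hk
    linarith
  by_contra! hbad
  have hseq : ∀ n : ℕ, ∃ (V : Type) (_ : Fintype V) (g : V → V → ℤ) (u : V → Option V → ℤ),
      IsMinBad g c ∧ Represents g u ∧ k + n < Fintype.card V := by
    intro n
    obtain ⟨V, i, g, h1, ⟨u, hu⟩, h2⟩ := hbad (k + n)
    exact ⟨V, i, g, u, h1, hu, h2⟩
  choose V inst g u hg hu hcard using hseq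
  have hreal : ∀ n, ∃ t, Realizes k (coordEdges (u n)) (CoordAdj (u n)) k (fun _ => none)
      Finset.univ t := by
    intro n
    refine exists_realizes (fun x y h => ⟨h.1.symm, h.2.imp fun i hi => ⟨hi.2, hi.1⟩⟩) k _ _
      fun x _ => ⟨x, Finset.mem_univ _, Relation.ReflTransGen.refl, ?_⟩
    have := hcard n
    exact (hg n).shortFrom (hu n) hk' (by omega) x
  choose t ht using hreal
  have := Forest.isPreorder_le (L := Fin k → Option (Bool → Bool → Prop)) k
  obtain ⟨s, hs⟩ := (Forest.wellQuasiOrdered_le k).exists_monotone_subseq t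
  set m := s 0
  set n := s (Fintype.card (V m)) with hn
  have hmn : Fintype.card (V m) < Fintype.card (V n) := by
    have h1 := hcard n
    have h2 : Fintype.card (V m) ≤ n := s.strictMono.le_apply
    omega
  obtain ⟨φ, hφ, -, hφE, -⟩ := Realizes.exists_embedding
    (fun x y h => ⟨h.1.symm, h.2.imp fun i hi => ⟨hi.2, hi.1⟩⟩) (fun x h => h.1 rfl) k
    _ _ _ _ _ _ le_rfl (fun _ _ => rfl) (fun _ _ => rfl) (hs 0 _ (Nat.zero_le _)) (ht m) (ht n)
  obtain ⟨f, hf, hfg⟩ := (hu m).exists_embedding (hg m).signed (hg n).signed (hu n)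
    (fun x y hxy => hφ (Finset.mem_univ x) (Finset.mem_univ y) hxy)
    fun x y hxy => hφE x (Finset.mem_univ _) y (Finset.mem_univ _) hxy
  exact (hg m).not_embeds (hg n) hmn hf hfg

/-- Below the threshold, minimal signed graphs have bounded order. -/
theorem exists_card_bound {β s c : ℝ} (hβ : β ^ 3 = β + 1) (hs : s = √β + (√β)⁻¹)
    (hc : c < s) : ∃ N : ℕ, ∀ {V : Type} [Fintype V] {g : V → V → ℤ}, IsMinBad g c →
    Fintype.card V ≤ N := by
  obtain ⟨hs0, hs2, hb1, hb2⟩ := lamStar_sq hβ hs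
  have hs3 : 2.0197 < s := by
    by_contra! h
    nlinarith
  obtain ⟨k₁, hp⟩ := exists_params hβ hs (le_max_right c 2.0197) (max_lt hc hs3)
  obtain ⟨N, hN⟩ := exists_represents hp
  have key : ∀ {V : Type} [Fintype V] {g : V → V → ℤ}, IsMinBad g c → N < Fintype.card V →
      ∃ u : V → Option V → ℤ, Represents g u := fun hg hcard =>
    hN hg.signed hg.isConn ((hg.locallyPSD hcard).mono_left (le_max_left _ _)) hcard
  rcases lt_or_ge c 2 with h2 | h2
  · obtain ⟨N', hN'⟩ := bounded_of_lt_two h2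
    refine ⟨max N N', fun {V _ g} hg => ?_⟩
    by_contra! hcard
    obtain ⟨h3, h4⟩ := max_lt_iff.1 hcard
    exact absurd (hN' hg (key hg h3)) (by omega)
  · refine ⟨N, fun {V _ g} hg => ?_⟩
    by_contra! hcard
    obtain ⟨u, hu⟩ := key hg hcard
    exact hg.bad (hu.psdOn_univ h2)

end

section

/-- The eigenvalues of a symmetric matrix are bounded by `c` iff its quadratic form is. -/
lemma eigenvalues_le_iff {n : ℕ} {A : Matrix (Fin n) (Fin n) ℝ} (hA : A.IsSymm) (c : ℝ) :
    (∀ μ : ℝ, IsEigenvalue A μ → μ ≤ c) ↔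
      ∀ x : Fin n → ℝ, x ⬝ᵥ A.mulVec x ≤ c * (x ⬝ᵥ x) := by
  constructor
  · intro h x
    have hH : (c • (1 : Matrix (Fin n) (Fin n) ℝ) - A).IsHermitian := by
      rw [Matrix.IsHermitian, Matrix.conjTranspose_eq_transpose_of_trivial, Matrix.transpose_sub,
        Matrix.transpose_smul, Matrix.transpose_one, hA]
    have hps : (c • (1 : Matrix (Fin n) (Fin n) ℝ) - A).PosSemidef := by
      rw [hH.posSemidef_iff_eigenvalues_nonneg]
      intro i
      have h1 := hH.mulVec_eigenvectorBasis i
      rw [Matrix.sub_mulVec, Matrix.smul_mulVec, Matrix.one_mulVec] at h1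
      have h2 : IsEigenvalue A (c - hH.eigenvalues i) := by
        refine ⟨hH.eigenvectorBasis i, fun h0 => ?_, ?_⟩
        · have := hH.eigenvectorBasis.toBasis.ne_zero i
          rw [OrthonormalBasis.coe_toBasis] at this
          exact this (by ext j; exact congrFun h0 j)
        · rw [sub_smul, ← h1]; simp
      have := h _ h2
      change 0 ≤ hH.eigenvalues i
      linarith
    have h1 := hps.dotProduct_mulVec_nonneg x
    rw [Matrix.sub_mulVec, Matrix.smul_mulVec, Matrix.one_mulVec, star_trivial,
      dotProduct_sub, dotProduct_smul, smul_eq_mul] at h1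
    linarith
  · rintro h μ ⟨v, hv, hAv⟩
    have h1 := h v
    rw [hAv, dotProduct_smul, smul_eq_mul] at h1
    have h2 : 0 < v ⬝ᵥ v := by
      refine lt_of_le_of_ne (Finset.sum_nonneg fun i _ => mul_self_nonneg _) fun h0 => hv ?_
      exact dotProduct_self_eq_zero.1 h0.symm
    exact le_of_mul_le_mul_right h1 h2

namespace SignedGraph

variable {m n : ℕ}

/-- The integral matrix opposite to the signed adjacency matrix. -/
noncomputable def neg (G : SignedGraph n) (i j : Fin n) : ℤ :=
  if G.mat i j = -1 then 1 else if G.mat i j = 0 then 0 else -1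

lemma cast_neg (G : SignedGraph n) (i j : Fin n) : (G.neg i j : ℝ) = -G.mat i j := by
  rcases G.entries i j with h | h | h <;> simp only [neg, h] <;> norm_num

lemma isSigned_neg (G : SignedGraph n) : IsSigned G.neg := by
  refine ⟨fun i j => ?_, fun i => ?_, fun i j => ?_⟩
  · rw [neg, neg, G.isSymm.apply]
  · rw [neg, G.diag_zero]; norm_num
  · rcases G.entries i j with h | h | h <;> simp only [neg, h] <;> norm_num

lemma eigenvalues_le_iff_psdOn (G : SignedGraph n) (c : ℝ) :
    (∀ μ : ℝ, IsEigenvalue G.mat μ → μ ≤ c) ↔ PSDOn G.neg c Finset.univ := by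
  rw [eigenvalues_le_iff G.isSymm]
  refine forall_congr' fun x => ?_
  have h1 : ∑ i, ∑ j, shiftGram G.neg c i j * x i * x j =
      c * (x ⬝ᵥ x) - x ⬝ᵥ G.mat.mulVec x := by
    simp only [dotProduct, Matrix.mulVec, Finset.mul_sum]
    rw [← Finset.sum_sub_distrib]
    refine Finset.sum_congr rfl fun i _ => ?_
    have h2 : ∀ j, shiftGram G.neg c i j * x i * x j =
        Pi.single (M := fun _ => ℝ) i (c * (x i * x i)) j - x i * (G.mat i j * x j) := by
      intro j
      simp only [shiftGram, cast_neg]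
      by_cases hij : i = j
      · subst hij
        rw [Pi.single_eq_same]
        simp only [if_true]
        ring
      · rw [Pi.single_eq_of_ne (Ne.symm hij)]
        simp only [hij, if_false]
        ring
    refine (Finset.sum_congr rfl fun j _ => h2 j).trans ?_
    rw [Finset.sum_sub_distrib, Finset.sum_pi_single', if_pos (Finset.mem_univ _)]
  rw [h1, sub_nonneg]

/-- The induced signed subgraph along an injective map. -/
def comap (G : SignedGraph n) (f : Fin m → Fin n) : SignedGraph m where
  mat := G.mat.submatrix f f
  isSymm := G.isSymm.submatrix f
  diag_zero i := G.diag_zero _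
  entries i j := G.entries _ _

lemma psdOn_of_embeds {F : SignedGraph m} {G : SignedGraph n} {c : ℝ} (h : SignedEmbeds F G)
    (hG : PSDOn G.neg c Finset.univ) : PSDOn F.neg c Finset.univ := by
  obtain ⟨f, hf, hfg⟩ := h
  intro x
  have h1 := hG.shiftQuad_nonneg f x fun _ => Finset.mem_univ _
  have h2 : F.neg = fun i j => G.neg (f i) (f j) := by
    funext i j
    rw [neg, neg, hfg]
  have h3 := shiftQuad_comp (g := G.neg) hf c (fun i : Fin m => i) x
  rw [← h2] at h3
  rw [← h3] at h1
  exact h1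

lemma finite_signedGraph (n : ℕ) : Finite (SignedGraph n) := by
  refine Finite.of_injective
    (fun G : SignedGraph n => fun i j => (G.mat i j = 1, G.mat i j = 0)) fun G H h => ?_
  have h1 : G.mat = H.mat := by
    ext i j
    have h2 := congrFun (congrFun h i) j
    simp only [Prod.mk.injEq, eq_iff_iff] at h2
    rcases G.entries i j with h3 | h3 | h3 <;> rcases H.entries i j with h4 | h4 | h4 <;>
      rw [h3, h4] at h2 ⊢ <;> norm_num at h2
  cases G
  cases H
  cases h1
  rfl

/-- A signed graph outside the family contains a minimal one. -/
lemma exists_minBad {G : SignedGraph n} {c : ℝ} (h : ¬ PSDOn G.neg c Finset.univ) :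
    ∃ (m : ℕ) (F : SignedGraph m), SignedEmbeds F G ∧ IsMinBad F.neg c := by
  have hex : ∃ m, ∃ F : SignedGraph m, SignedEmbeds F G ∧ ¬ PSDOn F.neg c Finset.univ :=
    ⟨n, G, ⟨id, Function.injective_id, fun _ _ => rfl⟩, h⟩
  obtain ⟨F, hFG, hF⟩ := Nat.find_spec hex
  refine ⟨_, F, hFG, F.isSigned_neg, hF, fun S hS => ?_⟩
  by_contra hbad
  let f := S.orderEmbOfFin rfl
  refine Nat.find_min hex (m := S.card) ?_ ⟨F.comap f, ?_, fun hps => hbad fun x => ?_⟩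
  · have := (Finset.card_lt_iff_ne_univ S).2 hS
    rwa [Fintype.card_fin] at this
  · obtain ⟨e, he, hee⟩ := hFG
    exact ⟨fun i => e (f i), he.comp f.injective, fun i j => hee _ _⟩
  · have h1 := hps fun i => x (f i)
    have h2 : S = Finset.univ.map f.toEmbedding := by
      rw [Finset.map_eq_image]
      exact (Finset.image_orderEmbOfFin_univ S rfl).symm
    rw [h2]
    simp only [Finset.sum_map]
    refine h1.trans_eq (Finset.sum_congr rfl fun i _ => Finset.sum_congr rfl fun j _ => ?_)
    have h3 : shiftGram (F.comap f).neg c i j = shiftGram F.neg c (f i) (f j) := by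
      simp only [shiftGram]
      by_cases hij : i = j
      · subst hij; simp only [if_true]; rfl
      · simp only [hij, f.injective.ne hij, if_false]; rfl
    rw [h3]
    rfl

end SignedGraph

/-- A bound on the order of minimal signed graphs gives a finite characterization. -/
lemma hasFiniteForbidden_of_bound {c : ℝ} {N : ℕ}
    (hN : ∀ {V : Type} [Fintype V] {g : V → V → ℤ}, IsMinBad g c → Fintype.card V ≤ N) :
    HasFiniteForbiddenCharacterizationSigned
      (fun _ G => ∀ μ : ℝ, IsEigenvalue G.mat μ → μ ≤ c) := by
  have : ∀ n, Finite (SignedGraph n) := SignedGraph.finite_signedGraph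
  let T := {p : Σ m : Fin (N + 1), SignedGraph m // ¬ PSDOn p.2.neg c Finset.univ}
  let e : Fin (Nat.card T) ≃ T := (Finite.equivFin T).symm
  refine ⟨Nat.card T, fun i => (e i).1.1, fun i => (e i).1.2, fun n G => ?_⟩
  refine (G.eigenvalues_le_iff_psdOn c).trans ?_
  constructor
  · exact fun hG i hi => (e i).2 (SignedGraph.psdOn_of_embeds hi hG)
  · intro h
    by_contra hG
    obtain ⟨m, F, hFG, hF⟩ := SignedGraph.exists_minBad hG
    have hm := hN hF
    rw [Fintype.card_fin] at hm
    let p : T := ⟨⟨⟨m, by omega⟩, F⟩, hF.bad⟩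
    refine h (e.symm p) ?_
    have he : e (e.symm p) = p := e.apply_symm_apply p
    change SignedEmbeds (e (e.symm p)).1.2 G
    rw [he]
    exact hFG

end

section

namespace SignedGraph

variable {n : ℕ}

/-- The signed graph obtained by attaching a new vertex along a `{-1, 0, 1}`-valued vector. -/
def extend (G : SignedGraph n) (a : Fin n → ℝ) (ha : ∀ i, a i = -1 ∨ a i = 0 ∨ a i = 1) :
    SignedGraph (n + 1) where
  mat := Matrix.of
    (Fin.cons (Fin.cons 0 a : Fin (n + 1) → ℝ) fun i => (Fin.cons (a i) (G.mat i)))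
  isSymm := by
    refine Matrix.IsSymm.ext fun i j => ?_
    refine Fin.cases ?_ (fun i => ?_) i <;> refine Fin.cases ?_ (fun j => ?_) j <;>
      simp [G.isSymm.apply]
  diag_zero i := by
    refine Fin.cases ?_ (fun i => ?_) i <;> simp [G.diag_zero]
  entries i j := by
    refine Fin.cases ?_ (fun i => ?_) i <;> refine Fin.cases ?_ (fun j => ?_) j
    · simp
    · simpa using ha j
    · simpa using ha i
    · simpa using G.entries i j

lemma extend_mulVec_zero (G : SignedGraph n) {a : Fin n → ℝ}
    (ha : ∀ i, a i = -1 ∨ a i = 0 ∨ a i = 1) (y : Fin (n + 1) → ℝ) :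
    (G.extend a ha).mat.mulVec y 0 = a ⬝ᵥ Fin.tail y := by
  simp [extend, Matrix.mulVec, dotProduct, Fin.sum_univ_succ, Fin.tail]

lemma extend_mulVec_succ (G : SignedGraph n) {a : Fin n → ℝ}
    (ha : ∀ i, a i = -1 ∨ a i = 0 ∨ a i = 1) (y : Fin (n + 1) → ℝ) (i : Fin n) :
    (G.extend a ha).mat.mulVec y i.succ = y 0 * a i + G.mat.mulVec (Fin.tail y) i := by
  simp [extend, Matrix.mulVec, dotProduct, Fin.sum_univ_succ, Fin.tail, mul_comm]

lemma dotProduct_succ (y z : Fin (n + 1) → ℝ) :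
    y ⬝ᵥ z = y 0 * z 0 + Fin.tail y ⬝ᵥ Fin.tail z := by
  simp [dotProduct, Fin.sum_univ_succ, Fin.tail]

lemma extend_quadratic (G : SignedGraph n) {a x : Fin n → ℝ} {μ κ : ℝ}
    (ha : ∀ i, a i = -1 ∨ a i = 0 ∨ a i = 1)
    (hG : ∀ y, y ⬝ᵥ G.mat.mulVec y ≤ μ * (y ⬝ᵥ y)) (hx : μ • x - G.mat.mulVec x = a)
    (hκ : a ⬝ᵥ x = κ) (hle : κ ≤ μ) (y : Fin (n + 1) → ℝ) :
    y ⬝ᵥ (G.extend a ha).mat.mulVec y ≤ μ * (y ⬝ᵥ y) := by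
  set t := y 0
  set z := Fin.tail y
  have h1 : Fin.tail ((G.extend a ha).mat.mulVec y) = t • a + G.mat.mulVec z := by
    funext i
    exact G.extend_mulVec_succ ha y i
  have h2 := hG (z - t • x)
  have h3 : G.mat.mulVec x = μ • x - a := by rw [← hx]; abel
  have h4 : x ⬝ᵥ G.mat.mulVec z = z ⬝ᵥ G.mat.mulVec x := by
    rw [Matrix.dotProduct_mulVec, ← Matrix.mulVec_transpose, G.isSymm, dotProduct_comm]
  rw [dotProduct_succ, dotProduct_succ y y, h1, extend_mulVec_zero]
  simp only [Matrix.mulVec_sub, Matrix.mulVec_smul, sub_dotProduct, dotProduct_sub, dotProduct_add,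
    smul_dotProduct, dotProduct_smul, smul_eq_mul, h4, h3] at h2 ⊢
  rw [dotProduct_comm x a, hκ, dotProduct_comm z a, dotProduct_comm x z] at h2
  change t * (a ⬝ᵥ z) + (t * (z ⬝ᵥ a) + z ⬝ᵥ G.mat.mulVec z) ≤ μ * (t * t + z ⬝ᵥ z)
  rw [dotProduct_comm z a]
  nlinarith [mul_le_mul_of_nonneg_right hle (mul_self_nonneg t)]

end SignedGraph

/-- There is a signed graph with eigenvalues at most `μ`, together with a `{-1, 0, 1}`-valued
vector `a` and a solution `x` of `(μ - A) x = a`, such that `a · x = κ` and `|x|² ≥ M`. -/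
def GrowthState (μ κ M : ℝ) : Prop :=
  ∃ (n : ℕ) (G : SignedGraph n) (a x : Fin n → ℝ), (∀ i, a i = -1 ∨ a i = 0 ∨ a i = 1) ∧
    (∀ y, y ⬝ᵥ G.mat.mulVec y ≤ μ * (y ⬝ᵥ y)) ∧ μ • x - G.mat.mulVec x = a ∧ a ⬝ᵥ x = κ ∧
    M ≤ x ⬝ᵥ x

namespace GrowthState

variable {μ κ M : ℝ}

lemma zero (μ : ℝ) : GrowthState μ 0 0 := by
  refine ⟨0, ⟨0, Matrix.isSymm_zero, fun i => i.elim0, fun i => i.elim0⟩, fun i => i.elim0,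
    fun i => i.elim0, fun i => i.elim0, fun y => ?_, ?_, ?_, ?_⟩
  · simp
  · funext i; exact i.elim0
  · simp
  · simp

/-- Attach a new vertex and restart from it. -/
lemma path (h : GrowthState μ κ M) (hlt : κ < μ) :
    GrowthState μ (μ - κ)⁻¹ (((μ - κ)⁻¹) ^ 2 * (M + 1)) := by
  obtain ⟨n, G, a, x, ha, hG, hx, hκ, hM⟩ := h
  have h0 : μ - κ ≠ 0 := by linarith
  set s := (μ - κ)⁻¹ with hs
  have hss : s * (μ - κ) = 1 := inv_mul_cancel₀ h0
  refine ⟨n + 1, G.extend a ha, Fin.cons 1 0, Fin.cons s (s • x), fun i => ?_,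
    G.extend_quadratic ha hG hx hκ hlt.le, ?_, ?_, ?_⟩
  · refine Fin.cases ?_ (fun i => ?_) i <;> simp
  · funext i
    refine Fin.cases ?_ (fun i => ?_) i
    · simp only [Pi.sub_apply, Pi.smul_apply, G.extend_mulVec_zero, Fin.cons_zero, Fin.tail_cons,
        dotProduct_smul, hκ, smul_eq_mul]
      linarith
    · have h1 := congrFun hx i
      simp only [Pi.sub_apply, Pi.smul_apply, G.extend_mulVec_succ, Fin.cons_zero, Fin.tail_cons,
        Fin.cons_succ, Matrix.mulVec_smul, smul_eq_mul, Pi.zero_apply] at h1 ⊢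
      rw [← h1]; ring
  · simp [SignedGraph.dotProduct_succ]
  · simp only [SignedGraph.dotProduct_succ, Fin.cons_zero, Fin.tail_cons, dotProduct_smul,
      smul_dotProduct, smul_eq_mul]
    nlinarith [mul_le_mul_of_nonneg_left hM (mul_self_nonneg s)]

/-- Attach a new vertex and extend the coupling vector by `η`. -/
lemma couple (h : GrowthState μ κ M) (hlt : κ < μ) {η : ℝ} (hη : η = -1 ∨ η = 0 ∨ η = 1) :
    GrowthState μ (κ + (κ + η) ^ 2 / (μ - κ)) ((1 + (κ + η) / (μ - κ)) ^ 2 * M) := by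
  obtain ⟨n, G, a, x, ha, hG, hx, hκ, hM⟩ := h
  have h0 : μ - κ ≠ 0 := by linarith
  set r := (κ + η) / (μ - κ) with hr
  have hrr : r * (μ - κ) = κ + η := div_mul_cancel₀ _ h0
  refine ⟨n + 1, G.extend a ha, Fin.cons η a, Fin.cons r ((1 + r) • x), fun i => ?_,
    G.extend_quadratic ha hG hx hκ hlt.le, ?_, ?_, ?_⟩
  · refine Fin.cases ?_ (fun i => ?_) i
    · simpa using hη
    · simpa using ha i
  · funext i
    refine Fin.cases ?_ (fun i => ?_) i
    · simp only [Pi.sub_apply, Pi.smul_apply, G.extend_mulVec_zero, Fin.cons_zero, Fin.tail_cons,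
        dotProduct_smul, hκ, smul_eq_mul]
      linarith
    · have h1 := congrFun hx i
      simp only [Pi.sub_apply, Pi.smul_apply, G.extend_mulVec_succ, Fin.cons_zero, Fin.tail_cons,
        Fin.cons_succ, Matrix.mulVec_smul, smul_eq_mul] at h1 ⊢
      linear_combination (1 + r) * h1
  · simp only [SignedGraph.dotProduct_succ, Fin.cons_zero, Fin.tail_cons, dotProduct_smul,
      smul_eq_mul, hκ]
    have : (κ + η) ^ 2 / (μ - κ) = r * (κ + η) := by rw [hr]; ring
    rw [this]; ring
  · simp only [SignedGraph.dotProduct_succ, Fin.cons_zero, Fin.tail_cons, dotProduct_smul,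
      smul_dotProduct, smul_eq_mul]
    nlinarith [mul_le_mul_of_nonneg_left hM (mul_self_nonneg (1 + r)), mul_self_nonneg r]

lemma mono (h : GrowthState μ κ M) {M' : ℝ} (hM : M' ≤ M) : GrowthState μ κ M' := by
  obtain ⟨n, G, a, x, ha, hG, hx, hκ, hM'⟩ := h
  exact ⟨n, G, a, x, ha, hG, hx, hκ, hM.trans hM'⟩

lemma exists_signedGraph {c : ℝ} (h : GrowthState μ κ M) (hc : κ < (μ - c) * M) (hcμ : c ≤ μ) :
    ∃ (n : ℕ) (G : SignedGraph n), (∀ ν : ℝ, IsEigenvalue G.mat ν → ν ≤ μ) ∧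
      ¬ ∀ ν : ℝ, IsEigenvalue G.mat ν → ν ≤ c := by
  obtain ⟨n, G, a, x, ha, hG, hx, hκ, hM⟩ := h
  refine ⟨n, G, (eigenvalues_le_iff G.isSymm μ).2 hG, fun hle => ?_⟩
  have h1 := (eigenvalues_le_iff G.isSymm c).1 hle x
  have h2 : G.mat.mulVec x = μ • x - a := by rw [← hx]; abel
  rw [h2, dotProduct_sub, dotProduct_smul, dotProduct_comm x a, hκ, smul_eq_mul] at h1
  nlinarith [mul_le_mul_of_nonneg_left hM (sub_nonneg.2 hcμ)]

end GrowthState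

end

section

lemma exists_of_progress {P : ℝ → Prop} {a δ c B : ℝ} (hδ : 0 < δ) (h0 : P a)
    (hB : ∀ κ, P κ → κ ≤ B)
    (hstep : ∀ κ, a ≤ κ → P κ → κ < c → ∃ κ', κ + δ ≤ κ' ∧ P κ') :
    ∃ κ, a ≤ κ ∧ c ≤ κ ∧ P κ := by
  by_contra! hno
  have h1 : ∀ n : ℕ, ∃ κ, a + n * δ ≤ κ ∧ P κ := by
    intro n
    induction n with
    | zero => exact ⟨a, by simp, h0⟩
    | succ n ih =>
      obtain ⟨κ, hκ, hP⟩ := ih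
      have ha : a ≤ κ := by
        have : (0 : ℝ) ≤ n * δ := by positivity
        linarith
      obtain ⟨κ', hκ', hP'⟩ := hstep κ ha hP (not_le.1 fun hc => hno κ ha hc hP)
      refine ⟨κ', ?_, hP'⟩
      push_cast
      linarith
  obtain ⟨n, hn⟩ := exists_nat_gt ((B - a) / δ)
  obtain ⟨κ, hκ, hP⟩ := h1 n
  rw [div_lt_iff₀ hδ] at hn
  linarith [hB κ hP]

namespace GrowthState

variable {μ κ M T : ℝ}

/-- Attach a new leaf-like vertex, keeping the coupling vector. -/
lemma leaf (h : GrowthState μ κ M) (hlt : κ < μ) :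
    GrowthState μ (κ * μ / (μ - κ)) ((μ / (μ - κ)) ^ 2 * M) := by
  have h0 : μ - κ ≠ 0 := by linarith
  have h1 := h.couple hlt (η := 0) (by simp)
  convert h1 using 1
  · field_simp; ring
  · congr 2; field_simp; ring

lemma exists_unbounded {R : ℝ → Prop} {r κ₀ M₀ : ℝ} (hr : 1 < r) (h0 : R κ₀) (hM₀ : 0 < M₀)
    (h : GrowthState μ κ₀ M₀)
    (hround : ∀ κ M, 0 < M → R κ → GrowthState μ κ M → ∃ κ', R κ' ∧ GrowthState μ κ' (r * M))
    (B : ℝ) : ∃ κ, R κ ∧ GrowthState μ κ B := by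
  have h1 : ∀ n : ℕ, ∃ κ, R κ ∧ GrowthState μ κ (r ^ n * M₀) := by
    intro n
    induction n with
    | zero => exact ⟨κ₀, h0, by simpa using h⟩
    | succ n ih =>
      obtain ⟨κ, hκ, hs⟩ := ih
      obtain ⟨κ', hκ', hs'⟩ := hround κ _ (by positivity) hκ hs
      exact ⟨κ', hκ', hs'.mono (by rw [pow_succ]; linarith)⟩
  obtain ⟨n, hn⟩ := pow_unbounded_of_one_lt (B / M₀) hr
  rw [div_lt_iff₀ hM₀] at hn
  obtain ⟨κ, hκ, hs⟩ := h1 n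
  exact ⟨κ, hκ, hs.mono hn.le⟩

/-- Growth by attaching leaves, available when `T` is not too small. -/
lemma leaf_round (hT : 1 < T) (hμ : μ = T + T⁻¹) (hM : 0 < M) (hκ : κ ≤ T)
    (h : GrowthState μ κ M) :
    ∃ κ', κ' ≤ T ∧ GrowthState μ κ' (((T⁻¹ + μ⁻¹)⁻¹) ^ 2 * M) := by
  have hT0 : 0 < T⁻¹ := by positivity
  have hμ0 : 0 < μ := by rw [hμ]; linarith
  have hlt : ∀ κ, κ ≤ T → κ < μ := fun κ h => by rw [hμ]; linarith
  set a := (μ - κ)⁻¹ with ha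
  have ha0 : 0 < a := inv_pos.2 (sub_pos.2 (hlt κ hκ))
  have haT : a ≤ T := by
    rw [ha]
    exact inv_le_of_inv_le₀ (by linarith) (by linarith)
  have hstep : ∀ κ, a ≤ κ → (κ ≤ T ∧ GrowthState μ κ (κ ^ 2 * M)) → κ < (T⁻¹ + μ⁻¹)⁻¹ →
      ∃ κ', κ + a ^ 2 / μ ≤ κ' ∧ κ' ≤ T ∧ GrowthState μ κ' (κ' ^ 2 * M) := by
    rintro κ haκ ⟨hκT, hs⟩ hκc
    have hκ0 : 0 < κ := ha0.trans_le haκ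
    have hκμ := hlt κ hκT
    have hd : 0 < μ - κ := by linarith
    refine ⟨κ * μ / (μ - κ), ?_, ?_, ?_⟩
    · have h1 : κ * μ / (μ - κ) = κ + κ ^ 2 / (μ - κ) := by field_simp; ring
      rw [h1]
      have : a ^ 2 / μ ≤ κ ^ 2 / (μ - κ) := by gcongr; linarith
      linarith
    · have h1 : T⁻¹ + μ⁻¹ < κ⁻¹ := by
        rwa [lt_inv_comm₀ (by positivity) hκ0]
      rw [div_le_iff₀ hd]
      have h2 : (T⁻¹ + μ⁻¹) * (T * μ * κ) ≤ κ⁻¹ * (T * μ * κ) := by gcongr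
      have h3 : (T⁻¹ + μ⁻¹) * (T * μ * κ) = (μ + T) * κ := by field_simp
      have h4 : κ⁻¹ * (T * μ * κ) = T * μ := by field_simp
      rw [h3, h4] at h2
      linarith
    · refine (hs.leaf hκμ).mono (le_of_eq ?_)
      field_simp
  obtain ⟨κ', haκ, hcκ, hκT, hs⟩ := exists_of_progress (c := (T⁻¹ + μ⁻¹)⁻¹) (B := T)
    (P := fun κ => κ ≤ T ∧ GrowthState μ κ (κ ^ 2 * M)) (a := a) (δ := a ^ 2 / μ)
    (by positivity)
    ⟨haT, (h.path (hlt κ hκ)).mono (by nlinarith [sq_nonneg a])⟩ (fun κ h => h.1) hstep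
  refine ⟨κ', hκT, hs.mono ?_⟩
  have : 0 ≤ (T⁻¹ + μ⁻¹)⁻¹ := by positivity
  gcongr

/-- Growth by negative twins, available when `T` is not too large. -/
lemma twin_round (hT : 1 < T) (hμ : μ = T + T⁻¹) {c₀ : ℝ} (hc₀ : 1 < c₀)
    (hc : c₀ ≤ (μ - T ^ 3 / (2 * T ^ 2 - 2 * T + 1))⁻¹) (hM : 0 < M) (hκ₀ : c₀ ≤ κ)
    (hκ : κ ≤ T) (h : GrowthState μ κ M) :
    ∃ κ', (c₀ ≤ κ' ∧ κ' ≤ T) ∧ GrowthState μ κ' (c₀ ^ 2 * M) := by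
  have hT0 : 0 < T⁻¹ := by positivity
  have hμ0 : 0 < μ := by rw [hμ]; linarith
  have hlt : ∀ κ, κ ≤ T → κ < μ := fun κ h => by rw [hμ]; linarith
  have hden : 0 < 2 * T ^ 2 - 2 * T + 1 := by nlinarith
  have hstep : ∀ κ', κ ≤ κ' → (κ' ≤ T ∧ GrowthState μ κ' M) →
      κ' < T ^ 3 / (2 * T ^ 2 - 2 * T + 1) →
      ∃ κ'', κ' + (κ - 1) ^ 2 / μ ≤ κ'' ∧ κ'' ≤ T ∧ GrowthState μ κ'' M := by
    rintro κ' haκ ⟨hκT, hs⟩ hκc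
    have hκμ := hlt κ' hκT
    have hd : 0 < μ - κ' := by linarith
    refine ⟨κ' + (κ' + -1) ^ 2 / (μ - κ'), ?_, ?_, ?_⟩
    · have : (κ - 1) ^ 2 / μ ≤ (κ' + -1) ^ 2 / (μ - κ') := by
        have : κ - 1 ≤ κ' + -1 := by linarith
        have : 0 ≤ κ - 1 := by linarith
        gcongr
        linarith
      linarith
    · rw [lt_div_iff₀ hden] at hκc
      rw [← le_sub_iff_add_le', div_le_iff₀ hd, hμ]
      have h1 : T * T⁻¹ = 1 := mul_inv_cancel₀ (by linarith)
      have h2 : T * (κ' + -1) ^ 2 ≤ T * ((T - κ') * (T + T⁻¹ - κ')) := by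
        have : T * ((T - κ') * (T + T⁻¹ - κ')) = (T - κ') * (T ^ 2 + 1 - T * κ') := by
          linear_combination (T - κ') * h1
        rw [this]
        nlinarith
      exact le_of_mul_le_mul_left h2 (by linarith)
    · refine (hs.couple hκμ (η := -1) (by simp)).mono ?_
      have : 0 ≤ (κ' + -1) / (μ - κ') := div_nonneg (by linarith) hd.le
      nlinarith [mul_nonneg this this]
  obtain ⟨κ', haκ, hcκ, hκT, hs⟩ := exists_of_progress
    (c := T ^ 3 / (2 * T ^ 2 - 2 * T + 1)) (B := T)
    (P := fun κ => κ ≤ T ∧ GrowthState μ κ M) (a := κ) (δ := (κ - 1) ^ 2 / μ)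
    (div_pos (pow_pos (by linarith) 2) hμ0) ⟨hκ, h⟩ (fun κ h => h.1) hstep
  have h1 : μ - κ' ≤ μ - T ^ 3 / (2 * T ^ 2 - 2 * T + 1) := by linarith
  have h2 : 0 < μ - κ' := sub_pos.2 (hlt κ' hκT)
  have h3 : c₀ ≤ (μ - κ')⁻¹ := hc.trans (inv_anti₀ h2 h1)
  refine ⟨(μ - κ')⁻¹, ⟨h3, inv_le_of_inv_le₀ (by linarith) (by linarith)⟩,
    (hs.path (hlt κ' hκT)).mono ?_⟩
  have : c₀ ^ 2 ≤ ((μ - κ')⁻¹) ^ 2 := by gcongr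
  nlinarith

lemma pos_path (h : ∃ M, 0 ≤ M ∧ GrowthState μ κ M) (hlt : κ < μ) :
    ∃ M, 0 < M ∧ GrowthState μ (μ - κ)⁻¹ M := by
  obtain ⟨M, hM, hs⟩ := h
  have : 0 < (μ - κ)⁻¹ := inv_pos.2 (sub_pos.2 hlt)
  exact ⟨_, by positivity, hs.path hlt⟩

lemma pos_leaf {σ : ℝ} (h : ∃ M, 0 < M ∧ GrowthState μ σ⁻¹ M) (hμ : 0 < μ) (hσ : μ⁻¹ < σ) :
    ∃ M, 0 < M ∧ GrowthState μ (σ - μ⁻¹)⁻¹ M := by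
  obtain ⟨M, hM, hs⟩ := h
  have hμi : 0 < μ⁻¹ := inv_pos.2 hμ
  have hσ0 : 0 < σ := hμi.trans hσ
  have h1 : σ⁻¹ < μ := inv_lt_of_inv_lt₀ hμ hσ
  have h2 : 0 < μ - σ⁻¹ := by linarith
  have h3 : 1 < σ * μ := by rwa [inv_lt_iff_one_lt_mul₀ hμ] at hσ
  refine ⟨(μ / (μ - σ⁻¹)) ^ 2 * M, by positivity, ?_⟩
  have := hs.leaf h1
  convert this using 1
  have h4 : σ * μ - 1 ≠ 0 := by linarith
  have h5 : μ * σ - 1 ≠ 0 := by linarith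
  field_simp

lemma pos_twin {k : ℝ} (h : ∃ M, 0 < M ∧ GrowthState μ ((k + 1) / (μ + k)) M) (hk : 0 ≤ k)
    (hμ : 2 ≤ μ) : ∃ M, 0 < M ∧ GrowthState μ ((k + 1 + 1) / (μ + (k + 1))) M := by
  obtain ⟨M, hM, hs⟩ := h
  have h0 : 0 < μ + k := by linarith
  have h3 : 0 < μ ^ 2 + μ * k - k - 1 := by nlinarith
  have h4 : μ - (k + 1) / (μ + k) = (μ ^ 2 + μ * k - k - 1) / (μ + k) := by field_simp; ring
  have h1 : (k + 1) / (μ + k) < μ := by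
    rw [← sub_pos, h4]; positivity
  have h2 := hs.couple h1 (η := -1) (by simp)
  have h5 : 0 < μ + k + 1 := by linarith
  have h6 : μ ^ 2 + μ * k - k - 1 = (μ - 1) * (μ + k + 1) := by ring
  have h7 : 0 < μ - 1 := by linarith
  have h8 : (k + 1) / (μ + k) + -1 = (1 - μ) / (μ + k) := by field_simp; ring
  rw [h4, h6, h8] at h2
  have h9 : 1 + (1 - μ) / (μ + k) / ((μ - 1) * (μ + k + 1) / (μ + k)) =
      (μ + k) / (μ + k + 1) := by
    field_simp
    ring
  rw [h9] at h2
  refine ⟨((μ + k) / (μ + k + 1)) ^ 2 * M, by positivity, ?_⟩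
  convert h2 using 1
  rw [← add_assoc]
  field_simp
  ring

end GrowthState

end

section

namespace GrowthState

variable {μ T : ℝ}

lemma exists_path_start (hT : 1 < T) (hT' : T ≤ 4 / 3) (hμ : μ = T + T⁻¹)
    (hβ : T ^ 2 + 1 ≤ (T ^ 2) ^ 3) :
    ∃ σ M, T⁻¹ ≤ σ ∧ σ < 1 ∧ 0 < M ∧ GrowthState μ σ⁻¹ M := by
  have hT0 : 0 < T := by linarith
  have hμT : μ * T = T ^ 2 + 1 := by rw [hμ]; field_simp
  have h2 : 2 < μ := by nlinarith [sq_nonneg (T - 1), mul_pos (sub_pos.2 hT) (sub_pos.2 hT)]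
  have hle : μ ≤ 25 / 12 := by nlinarith
  have hμi : μ * μ⁻¹ = 1 := mul_inv_cancel₀ (by linarith)
  have hi0 : 0 < μ⁻¹ := inv_pos.2 (by linarith)
  have hi1 : μ⁻¹ < 1 / 2 := by nlinarith
  set d := μ - μ⁻¹ with hd
  have hd1 : 3 / 2 < d := by linarith
  have hd2 : d < 1.61 := by rw [hd]; nlinarith
  have hdi : d * d⁻¹ = 1 := mul_inv_cancel₀ (by linarith)
  have hdi0 : 0 < d⁻¹ := inv_pos.2 (by linarith)
  have hdi1 : d⁻¹ < 2 / 3 := by nlinarith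
  obtain ⟨M, hM, hs⟩ := pos_path ⟨0, le_rfl, zero μ⟩ (by linarith)
  rw [sub_zero] at hs
  obtain ⟨M, hM, hs⟩ := pos_path ⟨M, hM.le, hs⟩ (by linarith)
  rw [← hd] at hs
  obtain ⟨M, hM, hs⟩ := pos_path ⟨M, hM.le, hs⟩ (by linarith)
  obtain ⟨M, hM, hs⟩ := pos_leaf ⟨M, hM, hs⟩ (by linarith) (by linarith)
  refine ⟨_, M, ?_, ?_, hM, hs⟩
  · have h3 : 0 < μ ^ 2 - 1 := by nlinarith
    have h4 : d⁻¹ = μ / (μ ^ 2 - 1) := by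
      rw [hd]; field_simp
    rw [h4]
    have h5 : μ - μ / (μ ^ 2 - 1) - μ⁻¹ - T⁻¹ = T - (2 * μ ^ 2 - 1) / (μ * (μ ^ 2 - 1)) := by
      have : μ - T⁻¹ = T := by rw [hμ]; ring
      have h6 : (2 * μ ^ 2 - 1) / (μ * (μ ^ 2 - 1)) = μ / (μ ^ 2 - 1) + μ⁻¹ := by
        field_simp; ring
      rw [h6]; linarith
    have h6 : (2 * μ ^ 2 - 1) / (μ * (μ ^ 2 - 1)) ≤ T := by
      have hpos : 0 < μ * (μ ^ 2 - 1) := mul_pos (by linarith) h3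
      rw [div_le_iff₀ hpos]
      have h7 : (2 * μ ^ 2 - 1) * T ^ 2 ≤ T * (μ * (μ ^ 2 - 1)) * T ^ 2 := by
        have e1 : (2 * μ ^ 2 - 1) * T ^ 2 = 2 * (μ * T) ^ 2 - T ^ 2 := by ring
        have e2 : T * (μ * (μ ^ 2 - 1)) * T ^ 2 = (μ * T) * ((μ * T) ^ 2 - T ^ 2) := by ring
        rw [e1, e2, hμT]
        nlinarith
      exact le_of_mul_le_mul_right h7 (by positivity)
    linarith
  · have : d - d⁻¹ < 1 := by nlinarith
    linarith

lemma exists_twin_start (hT : 4 / 3 ≤ T) (hT' : T ≤ 9 / 5) (hμ : μ = T + T⁻¹) :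
    ∃ σ M, T⁻¹ ≤ σ ∧ σ < 1 ∧ 0 < M ∧ GrowthState μ σ⁻¹ M := by
  have hT0 : 0 < T := by linarith
  have hμT : μ * T = T ^ 2 + 1 := by rw [hμ]; field_simp
  have hT1 : 0 < T - 1 := by linarith
  have h2 : 2 < μ := by nlinarith [mul_pos hT1 hT1]
  have hle : μ < 5 / 2 := by nlinarith
  have hμ0 : 0 < μ := by linarith
  have hμi : μ * μ⁻¹ = 1 := mul_inv_cancel₀ hμ0.ne'
  have hi0 : 0 < μ⁻¹ := inv_pos.2 hμ0
  obtain ⟨M, hM, hs⟩ := pos_path ⟨0, le_rfl, zero μ⟩ hμ0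
  have h0 : ∃ M, 0 < M ∧ GrowthState μ ((0 + 1) / (μ + 0)) M := by
    refine ⟨M, hM, ?_⟩
    convert hs using 1
    rw [sub_zero, add_zero, zero_add, one_div]
  obtain ⟨M, hM, hs⟩ := pos_twin (pos_twin (pos_twin h0 le_rfl h2.le) (by norm_num) h2.le)
    (by norm_num) h2.le
  have h3 : ((0 : ℝ) + 1 + 1 + 1 + 1) / (μ + (0 + 1 + 1 + 1)) = ((μ + 3) / 4)⁻¹ := by
    rw [inv_div]; norm_num
  rw [h3] at hs
  obtain ⟨M, hM, hs⟩ := pos_leaf ⟨M, hM, hs⟩ hμ0 (by nlinarith)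
  refine ⟨_, M, ?_, ?_, hM, hs⟩
  · have h4 : (μ + 3) / 4 - μ⁻¹ - T⁻¹ =
        (T ^ 4 + 3 * T ^ 3 - 6 * T ^ 2 + 3 * T - 3) / (4 * T * (T ^ 2 + 1)) := by
      have : μ = (T ^ 2 + 1) / T := by rw [eq_div_iff hT0.ne', hμT]
      rw [this]
      field_simp
      ring
    have h5 : 0 ≤ (T ^ 4 + 3 * T ^ 3 - 6 * T ^ 2 + 3 * T - 3) / (4 * T * (T ^ 2 + 1)) := by
      apply div_nonneg _ (by positivity)
      nlinarith [mul_nonneg (sub_nonneg.2 hT) (sub_nonneg.2 hT),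
        mul_nonneg (mul_nonneg (sub_nonneg.2 hT) (sub_nonneg.2 hT)) hT0.le, sq_nonneg (T ^ 2 - 1)]
    linarith
  · nlinarith

lemma exists_large (hT : 1 < T) (hμ : μ = T + T⁻¹) (hβ : T ^ 2 + 1 ≤ (T ^ 2) ^ 3) (B : ℝ) :
    ∃ κ, κ ≤ T ∧ GrowthState μ κ B := by
  have hT0 : 0 < T := by linarith
  have hTi : 0 < T⁻¹ := by positivity
  have hμT : μ * T = T ^ 2 + 1 := by rw [hμ]; field_simp
  have hμ' : μ = (T ^ 2 + 1) / T := by rw [eq_div_iff hT0.ne', hμT]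
  have hμ0 : 0 < μ := by rw [hμ]; linarith
  rcases le_total T (9 / 5) with hle | hle
  · obtain ⟨σ, M, hσ, hσ1, hM, hs⟩ : ∃ σ M, T⁻¹ ≤ σ ∧ σ < 1 ∧ 0 < M ∧ GrowthState μ σ⁻¹ M := by
      rcases le_total T (4 / 3) with h | h
      · exact exists_path_start hT h hμ hβ
      · exact exists_twin_start h hle hμ
    have hden : 0 < 2 * T ^ 2 - 2 * T + 1 := by nlinarith
    have hc : 1 < (μ - T ^ 3 / (2 * T ^ 2 - 2 * T + 1))⁻¹ := by
      have h1 : μ - T ^ 3 / (2 * T ^ 2 - 2 * T + 1) =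
          (T ^ 4 - 2 * T ^ 3 + 3 * T ^ 2 - 2 * T + 1) / (T * (2 * T ^ 2 - 2 * T + 1)) := by
        have h0 := hden.ne'
        rw [hμ']
        generalize hD : 2 * T ^ 2 - 2 * T + 1 = D at h0 ⊢
        field_simp
        subst hD
        ring
      rw [h1, one_lt_inv₀ (div_pos (by nlinarith [sq_nonneg (T ^ 2 - T)]) (by positivity)),
        div_lt_one (by positivity)]
      have h2 : T ^ 3 - 3 * T ^ 2 + 2 * T - 1 < 0 := by
        nlinarith [mul_nonneg (mul_nonneg hT0.le hT0.le) (sub_nonneg.2 hle)]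
      nlinarith [mul_pos (sub_pos.2 hT) (neg_pos.2 h2)]
    have hσ0 : 0 < σ := hTi.trans_le hσ
    have hσi : 1 < σ⁻¹ := (one_lt_inv₀ hσ0).2 hσ1
    set c₀ := min σ⁻¹ (μ - T ^ 3 / (2 * T ^ 2 - 2 * T + 1))⁻¹
    have hc₀ : 1 < c₀ := lt_min hσi hc
    obtain ⟨κ, hκ, hB⟩ := exists_unbounded (R := fun κ => c₀ ≤ κ ∧ κ ≤ T) (r := c₀ ^ 2)
      (one_lt_pow₀ hc₀ two_ne_zero) ⟨min_le_left _ _, inv_le_of_inv_le₀ hT0 hσ⟩ hM hs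
      (fun κ M hM hκ h => twin_round hT hμ hc₀ (min_le_right _ _) hM hκ.1 hκ.2 h) B
    exact ⟨κ, hκ.2, hB⟩
  · obtain ⟨M, hM, hs⟩ := pos_path ⟨0, le_rfl, zero μ⟩ hμ0
    have hc : 1 < (T⁻¹ + μ⁻¹)⁻¹ := by
      rw [one_lt_inv₀ (by positivity)]
      have h1 : T⁻¹ + μ⁻¹ = (2 * T ^ 2 + 1) / (T * (T ^ 2 + 1)) := by
        rw [hμ']; field_simp; ring
      rw [h1, div_lt_one (by positivity)]
      nlinarith [mul_nonneg (mul_nonneg hT0.le hT0.le) (sub_nonneg.2 hle)]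
    refine exists_unbounded (R := fun κ => κ ≤ T) (one_lt_pow₀ hc two_ne_zero) ?_ hM hs
      (fun κ M hM hκ h => leaf_round hT hμ hM hκ h) B
    rw [sub_zero]
    exact inv_le_of_inv_le₀ hT0 (by rw [hμ]; nlinarith)

end GrowthState

/-- Above `√β + 1/√β` the largest eigenvalues of signed graphs are dense. -/
lemma exists_signedGraph_between {β s μ c : ℝ} (hβ : β ^ 3 = β + 1) (hs : s = √β + (√β)⁻¹)
    (hμ : s < μ) (hc : c < μ) :
    ∃ (n : ℕ) (G : SignedGraph n), (∀ ν : ℝ, IsEigenvalue G.mat ν → ν ≤ μ) ∧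
      ¬ ∀ ν : ℝ, IsEigenvalue G.mat ν → ν ≤ c := by
  obtain ⟨-, -, hβ1, -⟩ := lamStar_sq hβ hs
  set q := √β with hq
  have hq2 : q ^ 2 = β := Real.sq_sqrt (by linarith)
  have hq1 : 1 < q := by rw [hq, Real.lt_sqrt] <;> linarith
  have hqi : q * q⁻¹ = 1 := mul_inv_cancel₀ (by linarith)
  have hs2 : 2 < s := by
    rw [hs]
    have : 0 < q⁻¹ := inv_pos.2 (by linarith)
    nlinarith [mul_pos this (mul_pos (sub_pos.2 hq1) (sub_pos.2 hq1))]
  set D := √(μ ^ 2 - 4) with hD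
  have hD0 : 0 < μ ^ 2 - 4 := by nlinarith
  have hD2 : D ^ 2 = μ ^ 2 - 4 := Real.sq_sqrt hD0.le
  have hDpos : 0 < D := Real.sqrt_pos.2 hD0
  set T := (μ + D) / 2 with hT
  have hT1 : 1 < T := by linarith
  have hTT : T ^ 2 + 1 = μ * T := by rw [hT]; nlinarith
  have hμT : μ = T + T⁻¹ := by field_simp; linarith
  have hqT : q < T := by
    by_contra! hle
    have h1 : 0 ≤ (q - T) * (q * T - 1) := mul_nonneg (by linarith) (by nlinarith)
    have h2 : q + q⁻¹ - (T + T⁻¹) = (q - T) * (q * T - 1) / (q * T) := by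
      field_simp; ring
    have h3 : 0 ≤ (q - T) * (q * T - 1) / (q * T) := div_nonneg h1 (by nlinarith)
    linarith
  have hβT : β ≤ T ^ 2 := by rw [← hq2]; gcongr
  have hβ3 : T ^ 2 + 1 ≤ (T ^ 2) ^ 3 := by
    have h1 : 0 ≤ (T ^ 2 - β) * ((T ^ 2) ^ 2 + T ^ 2 * β + β ^ 2 - 1) :=
      mul_nonneg (by linarith) (by nlinarith)
    nlinarith
  obtain ⟨κ, hκ, hstate⟩ := GrowthState.exists_large hT1 hμT hβ3 ((T + 1) / (μ - c))
  refine hstate.exists_signedGraph (c := c) ?_ hc.le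
  rw [mul_div_cancel₀ _ (by linarith)]
  linarith

lemma SignedEmbeds.refl {n : ℕ} (G : SignedGraph n) : SignedEmbeds G G :=
  ⟨id, Function.injective_id, fun _ _ => rfl⟩

lemma not_hasFiniteForbidden {β s c : ℝ} (hβ : β ^ 3 = β + 1) (hs : s = √β + (√β)⁻¹)
    (hc : s ≤ c) : ¬ HasFiniteForbiddenCharacterizationSigned
      (fun _ G => ∀ μ : ℝ, IsEigenvalue G.mat μ → μ ≤ c) := by
  rintro ⟨k, N, F, hF⟩
  have h1 : ∀ i, ∃ ν, IsEigenvalue (F i).mat ν ∧ c < ν := by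
    intro i
    by_contra! hno
    exact (hF _ (F i)).1 hno i (SignedEmbeds.refl _)
  choose ν hν hcν using h1
  obtain ⟨μ, hμ, hcμ⟩ : ∃ μ, (∀ i, μ < ν i) ∧ c < μ := by
    have h2 : ∀ᶠ μ in nhdsWithin c (Set.Ioi c), ∀ i, μ < ν i :=
      Filter.eventually_all.2 fun i => nhdsWithin_le_nhds (eventually_lt_nhds (hcν i))
    exact (h2.and self_mem_nhdsWithin).exists
  obtain ⟨n, G, hG, hGc⟩ := exists_signedGraph_between hβ hs (hc.trans_lt hcμ) hcμ
  refine hGc ((hF n G).2 fun i hi => ?_)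
  have h3 := (G.eigenvalues_le_iff_psdOn μ).1 hG
  have h4 := ((F i).eigenvalues_le_iff_psdOn μ).2 (SignedGraph.psdOn_of_embeds hi h3) _ (hν i)
  linarith [hμ i]

end

/-- The family of signed graphs whose largest eigenvalue is at most `λ` has a finite
forbidden subgraph characterization iff `λ < λ*`. -/
theorem signed_forbidden_characterization_largest_iff_lt_lamStar
    (βs lamStar : ℝ) (hβs : βs ^ 3 = βs + 1)
    (hstar : lamStar = Real.sqrt βs + (Real.sqrt βs)⁻¹) (lam : ℝ) :
    HasFiniteForbiddenCharacterizationSigned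
      (fun _ G => ∀ μ : ℝ, IsEigenvalue G.mat μ → μ ≤ lam) ↔ lam < lamStar := by
  constructor
  · intro h
    by_contra! hle
    exact not_hasFiniteForbidden hβs hstar hle h
  · intro h
    obtain ⟨N, hN⟩ := exists_card_bound hβs hstar h
    exact hasFiniteForbidden_of_bound hN
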